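/- Let α ∈ (1/4, 1/2) and let (λ_j)_{j≥1} be a sequence interlacing with 𝒩 such that log⟨Δ⟩_x / log log x → α as x → ∞, where ⟨Δ⟩_x = (1/#{k : λ_k ≤ x}) · Σ_{λ_k ≤ x} Δ_k. Let q > 1 satisfy (1 − log 2)/(2 − 4α) < q ≤ 1/(2 − 4α). Let G : (0,∞) → (0,∞) satisfy G(x)/√(log x) → ∞ and ⟨Δ⟩_x^{2q} · (1/x)·∫_x^{2x} τ_q(t, G(x)) dt = 1 for all large x, and set N(x) = 2π·G(x). Then there exist a full density set of indices J ⊆ ℕ and a constant c ∈ [½ log 2, 1] such that lim_{j∈J, j→∞} log m_q(λ_j)/log N(λ_j) = (1/(2α))·(1 − 1/(2q))·log 2, and lim sup_{j∈J, j→∞} (log m_q(λ_j) − q·log m_1(λ_j)) / ((1−q)·log N(λ_j)) = (1/(2α))·(1 − 1/(2q))·(2cq − log 2)/(q − 1). -/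

import Mathlib

open Filter Topology

noncomputable section

/-- The set of natural numbers expressible as a sum of two squares. -/
def SOS : Set ℕ := {n | ∃ x y : ℤ, (n : ℤ) = x ^ 2 + y ^ 2}

/-- `r₂(n)`, the number of representations of `n` as a sum of two squares. -/
def r2 (n : ℕ) : ℕ := Nat.card {p : ℤ × ℤ // p.1 ^ 2 + p.2 ^ 2 = (n : ℤ)}

/-- A set `J` of indices has full density if `#(J ∩ [1,k])/k → 1`. -/
def FullDensityIdx (J : Set ℕ) : Prop :=
  Tendsto (fun k : ℕ => (Nat.card ↥(J ∩ Set.Icc 1 k) : ℝ) / (k : ℝ)) atTop (𝓝 1)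

/-- The moment `m_q(λ) = Δ^{2q} ∑_{n ∈ 𝒩} r₂(n) |n − λ|^{−2q}`. -/
def mq (q lam Δ : ℝ) : ℝ :=
  Δ ^ (2 * q) * ∑' n : ℕ, (r2 n : ℝ) * |(n : ℝ) - lam| ^ (-(2 * q))

/-- The average `⟨Δ⟩_x = (1/#{k : λ_k ≤ x}) ∑_{λ_k ≤ x} Δ_k` (indices `k ≥ 1`). -/
def avgD (lam D : ℕ → ℝ) (x : ℝ) : ℝ :=
  (∑' k : {k : ℕ // 1 ≤ k ∧ lam k ≤ x}, D (k : ℕ)) /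
    (Nat.card {k : ℕ // 1 ≤ k ∧ lam k ≤ x} : ℝ)

/-- The tail `τ_q(t, G) = ∑_{m ∈ 𝒩, |m − t| ≥ G} r₂(m) |m − t|^{−2q}`. -/
def tauq (q t G : ℝ) : ℝ :=
  ∑' m : {m : ℕ // G ≤ |(m : ℝ) - t|}, (r2 (m : ℕ) : ℝ) * |((m : ℕ) : ℝ) - t| ^ (-(2 * q))

/-! ### Mertens' theorems for the primes in the residue classes modulo four -/

namespace TwoSquares

open Finset ArithmeticFunction

/-- The non-principal character modulo four, with real values. -/
def chi (n : ℕ) : ℝ := ((ZMod.χ₄ (n : ZMod 4) : ℤ) : ℝ)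

lemma chi_eq (n : ℕ) : chi n = if n % 2 = 0 then 0 else if n % 4 = 1 then 1 else -1 := by
  rw [chi, ZMod.χ₄_nat_eq_if_mod_four]
  split_ifs <;> simp

lemma chi_mul (m n : ℕ) : chi (m * n) = chi m * chi n := by
  rw [chi, chi, chi, Nat.cast_mul, map_mul, Int.cast_mul]

lemma abs_chi_le_one (n : ℕ) : |chi n| ≤ 1 := by
  rw [chi_eq]; split_ifs <;> simp

lemma sum_chi_mul_antitone_bounds (a : ℕ → ℝ) (r : ℕ) :
    ∀ M : ℕ, (∀ n, M < n → 0 ≤ a n ∧ a (n + 1) ≤ a n) →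
      ((M % 4 = 0 ∨ M % 4 = 3) → 0 ≤ ∑ n ∈ Ioc M (M + r), chi n * a n ∧
        ∑ n ∈ Ioc M (M + r), chi n * a n ≤ a (M + 1)) ∧
      ((M % 4 = 1 ∨ M % 4 = 2) → -a (M + 1) ≤ ∑ n ∈ Ioc M (M + r), chi n * a n ∧
        ∑ n ∈ Ioc M (M + r), chi n * a n ≤ 0) := by
  induction r with
  | zero =>
    intro M h
    have := (h (M + 1) (by lia)).1
    simp [this]
  | succ r ih =>
    intro M h
    have h1 := h (M + 1) (by lia)
    have h2 := h (M + 1 + 1) (by lia)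
    have ih' := ih (M + 1) (fun n hn => h n (by lia))
    have hs : ∑ n ∈ Ioc M (M + (r + 1)), chi n * a n =
        chi (M + 1) * a (M + 1) + ∑ n ∈ Ioc (M + 1) (M + 1 + r), chi n * a n := by
      rw [← Finset.insert_Ioc_add_one_left_eq_Ioc (by lia : M < M + (r + 1)), sum_insert (by simp)]
      rw [show M + (r + 1) = M + 1 + r by ring]
    rw [hs, chi_eq]
    constructor
    · rintro (hM | hM)
      · have := ih'.2 (by lia)
        rw [if_neg (by lia), if_pos (by lia)]
        constructor <;> linarith
      · have := ih'.1 (by lia)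
        rw [if_pos (by lia)]
        constructor <;> linarith
    · rintro (hM | hM)
      · have := ih'.2 (by lia)
        rw [if_pos (by lia)]
        constructor <;> linarith
      · have := ih'.1 (by lia)
        rw [if_neg (by lia), if_neg (by lia)]
        constructor <;> linarith

lemma abs_sum_chi_mul_le {a : ℕ → ℝ} {M N : ℕ} (hMN : M ≤ N)
    (h : ∀ n, M < n → 0 ≤ a n ∧ a (n + 1) ≤ a n) :
    |∑ n ∈ Ioc M N, chi n * a n| ≤ a (M + 1) := by
  obtain ⟨r, rfl⟩ := Nat.exists_eq_add_of_le hMN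
  have := sum_chi_mul_antitone_bounds a r M h
  have h1 := h (M + 1) (by lia)
  rw [abs_le]
  rcases (by lia : (M % 4 = 0 ∨ M % 4 = 3) ∨ (M % 4 = 1 ∨ M % 4 = 2)) with hM | hM
  · have := this.1 hM
    constructor <;> linarith
  · have := this.2 hM
    constructor <;> linarith

lemma abs_sum_chi_div_le {M N : ℕ} (hMN : M ≤ N) :
    |∑ n ∈ Ioc M N, chi n / n| ≤ 1 / ((M : ℝ) + 1) := by
  have := abs_sum_chi_mul_le (a := fun n => 1 / (n : ℝ)) hMN (fun n hn => by
    have : (0 : ℝ) < n := by exact_mod_cast (by lia : 0 < n)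
    refine ⟨by positivity, ?_⟩
    push_cast
    gcongr
    linarith)
  simpa [div_eq_mul_inv] using this

lemma sum_chi_div_ge {N : ℕ} (hN : 1 ≤ N) : 1 / 2 ≤ ∑ n ∈ Ioc 0 N, chi n / n := by
  have h := abs_sum_chi_div_le hN
  have hs : ∑ n ∈ Ioc 0 N, chi n / n = 1 + ∑ n ∈ Ioc 1 N, chi n / n := by
    rw [← Finset.insert_Ioc_add_one_left_eq_Ioc (by lia : 0 < N), sum_insert (by simp)]
    simp [chi_eq]
  rw [hs]
  rw [abs_le] at h
  norm_num at h ⊢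
  linarith [h.1]

lemma abs_sum_chi_log_div_le (N : ℕ) :
    |∑ n ∈ Ioc 0 N, chi n * (Real.log n / n)| ≤ 3 := by
  rcases le_or_gt N 2 with hN | hN
  · refine (abs_sum_le_sum_abs _ _).trans ?_
    have : ∀ n ∈ Ioc 0 N, |chi n * (Real.log n / n)| ≤ 1 := by
      intro n hn
      have hn0 : (0 : ℝ) < n := by exact_mod_cast (mem_Ioc.1 hn).1
      rw [abs_mul]
      have h1 : |Real.log n / n| ≤ 1 := by
        rw [abs_of_nonneg (div_nonneg (Real.log_natCast_nonneg n) hn0.le), div_le_one hn0]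
        linarith [Real.log_le_sub_one_of_pos hn0]
      nlinarith [abs_chi_le_one n, abs_nonneg (chi n), abs_nonneg (Real.log n / n)]
    refine (sum_le_card_nsmul _ _ _ this).trans ?_
    simp only [Nat.card_Ioc, tsub_zero, nsmul_eq_mul, mul_one]
    exact_mod_cast (by lia : N ≤ 3)
  · have hs : ∑ n ∈ Ioc 0 N, chi n * (Real.log n / n) =
        ∑ n ∈ Ioc 2 N, chi n * (Real.log n / n) := by
      rw [← Finset.insert_Ioc_add_one_left_eq_Ioc (by lia : 0 < N), sum_insert (by simp),
        ← Finset.insert_Ioc_add_one_left_eq_Ioc (by lia : 0 + 1 < N), sum_insert (by simp)]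
      simp [chi_eq]
    rw [hs]
    refine (abs_sum_chi_mul_le (a := fun n => Real.log n / n) (by lia) ?_).trans ?_
    · intro n hn
      refine ⟨by positivity, ?_⟩
      refine Real.log_div_self_antitoneOn ?_ ?_ (by simp)
      · have := Real.exp_one_lt_d9
        have h3 : (3 : ℝ) ≤ n := by exact_mod_cast hn
        show Real.exp 1 ≤ _
        linarith
      · have := Real.exp_one_lt_d9
        have h3 : (3 : ℝ) ≤ n := by exact_mod_cast hn
        show Real.exp 1 ≤ _
        push_cast
        linarith
    · norm_num
      have := Real.log_le_sub_one_of_pos (x := 3) (by norm_num)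
      linarith

/-- The constant in Chebyshev's upper bound. -/
def chebC : ℝ := Real.log 4 + 4

lemma chebC_pos : 0 < chebC := by
  have := Real.log_pos (by norm_num : (1 : ℝ) < 4)
  unfold chebC; linarith

lemma sum_vonMangoldt_le (N : ℕ) : ∑ n ∈ Ioc 0 N, Λ n ≤ chebC * N := by
  have := Chebyshev.psi_le_const_mul_self (Nat.cast_nonneg (α := ℝ) N)
  simpa [Chebyshev.psi, chebC] using this

lemma abs_sum_vonMangoldt_div_sub_log_le {N : ℕ} (hN : 1 ≤ N) :
    |∑ n ∈ Ioc 0 N, Λ n / n - Real.log N| ≤ chebC := by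
  have hN0 : (0 : ℝ) < N := by exact_mod_cast hN
  have key : ∑ n ∈ Ioc 0 N, Real.log n = ∑ n ∈ Ioc 0 N, Λ n * ((N / n : ℕ) : ℝ) := by
    have := sum_Ioc_mul_zeta_eq_sum Λ N
    rw [vonMangoldt_mul_zeta] at this
    simpa [log_apply] using this
  have hfac : ∑ n ∈ Ioc 0 N, Real.log n = Real.log (N.factorial) := by
    clear key hN hN0
    induction N with
    | zero => simp
    | succ n ih =>
      rw [Finset.sum_Ioc_succ_top (by lia), ih, Nat.factorial_succ]
      push_cast
      rw [Real.log_mul (by positivity) (by positivity), add_comm]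
  have hup : Real.log (N.factorial) ≤ N * Real.log N := by
    rw [← Real.log_pow]
    apply Real.log_le_log (by positivity)
    exact_mod_cast Nat.factorial_le_pow N
  have hlow : N * Real.log N - N ≤ Real.log (N.factorial) := by
    have h1 : (N : ℝ) ^ N / N.factorial ≤ Real.exp N :=
      Real.pow_div_factorial_le_exp N hN0.le N
    have h2 := Real.log_le_log (by positivity) h1
    rw [Real.log_div (by positivity) (by positivity), Real.log_pow, Real.log_exp] at h2
    linarith
  have h1 : ∑ n ∈ Ioc 0 N, Λ n * ((N / n : ℕ) : ℝ) ≤ N * ∑ n ∈ Ioc 0 N, Λ n / n := by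
    rw [mul_sum]
    refine sum_le_sum fun n hn => ?_
    have h3 : ((N / n : ℕ) : ℝ) ≤ N / n := Nat.cast_div_le
    calc Λ n * ((N / n : ℕ) : ℝ) ≤ Λ n * (N / n) := by gcongr
      _ = N * (Λ n / n) := by ring
  have h2 : N * ∑ n ∈ Ioc 0 N, Λ n / n ≤
      ∑ n ∈ Ioc 0 N, Λ n * ((N / n : ℕ) : ℝ) + chebC * N := by
    refine le_trans ?_ (add_le_add_right (sum_vonMangoldt_le N) _)
    rw [mul_sum, ← sum_add_distrib]
    refine sum_le_sum fun n hn => ?_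
    have hn0 : 0 < n := (mem_Ioc.1 hn).1
    have h3 : (N : ℝ) / n ≤ ((N / n : ℕ) : ℝ) + 1 := by
      rw [div_le_iff₀ (by exact_mod_cast hn0)]
      have := Nat.lt_div_mul_add (a := N) hn0
      have h4 : N ≤ (N / n + 1) * n := by lia
      exact_mod_cast h4
    calc N * (Λ n / n) = Λ n * (N / n) := by ring
      _ ≤ Λ n * (((N / n : ℕ) : ℝ) + 1) := by gcongr
      _ = _ := by ring
  have hc : (1 : ℝ) ≤ chebC := by
    have := Real.log_pos (by norm_num : (1 : ℝ) < 4)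
    unfold chebC; linarith
  set S := ∑ n ∈ Ioc 0 N, Λ n / n
  rw [← key, hfac] at h1 h2
  rw [abs_le]
  constructor
  · have : (N : ℝ) * (Real.log N - 1) ≤ N * S := by linarith
    have := le_of_mul_le_mul_left this hN0
    linarith
  · have : (N : ℝ) * S ≤ N * (Real.log N + chebC) := by linarith
    have := le_of_mul_le_mul_left this hN0
    linarith

lemma abs_sum_chi_vonMangoldt_div_le {N : ℕ} (hN : 1 ≤ N) :
    |∑ n ∈ Ioc 0 N, chi n * Λ n / n| ≤ 2 * (3 + chebC) := by
  have hN0 : (0 : ℝ) < N := by exact_mod_cast hN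
  let f : ArithmeticFunction ℝ := ⟨fun n => chi n * Λ n / n, by simp⟩
  let g : ArithmeticFunction ℝ := ⟨fun n => chi n / n, by simp⟩
  have hfg : ∀ n ∈ Ioc 0 N, (f * g) n = chi n * (Real.log n / n) := by
    intro n hn
    rw [ArithmeticFunction.mul_apply, ← vonMangoldt_sum, Nat.sum_divisorsAntidiagonal
      (fun i j => f i * g j), sum_div, mul_sum]
    refine sum_congr rfl fun d hd => ?_
    have hdvd := Nat.dvd_of_mem_divisors hd
    obtain ⟨e, rfl⟩ := hdvd
    have hde : 0 < d * e := (mem_Ioc.1 hn).1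
    have hd0 : 0 < d := Nat.pos_of_mul_pos_right hde
    rw [Nat.mul_div_cancel_left _ hd0, chi_mul]
    simp only [f, g, coe_mk]
    push_cast
    field_simp
  have key := sum_Ioc_mul_eq_sum_sum f g N
  rw [sum_congr rfl hfg] at key
  have hlog := abs_sum_chi_log_div_le N
  rw [key] at hlog
  set T : ℝ := ∑ n ∈ Ioc 0 N, chi n / n with hT
  have hT2 : 1 / 2 ≤ T := sum_chi_div_ge hN
  set S := ∑ n ∈ Ioc 0 N, chi n * Λ n / n with hS
  have hdiff : |S * T - ∑ n ∈ Ioc 0 N, f n * ∑ m ∈ Ioc 0 (N / n), g m| ≤ chebC := by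
    rw [hS, sum_mul, ← sum_sub_distrib]
    refine (abs_sum_le_sum_abs _ _).trans ?_
    have : ∀ n ∈ Ioc 0 N, |chi n * Λ n / n * T - f n * ∑ m ∈ Ioc 0 (N / n), g m| ≤ Λ n / N := by
      intro n hn
      have hn0 : 0 < n := (mem_Ioc.1 hn).1
      have hn0' : (0 : ℝ) < n := by exact_mod_cast hn0
      have hsplit : T = ∑ m ∈ Ioc 0 (N / n), g m + ∑ m ∈ Ioc (N / n) N, chi m / m := by
        rw [hT, ← Finset.sum_Ioc_consecutive _ (Nat.zero_le _) (Nat.div_le_self N n)]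
        rfl
      have h1 : chi n * Λ n / n * T - f n * ∑ m ∈ Ioc 0 (N / n), g m =
          chi n * (Λ n / n) * ∑ m ∈ Ioc (N / n) N, chi m / m := by
        rw [hsplit]; simp only [f, coe_mk]; ring
      rw [h1, abs_mul, abs_mul, abs_of_nonneg (div_nonneg vonMangoldt_nonneg hn0'.le)]
      have h2 := abs_sum_chi_div_le (Nat.div_le_self N n)
      have h3 : 1 / (((N / n : ℕ) : ℝ) + 1) ≤ n / N := by
        rw [div_le_div_iff₀ (by positivity) hN0]
        have := Nat.lt_div_mul_add (a := N) hn0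
        have h4 : 1 * N ≤ n * (N / n + 1) := by lia
        exact_mod_cast h4
      calc |chi n| * (Λ n / n) * |∑ m ∈ Ioc (N / n) N, chi m / m|
          ≤ 1 * (Λ n / n) * (n / N) := by
            have := abs_chi_le_one n
            have h5 : 0 ≤ Λ n / n := div_nonneg vonMangoldt_nonneg hn0'.le
            gcongr
            exact h2.trans h3
        _ = Λ n / N := by field_simp
    refine (sum_le_sum this).trans ?_
    rw [← sum_div, div_le_iff₀ hN0]
    exact sum_vonMangoldt_le N
  have h3 : |S * T| ≤ 3 + chebC := by
    rw [abs_le] at hlog hdiff ⊢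
    constructor <;> linarith
  rw [abs_mul, abs_of_pos (by linarith : 0 < T)] at h3
  nlinarith [abs_nonneg S]

/-- The primes up to `N` congruent to `i` modulo four. -/
def primesMod (i N : ℕ) : Finset ℕ := (Ioc 0 N).filter fun p => p.Prime ∧ p % 4 = i

lemma exists_sum_nonprime_le : ∃ C : ℝ, 0 ≤ C ∧ ∀ N : ℕ,
    ∑ n ∈ Ioc 0 N, (if n.Prime then 0 else Λ n) / n ≤ C := by
  have h := vonMangoldt.summable_residueClass_non_primes_div (q := 1) 0
  have hz : ∀ n : ℕ, vonMangoldt.residueClass (q := 1) 0 n = Λ n := by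
    intro n
    simp only [vonMangoldt.residueClass]
    rw [Set.indicator_of_mem]
    exact Subsingleton.elim _ _
  simp only [hz] at h
  have hnn : ∀ n : ℕ, 0 ≤ (if n.Prime then 0 else Λ n) / (n : ℝ) := by
    intro n
    split_ifs
    · simp
    · exact div_nonneg vonMangoldt_nonneg (Nat.cast_nonneg n)
  exact ⟨_, tsum_nonneg hnn, fun N => h.sum_le_tsum _ (fun n _ => hnn n)⟩

/-- Mertens' first theorem for the residue classes `1` and `3` modulo four. -/
lemma exists_abs_sum_log_div_sub_le {i : ℕ} (hi : i = 1 ∨ i = 3) : ∃ C : ℝ, 0 ≤ C ∧ ∀ N : ℕ, 1 ≤ N →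
    |∑ p ∈ primesMod i N, Real.log p / p - 1 / 2 * Real.log N| ≤ C := by
  obtain ⟨C, hC0, hC⟩ := exists_sum_nonprime_le
  have hcp := chebC_pos
  refine ⟨C + 1 + chebC + (3 + chebC), by positivity, fun N hN => ?_⟩
  have h1 := abs_sum_vonMangoldt_div_sub_log_le hN
  have h2 := abs_sum_chi_vonMangoldt_div_le hN
  set s : ℝ := if i = 1 then 1 else -1 with hs
  have hsabs : |s| = 1 := by rw [hs]; split_ifs <;> simp
  have hpt : ∀ n ∈ Ioc 0 N, |(if n.Prime ∧ n % 4 = i then Real.log n / n else 0) -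
      (1 / 2 * (Λ n / n) + s / 2 * (chi n * Λ n / n))| ≤
      (if n.Prime then 0 else Λ n) / n + (if n = 2 then 1 else 0) := by
    intro n hn
    have hn0 : (0 : ℝ) < n := by exact_mod_cast (mem_Ioc.1 hn).1
    by_cases hp : n.Prime
    · rw [if_pos hp, zero_div, zero_add]
      rw [vonMangoldt_apply_prime hp]
      rcases hp.eq_two_or_odd with rfl | hodd
      · have hlog : Real.log 2 ≤ 1 := by
          have := Real.log_le_sub_one_of_pos (x := 2) (by norm_num)
          linarith
        have hlog0 := Real.log_pos (x := 2) (by norm_num)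
        rw [if_neg (by rcases hi with rfl | rfl <;> simp)]
        simp only [chi_eq]
        norm_num
        rw [abs_of_pos (by positivity)]
        linarith
      · have h2 : n ≠ 2 := by rintro rfl; simp at hodd
        have hchi : chi n = if n % 4 = 1 then 1 else -1 := by rw [chi_eq, if_neg (by lia)]
        rw [if_neg h2, hchi]
        apply le_of_eq
        rw [abs_eq_zero, hs]
        rcases hi with rfl | rfl
        · by_cases h4 : n % 4 = 1
          · simp [hp, h4]; ring
          · simp [hp, h4]; ring
        · by_cases h4 : n % 4 = 1
          · simp [h4]; ring
          · have h43 : n % 4 = 3 := by lia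
            simp [hp, h43]; ring
    · simp only [hp, false_and, if_false]
      have h5 : 0 ≤ Λ n / n := div_nonneg vonMangoldt_nonneg hn0.le
      have h6 : |s / 2 * (chi n * Λ n / n)| ≤ 1 / 2 * (Λ n / n) := by
        rw [mul_div_assoc, abs_mul, abs_mul, abs_of_nonneg h5, abs_div, hsabs]
        have := abs_chi_le_one n
        norm_num
        nlinarith
      have h7 : (0 : ℝ) ≤ if n = 2 then 1 else 0 := by split_ifs <;> simp
      rw [abs_le] at h6 ⊢
      constructor <;> linarith
  have hsum : |∑ p ∈ primesMod i N, Real.log p / p -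
      (1 / 2 * ∑ n ∈ Ioc 0 N, Λ n / n + s / 2 * ∑ n ∈ Ioc 0 N, chi n * Λ n / n)| ≤ C + 1 := by
    rw [primesMod, sum_filter, mul_sum, mul_sum, ← sum_add_distrib, ← sum_sub_distrib]
    refine (abs_sum_le_sum_abs _ _).trans ((sum_le_sum hpt).trans ?_)
    rw [sum_add_distrib]
    refine add_le_add (hC N) ?_
    rw [sum_ite_eq']
    split_ifs <;> simp
  have h3 : |s / 2 * ∑ n ∈ Ioc 0 N, chi n * Λ n / n| ≤ 3 + chebC := by
    rw [abs_mul, abs_div, hsabs]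
    norm_num
    linarith
  rw [abs_le] at h1 h3 hsum ⊢
  constructor <;> linarith

lemma mem_primesMod {i N p : ℕ} : p ∈ primesMod i N ↔ p ≤ N ∧ p.Prime ∧ p % 4 = i := by
  simp only [primesMod, mem_filter, mem_Ioc]
  exact ⟨fun h => ⟨h.1.2, h.2⟩, fun h => ⟨⟨h.2.1.pos, h.1⟩, h.2⟩⟩

lemma sum_primesMod_succ (i N : ℕ) (f : ℕ → ℝ) :
    ∑ p ∈ primesMod i (N + 1), f p =
      ∑ p ∈ primesMod i N, f p + if (N + 1).Prime ∧ (N + 1) % 4 = i then f (N + 1) else 0 := by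
  rw [primesMod, primesMod, sum_filter, sum_filter, Finset.sum_Ioc_succ_top (by lia)]

/-- Mertens' second theorem for the residue classes `1` and `3` modulo four. -/
lemma exists_abs_sum_inv_sub_le {i : ℕ} (hi : i = 1 ∨ i = 3) : ∃ C : ℝ, 0 ≤ C ∧ ∀ N : ℕ, 2 ≤ N →
    |∑ p ∈ primesMod i N, 1 / (p : ℝ) - 1 / 2 * Real.log (Real.log N)| ≤ C := by
  obtain ⟨C, hC0, hC⟩ := exists_abs_sum_log_div_sub_le hi
  have hl2 : 0 < Real.log 2 := Real.log_pos (by norm_num)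
  set E : ℕ → ℝ := fun N => ∑ p ∈ primesMod i N, Real.log p / p - 1 / 2 * Real.log N with hE
  set U : ℕ → ℝ := fun N => ∑ p ∈ primesMod i N, 1 / (p : ℝ) - 1 / 2 * Real.log (Real.log N) -
    E N / Real.log N with hU
  have key : ∀ N : ℕ, 2 ≤ N → |U N - U 2| ≤ (C + 1) * (1 / Real.log 2 - 1 / Real.log N) := by
    intro N hN
    induction N, hN using Nat.le_induction with
    | base => simp
    | succ N hN ih =>
      have hN' : (2 : ℝ) ≤ N := by exact_mod_cast hN
      set u := Real.log N with hu
      set v := Real.log ((N + 1 : ℕ) : ℝ) with hv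
      have hu0 : 0 < u := Real.log_pos (by linarith)
      have huv : u ≤ v := Real.log_le_log (by linarith) (by push_cast; linarith)
      have hv0 : 0 < v := hu0.trans_le huv
      have huv1 : v - u ≤ 1 := by
        rw [hu, hv, ← Real.log_div (by positivity) (by positivity)]
        refine (Real.log_le_sub_one_of_pos (by positivity)).trans ?_
        rw [sub_le_iff_le_add, div_le_iff₀ (by linarith)]
        push_cast
        linarith
      have hS : ∑ p ∈ primesMod i (N + 1), 1 / (p : ℝ) - ∑ p ∈ primesMod i N, 1 / (p : ℝ) =
          (E (N + 1) - E N + 1 / 2 * (v - u)) / v := by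
        simp only [hE]
        rw [sum_primesMod_succ, sum_primesMod_succ]
        split_ifs with h
        · rw [← hv, ← hu]
          field_simp
          ring
        · rw [← hv, ← hu]
          field_simp
          ring
      have hlog1 : Real.log v - Real.log u ≤ (v - u) / u := by
        rw [← Real.log_div hv0.ne' hu0.ne']
        refine (Real.log_le_sub_one_of_pos (by positivity)).trans (le_of_eq ?_)
        field_simp
      have hlog2 : (v - u) / v ≤ Real.log v - Real.log u := by
        have := Real.log_le_sub_one_of_pos (x := u / v) (by positivity)
        rw [Real.log_div hu0.ne' hv0.ne'] at this
        have h2 : (v - u) / v = 1 - u / v := by field_simp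
        linarith
      have hdiff : U (N + 1) - U N = E N * (1 / u - 1 / v) +
          1 / 2 * ((v - u) / v - (Real.log v - Real.log u)) := by
        have : U (N + 1) - U N = (∑ p ∈ primesMod i (N + 1), 1 / (p : ℝ) -
            ∑ p ∈ primesMod i N, 1 / (p : ℝ)) - 1 / 2 * (Real.log v - Real.log u) -
            (E (N + 1) / v - E N / u) := by
          simp only [hU]
          ring
        rw [this, hS]
        field_simp
        ring
      have hw : 0 ≤ 1 / u - 1 / v := sub_nonneg.2 (one_div_le_one_div_of_le hu0 huv)
      have hsq : (v - u) / u - (v - u) / v ≤ 1 / u - 1 / v := by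
        have : (v - u) / u - (v - u) / v = (v - u) * (1 / u - 1 / v) := by ring
        rw [this]
        nlinarith
      have hEN := hC N (by lia)
      have h1 : |E N * (1 / u - 1 / v)| ≤ C * (1 / u - 1 / v) := by
        rw [abs_mul, abs_of_nonneg hw]
        exact mul_le_mul_of_nonneg_right hEN hw
      rw [abs_le] at h1 ih ⊢
      constructor <;> linarith
  refine ⟨|U 2| + (C + 1) / Real.log 2 + C / Real.log 2, by positivity, fun N hN => ?_⟩
  have hN' : (2 : ℝ) ≤ N := by exact_mod_cast hN
  have hlN : Real.log 2 ≤ Real.log N := Real.log_le_log (by norm_num) hN'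
  have hk := key N hN
  have hE1 : |E N / Real.log N| ≤ C / Real.log 2 := by
    rw [abs_div, abs_of_pos (hl2.trans_le hlN)]
    exact div_le_div₀ hC0 (hC N (by lia)) hl2 hlN
  have h0 : 0 < 1 / Real.log N := by have := hl2.trans_le hlN; positivity
  have h3 : (C + 1) * (1 / Real.log 2 - 1 / Real.log N) ≤ (C + 1) / Real.log 2 := by
    have : (C + 1) / Real.log 2 = (C + 1) * (1 / Real.log 2) := by ring
    nlinarith
  have h4 : ∑ p ∈ primesMod i N, 1 / (p : ℝ) - 1 / 2 * Real.log (Real.log N) =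
      (U N - U 2) + U 2 + E N / Real.log N := by simp only [hU]; ring
  rw [h4]
  refine (abs_add_le _ _).trans (add_le_add ((abs_add_le _ _).trans ?_) hE1)
  linarith

/-- There are many primes `≡ 1 (mod 4)` in the intervals `(M, BM]`. -/
lemma exists_card_primesMod_ge : ∃ B : ℕ, 2 ≤ B ∧ ∀ M : ℕ, 1 ≤ M →
    (M : ℝ) / Real.log (B * M) ≤ (((primesMod 1 (B * M)).filter (M < ·)).card : ℝ) := by
  obtain ⟨C, hC0, hC⟩ := exists_abs_sum_log_div_sub_le (Or.inl rfl : (1 : ℕ) = 1 ∨ 1 = 3)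
  set B := ⌈Real.exp (4 * C + 2)⌉₊ with hB
  have hBe : Real.exp (4 * C + 2) ≤ B := Nat.le_ceil _
  have hB2 : (2 : ℝ) ≤ B := by
    have := Real.add_one_le_exp (4 * C + 2)
    linarith
  refine ⟨B, by exact_mod_cast hB2, fun M hM => ?_⟩
  have hM1 : (1 : ℝ) ≤ M := by exact_mod_cast hM
  have hlB : 4 * C + 2 ≤ Real.log B := by rwa [Real.le_log_iff_exp_le (by linarith)]
  have hBM : (2 : ℝ) ≤ B * M := by nlinarith
  have hlog : 0 < Real.log (B * M) := Real.log_pos (by linarith)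
  have hB1 : 1 ≤ B := by exact_mod_cast (by linarith : (1 : ℝ) ≤ B)
  have hsplit : ∑ p ∈ primesMod 1 (B * M), Real.log p / p = ∑ p ∈ primesMod 1 M, Real.log p / p +
      ∑ p ∈ (primesMod 1 (B * M)).filter (M < ·), Real.log p / p := by
    rw [← sum_filter_add_sum_filter_not (primesMod 1 (B * M)) (fun p => M < p), add_comm]
    congr 1
    apply sum_congr _ (fun _ _ => rfl)
    ext p
    rw [mem_filter, mem_primesMod, mem_primesMod]
    have : M ≤ B * M := Nat.le_mul_of_pos_left M hB1
    constructor
    · rintro ⟨⟨_, h⟩, h'⟩; exact ⟨by lia, h⟩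
    · rintro ⟨h', h⟩; exact ⟨⟨by lia, h⟩, by lia⟩
  have h1 := hC M hM
  have h2 := hC (B * M) (Nat.mul_pos hB1 hM)
  rw [hsplit, Nat.cast_mul, Real.log_mul (by positivity) (by positivity)] at h2
  have hge : 1 ≤ ∑ p ∈ (primesMod 1 (B * M)).filter (M < ·), Real.log p / p := by
    rw [abs_le] at h1 h2
    linarith
  have hle : ∑ p ∈ (primesMod 1 (B * M)).filter (M < ·), Real.log p / p ≤
      ((primesMod 1 (B * M)).filter (M < ·)).card • (Real.log (B * M) / M) := by
    apply sum_le_card_nsmul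
    intro p hp
    rw [mem_filter, mem_primesMod] at hp
    have hp0 : (0 : ℝ) < p := by exact_mod_cast hp.1.2.1.pos
    have hMp : (M : ℝ) ≤ p := by exact_mod_cast hp.2.le
    refine div_le_div₀ hlog.le (Real.log_le_log hp0 ?_) (by linarith) hMp
    exact_mod_cast hp.1.1
  rw [nsmul_eq_mul] at hle
  have := hge.trans hle
  rw [div_le_iff₀ hlog]
  rw [← mul_div_assoc, le_div_iff₀ (by linarith)] at this
  linarith

end TwoSquares

/-! ### Representations as sums of two squares -/

namespace TwoSquares

open Finset

/-- The Gaussian integers of norm `n`. -/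
def normEq (n : ℕ) : Set GaussianInt := {z | z.norm = n}

lemma mem_normEq {n : ℕ} {z : GaussianInt} : z ∈ normEq n ↔ z.norm = n := Iff.rfl

lemma norm_eq_sq (z : GaussianInt) : z.norm = z.re ^ 2 + z.im ^ 2 := by
  rw [Zsqrtd.norm_def]; ring

/-- The representations of `n` correspond to the Gaussian integers of norm `n`. -/
def reprEquiv (n : ℕ) : {p : ℤ × ℤ // p.1 ^ 2 + p.2 ^ 2 = (n : ℤ)} ≃ normEq n where
  toFun p := ⟨⟨p.1.1, p.1.2⟩, by rw [mem_normEq, norm_eq_sq]; exact p.2⟩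
  invFun z := ⟨(z.1.re, z.1.im), by have := z.2; rw [mem_normEq, norm_eq_sq] at this; exact this⟩
  left_inv _ := rfl
  right_inv _ := rfl

lemma r2_eq_ncard (n : ℕ) : r2 n = (normEq n).ncard := by
  rw [r2, Nat.card_congr (reprEquiv n), Nat.card_coe_set_eq]

lemma normEq_finite (n : ℕ) : (normEq n).Finite := by
  have hf : ((Set.Icc (-(n : ℤ)) n) ×ˢ (Set.Icc (-(n : ℤ)) n)).Finite :=
    (Set.finite_Icc _ _).prod (Set.finite_Icc _ _)
  refine (hf.preimage (f := fun z : GaussianInt => (z.re, z.im)) ?_).subset ?_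
  · intro a _ b _ h
    simp only [Prod.mk.injEq] at h
    exact Zsqrtd.ext h.1 h.2
  · intro z hz
    rw [mem_normEq, norm_eq_sq] at hz
    simp only [Set.mem_preimage, Set.mem_prod, Set.mem_Icc]
    refine ⟨⟨?_, ?_⟩, ?_, ?_⟩ <;> nlinarith [sq_nonneg z.re, sq_nonneg z.im]

lemma mem_SOS_iff {n : ℕ} : n ∈ SOS ↔ (normEq n).Nonempty := by
  constructor
  · rintro ⟨x, y, h⟩
    exact ⟨⟨x, y⟩, by rw [mem_normEq, norm_eq_sq, h]⟩
  · rintro ⟨z, hz⟩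
    rw [mem_normEq, norm_eq_sq] at hz
    exact ⟨z.re, z.im, hz.symm⟩

lemma r2_pos_iff {n : ℕ} : 0 < r2 n ↔ n ∈ SOS := by
  rw [r2_eq_ncard, Set.ncard_pos (normEq_finite n), mem_SOS_iff]

lemma r2_eq_zero {n : ℕ} (h : n ∉ SOS) : r2 n = 0 := by
  rw [← r2_pos_iff] at h; lia

lemma prime_of_norm_prime {p : ℕ} (hp : p.Prime) {w : GaussianInt} (hw : w.norm = p) : Prime w := by
  rw [← irreducible_iff_prime]
  constructor
  · intro hu
    rw [← Zsqrtd.norm_eq_one_iff, hw] at hu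
    exact hp.one_lt.ne' (by simpa using hu)
  · intro a b hab
    have h : a.norm.natAbs * b.norm.natAbs = p := by
      rw [← Int.natAbs_mul, ← Zsqrtd.norm_mul, ← hab, hw]; simp
    rw [← Zsqrtd.norm_eq_one_iff, ← Zsqrtd.norm_eq_one_iff]
    rcases (Nat.dvd_prime hp).1 (Dvd.intro _ h) with h1 | h1
    · exact Or.inl h1
    · refine Or.inr ?_
      rw [h1] at h
      exact Nat.eq_of_mul_eq_mul_left hp.pos (by lia)

lemma exists_norm_eq {p : ℕ} (hp : p.Prime) (h3 : p % 4 ≠ 3) : ∃ w : GaussianInt, w.norm = p := by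
  have := Fact.mk hp
  obtain ⟨a, b, h⟩ := Nat.Prime.sq_add_sq h3
  exact ⟨⟨a, b⟩, by rw [norm_eq_sq]; simp only; exact_mod_cast h⟩

lemma dvd_or_star_dvd {p : ℕ} (hp : p.Prime) {w z : GaussianInt} (hw : w.norm = p)
    (h : (p : ℤ) ∣ z.norm) : w ∣ z ∨ star w ∣ z := by
  have h1 : w ∣ z * star z := by
    obtain ⟨k, hk⟩ := h
    have : z * star z = w * (star w * k) := by
      rw [← mul_assoc, ← Zsqrtd.norm_eq_mul_conj, ← Zsqrtd.norm_eq_mul_conj, hk, hw]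
      push_cast; ring
    rw [this]; exact Dvd.intro _ rfl
  rcases (prime_of_norm_prime hp hw).dvd_or_dvd h1 with h | h
  · exact Or.inl h
  · right
    obtain ⟨k, hk⟩ := h
    exact ⟨star k, by rw [← star_star z, hk]; simp⟩

lemma norm_star (w : GaussianInt) : (star w).norm = w.norm := Zsqrtd.norm_conj w

lemma normEq_cover {p : ℕ} (hp : p.Prime) {w : GaussianInt} (hw : w.norm = p) (k m : ℕ) :
    ∀ z ∈ normEq (p ^ k * m), ∃ i ∈ range (k + 1), ∃ u ∈ normEq m,
      z = w ^ i * star w ^ (k - i) * u := by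
  have hp0 : (p : ℤ) ≠ 0 := by exact_mod_cast hp.ne_zero
  induction k with
  | zero => intro z hz; exact ⟨0, by simp, z, by simpa using hz, by simp⟩
  | succ k ih =>
    intro z hz
    rw [mem_normEq] at hz
    have hd : (p : ℤ) ∣ z.norm := by rw [hz]; push_cast; exact ⟨p ^ k * m, by ring⟩
    rcases dvd_or_star_dvd hp hw hd with ⟨v, rfl⟩ | ⟨v, rfl⟩
    · have hv : v ∈ normEq (p ^ k * m) := by
        rw [Zsqrtd.norm_mul, hw] at hz
        rw [mem_normEq]
        apply mul_left_cancel₀ hp0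
        rw [hz]; push_cast; ring
      obtain ⟨i, hi, u, hu, rfl⟩ := ih v hv
      refine ⟨i + 1, by simp at hi ⊢; lia, u, hu, ?_⟩
      rw [show k + 1 - (i + 1) = k - i by lia]; ring
    · have hv : v ∈ normEq (p ^ k * m) := by
        rw [Zsqrtd.norm_mul, norm_star, hw] at hz
        rw [mem_normEq]
        apply mul_left_cancel₀ hp0
        rw [hz]; push_cast; ring
      obtain ⟨i, hi, u, hu, rfl⟩ := ih v hv
      rw [mem_range] at hi
      refine ⟨i, by simp; lia, u, hu, ?_⟩
      rw [show k + 1 - i = (k - i) + 1 by lia]; ring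

lemma r2_prime_pow_mul_le {p : ℕ} (hp : p.Prime) (h3 : p % 4 ≠ 3) (k m : ℕ) :
    r2 (p ^ k * m) ≤ (k + 1) * r2 m := by
  obtain ⟨w, hw⟩ := exists_norm_eq hp h3
  rw [r2_eq_ncard, r2_eq_ncard, Set.ncard_eq_toFinset_card _ (normEq_finite _),
    Set.ncard_eq_toFinset_card _ (normEq_finite _)]
  have : (normEq_finite (p ^ k * m)).toFinset ⊆ (range (k + 1)).biUnion fun i =>
      ((normEq_finite m).toFinset.image fun u => w ^ i * star w ^ (k - i) * u) := by
    intro z hz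
    obtain ⟨i, hi, u, hu, h⟩ := normEq_cover hp hw k m z (by simpa using hz)
    simp only [mem_biUnion, mem_image, Set.Finite.mem_toFinset]
    exact ⟨i, hi, u, hu, h.symm⟩
  refine (card_le_card this).trans (card_biUnion_le.trans ?_)
  refine (sum_le_sum fun i _ => card_image_le).trans ?_
  simp

lemma dvd_of_prime_mod_three {p : ℕ} (hp : p.Prime) (h3 : p % 4 = 3) {z : GaussianInt}
    (h : (p : ℤ) ∣ z.norm) : (p : GaussianInt) ∣ z := by
  have := Fact.mk hp
  have hpr := GaussianInt.prime_of_nat_prime_of_mod_four_eq_three p h3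
  have h1 : (p : GaussianInt) ∣ z * star z := by
    rw [← Zsqrtd.norm_eq_mul_conj]
    obtain ⟨k, hk⟩ := h
    exact ⟨k, by rw [hk]; push_cast; ring⟩
  rcases hpr.dvd_or_dvd h1 with h | h
  · exact h
  · obtain ⟨k, hk⟩ := h
    exact ⟨star k, by rw [← star_star z, hk]; simp [mul_comm]⟩

lemma norm_natCast_mul (p : ℕ) (v : GaussianInt) :
    ((p : GaussianInt) * v).norm = (p : ℤ) ^ 2 * v.norm := by
  rw [Zsqrtd.norm_mul, Zsqrtd.norm_natCast]; ring

/-- A prime `≡ 3 (mod 4)` dividing a sum of two squares divides it twice. -/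
lemma sq_dvd_of_mem_SOS {p n : ℕ} (hp : p.Prime) (h3 : p % 4 = 3) (hn : n ∈ SOS) (h : p ∣ n) :
    p ^ 2 ∣ n := by
  obtain ⟨z, hz⟩ := mem_SOS_iff.1 hn
  rw [mem_normEq] at hz
  obtain ⟨v, rfl⟩ := dvd_of_prime_mod_three hp h3 (z := z) (by rw [hz]; exact_mod_cast h)
  rw [norm_natCast_mul] at hz
  have : ((p ^ 2 : ℕ) : ℤ) ∣ (n : ℤ) := ⟨v.norm, by rw [← hz]; push_cast; ring⟩
  exact_mod_cast this

lemma r2_sq_mul_le {p : ℕ} (hp : p.Prime) (h3 : p % 4 = 3) (m : ℕ) : r2 (p ^ 2 * m) ≤ r2 m := by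
  have hp0 : (p : ℤ) ^ 2 ≠ 0 := by have := hp.ne_zero; positivity
  rw [r2_eq_ncard, r2_eq_ncard]
  have : normEq (p ^ 2 * m) ⊆ (fun v : GaussianInt => (p : GaussianInt) * v) '' normEq m := by
    intro z hz
    rw [mem_normEq] at hz
    obtain ⟨v, rfl⟩ := dvd_of_prime_mod_three hp h3 (z := z)
      (by rw [hz]; push_cast; exact ⟨p * m, by ring⟩)
    refine ⟨v, ?_, rfl⟩
    rw [norm_natCast_mul] at hz
    rw [mem_normEq]
    apply mul_left_cancel₀ hp0
    rw [hz]; push_cast; ring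
  exact (Set.ncard_le_ncard this ((normEq_finite m).image _)).trans
    (Set.ncard_image_le (normEq_finite m))

lemma r2_one_le : r2 1 ≤ 4 := by
  rw [r2_eq_ncard]
  have : normEq 1 ⊆ (({⟨1, 0⟩, ⟨-1, 0⟩, ⟨0, 1⟩, ⟨0, -1⟩} : Finset GaussianInt) : Set GaussianInt) := by
    intro z hz
    rw [mem_normEq, norm_eq_sq] at hz
    have h1 : z.re ≤ 1 := by push_cast at hz; nlinarith [sq_nonneg z.im]
    have h2 : -1 ≤ z.re := by push_cast at hz; nlinarith [sq_nonneg z.im]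
    have h3 : z.im ≤ 1 := by push_cast at hz; nlinarith [sq_nonneg z.re]
    have h4 : -1 ≤ z.im := by push_cast at hz; nlinarith [sq_nonneg z.re]
    obtain ⟨x, y⟩ := z
    simp only at hz h1 h2 h3 h4
    interval_cases x <;> interval_cases y <;> simp_all
  refine (Set.ncard_le_ncard this (Finset.finite_toSet _)).trans ?_
  rw [Set.ncard_coe_finset]
  exact Finset.card_le_four

lemma r2_le_four_of_primes {n : ℕ} (hn : 1 ≤ n) (h : ∀ p, p.Prime → p ∣ n → p % 4 = 3) :
    r2 n ≤ 4 := by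
  induction n using Nat.strong_induction_on with
  | _ n ih =>
    rcases hn.eq_or_lt with rfl | hn1
    · exact r2_one_le
    by_cases hS : n ∈ SOS
    · obtain ⟨p, hp, hpn⟩ := Nat.exists_prime_and_dvd (by lia : n ≠ 1)
      have h3 := h p hp hpn
      obtain ⟨m, rfl⟩ := sq_dvd_of_mem_SOS hp h3 hS hpn
      have hm : 1 ≤ m := Nat.pos_of_ne_zero (by rintro rfl; simp at hn)
      refine (r2_sq_mul_le hp h3 m).trans (ih m ?_ hm fun q hq hqm => h q hq (hqm.mul_left _))
      have : 1 < p ^ 2 := Nat.one_lt_pow (by norm_num) hp.one_lt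
      nlinarith
    · rw [r2_eq_zero hS]; norm_num

/-- The product of `v_p(n) + 1` over a finite set of primes. -/
def tauOn (Q : Finset ℕ) (n : ℕ) : ℕ := ∏ p ∈ Q, (n.factorization p + 1)

lemma factorization_pow_mul_of_ne {p q k m : ℕ} (hp : p.Prime) (hpq : q ≠ p) (hm : m ≠ 0) :
    (p ^ k * m).factorization q = m.factorization q := by
  rw [Nat.factorization_mul (pow_ne_zero _ hp.ne_zero) hm, Nat.factorization_pow,
    hp.factorization]
  simp [hpq.symm]

lemma factorization_pow_mul_self {p k m : ℕ} (hp : p.Prime) (hm : ¬ p ∣ m) :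
    (p ^ k * m).factorization p = k := by
  have hm0 : m ≠ 0 := by rintro rfl; simp at hm
  rw [Nat.factorization_mul (pow_ne_zero _ hp.ne_zero) hm0, Nat.factorization_pow,
    hp.factorization]
  simp [Nat.factorization_eq_zero_of_not_dvd hm]

lemma r2_le_tauOn {Q : Finset ℕ} (hQ : ∀ p ∈ Q, p.Prime ∧ p % 4 ≠ 3) :
    ∀ n : ℕ, 1 ≤ n → (∀ p, p.Prime → p ∣ n → p % 4 ≠ 3 → p ∈ Q) → r2 n ≤ 4 * tauOn Q n := by
  induction Q using Finset.induction_on with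
  | empty =>
    intro n hn h
    simpa [tauOn] using r2_le_four_of_primes hn fun p hp hpn => by
      by_contra h3
      exact absurd (h p hp hpn h3) (by simp)
  | insert p Q hpQ ih =>
    intro n hn h
    obtain ⟨hp, h3⟩ := hQ p (by simp)
    obtain ⟨k, m, hm, rfl⟩ := Nat.exists_eq_pow_mul_and_not_dvd (by lia : n ≠ 0) p hp.ne_one
    have hm0 : m ≠ 0 := by rintro rfl; simp at hm
    have h1 := ih (fun q hq => hQ q (by simp [hq])) m (by lia) fun q hq hqm hq3 => by
      have := h q hq (hqm.mul_left _) hq3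
      rw [mem_insert] at this
      rcases this with rfl | h
      · exact absurd hqm hm
      · exact h
    have h2 : tauOn Q (p ^ k * m) = tauOn Q m := by
      apply prod_congr rfl
      intro q hq
      rw [factorization_pow_mul_of_ne hp (by rintro rfl; exact hpQ hq) hm0]
    have h4 : tauOn (insert p Q) (p ^ k * m) = (k + 1) * tauOn Q (p ^ k * m) := by
      rw [tauOn, prod_insert hpQ, factorization_pow_mul_self hp hm, tauOn]
    rw [h4, h2]
    calc _ ≤ (k + 1) * r2 m := r2_prime_pow_mul_le hp h3 k m
      _ ≤ (k + 1) * (4 * tauOn Q m) := Nat.mul_le_mul_left _ h1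
      _ = _ := by ring

lemma not_dvd_star {p : ℕ} (hp : p.Prime) (h1 : p % 4 = 1) {w : GaussianInt} (hw : w.norm = p) :
    ¬ w ∣ star w := by
  intro hd
  have hre : w ∣ ((2 * w.re : ℤ) : GaussianInt) := by
    have : ((2 * w.re : ℤ) : GaussianInt) = w + star w := by
      apply Zsqrtd.ext <;> simp
      ring
    rw [this]; exact dvd_add dvd_rfl hd
  obtain ⟨v, hv⟩ := hre
  have hn : (2 * w.re) * (2 * w.re) = p * v.norm := by
    rw [← hw, ← Zsqrtd.norm_mul, ← hv, Zsqrtd.norm_intCast]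
  have hpp : Prime (p : ℤ) := Nat.prime_iff_prime_int.1 hp
  have hdv : (p : ℤ) ∣ w.re := by
    have : (p : ℤ) ∣ 2 * w.re := by
      rcases hpp.dvd_or_dvd (Dvd.intro _ hn.symm) with h | h <;> exact h
    rcases hpp.dvd_or_dvd this with h | h
    · have := Int.le_of_dvd (by norm_num) h
      have h2 := hp.two_le
      lia
    · exact h
  rw [norm_eq_sq] at hw
  obtain ⟨c, hc⟩ := hdv
  have hp1 : (1 : ℤ) < p := by exact_mod_cast hp.one_lt
  by_cases hc0 : c = 0
  · rw [hc, hc0] at hw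
    simp at hw
    have h2 : (p : ℤ) ∣ w.im := hpp.dvd_of_dvd_pow (n := 2) (by rw [hw])
    obtain ⟨d, hd⟩ := h2
    rw [hd] at hw
    have : (p : ℤ) * d ^ 2 = 1 := by
      apply mul_left_cancel₀ (by lia : (p : ℤ) ≠ 0)
      linear_combination hw
    have := Int.le_of_dvd (by norm_num) (Dvd.intro _ this)
    lia
  · have : 1 ≤ c ^ 2 := by have := sq_pos_of_ne_zero hc0; lia
    rw [hc, mul_pow] at hw
    nlinarith [sq_nonneg w.im, mul_le_mul_of_nonneg_left this (sq_nonneg (p : ℤ))]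

lemma two_mul_r2_le {p : ℕ} (hp : p.Prime) (h1 : p % 4 = 1) {k m : ℕ} (hk : k ≠ 0)
    (hm : ¬ p ∣ m) : 2 * r2 m ≤ r2 (p ^ k * m) := by
  obtain ⟨w, hw⟩ := exists_norm_eq hp (by lia)
  have hwp := prime_of_norm_prime hp hw
  have hsw : (star w).norm = p := by rw [norm_star, hw]
  have hsp := prime_of_norm_prime hp hsw
  have hnorm : ∀ (w : GaussianInt) (j : ℕ), (w ^ j).norm = w.norm ^ j := fun w j =>
    map_pow (Zsqrtd.normMonoidHom) w j
  have himg : ∀ w' : GaussianInt, w'.norm = p → (fun u => w' ^ k * u) '' normEq m ⊆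
      normEq (p ^ k * m) := by
    rintro w' hw' _ ⟨u, hu, rfl⟩
    rw [mem_normEq] at hu ⊢
    simp only [Zsqrtd.norm_mul, hnorm, hw', hu]
    push_cast; ring
  have hdisj : Disjoint ((fun u => w ^ k * u) '' normEq m)
      ((fun u => star w ^ k * u) '' normEq m) := by
    rw [Set.disjoint_left]
    rintro _ ⟨u, hu, rfl⟩ ⟨v, hv, huv⟩
    simp only at huv
    have hd : w ∣ star w ^ k * v := by
      rw [huv]; exact (dvd_pow_self w hk).mul_right u
    rcases hwp.dvd_or_dvd hd with h | h
    · exact not_dvd_star hp h1 hw (hwp.dvd_of_dvd_pow h)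
    · obtain ⟨c, rfl⟩ := h
      rw [mem_normEq, Zsqrtd.norm_mul, hw] at hv
      exact hm (by exact_mod_cast (Dvd.intro _ hv : (p : ℤ) ∣ m))
  have hcard : ∀ w' : GaussianInt, w' ≠ 0 → ((fun u => w' ^ k * u) '' normEq m).ncard = r2 m := by
    intro w' hw'
    rw [r2_eq_ncard]
    exact Set.ncard_image_of_injective _ (mul_right_injective₀ (pow_ne_zero _ hw'))
  rw [r2_eq_ncard (p ^ k * m)]
  rw [two_mul]
  have := Set.ncard_le_ncard (Set.union_subset (himg w hw) (himg _ hsw)) (normEq_finite _)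
  rw [Set.ncard_union_eq hdisj ((normEq_finite m).image _) ((normEq_finite m).image _),
    hcard w hwp.ne_zero, hcard _ hsp.ne_zero] at this
  exact this

lemma two_pow_card_le_r2 {T : Finset ℕ} (hT : ∀ p ∈ T, p.Prime ∧ p % 4 = 1) :
    ∀ n : ℕ, n ≠ 0 → n ∈ SOS → (∀ p ∈ T, p ∣ n) → 2 ^ T.card ≤ r2 n := by
  induction T using Finset.induction_on with
  | empty => intro n _ hn _; simpa using Nat.succ_le_of_lt (r2_pos_iff.2 hn)
  | insert p T hpT ih =>
    intro n hn hS h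
    obtain ⟨hp, h1⟩ := hT p (by simp)
    obtain ⟨k, m, hm, rfl⟩ := Nat.exists_eq_pow_mul_and_not_dvd hn p hp.ne_one
    have hk : k ≠ 0 := by
      rintro rfl
      have := h p (by simp)
      simp at this
      exact hm this
    have hm0 : m ≠ 0 := by rintro rfl; simp at hm
    obtain ⟨w, hw⟩ := exists_norm_eq hp (by lia)
    obtain ⟨z, hz⟩ := mem_SOS_iff.1 hS
    obtain ⟨_, _, u, hu, _⟩ := normEq_cover hp hw k m z hz
    have := ih (fun q hq => hT q (by simp [hq])) m hm0 (mem_SOS_iff.2 ⟨u, hu⟩) fun q hq => by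
      have hqp := (hT q (by simp [hq])).1
      rcases (hqp.dvd_mul).1 (h q (by simp [hq])) with h | h
      · exact absurd ((Nat.prime_dvd_prime_iff_eq hqp hp).1 (hqp.dvd_of_dvd_pow h))
          (by rintro rfl; exact hpT hq)
      · exact h
    rw [card_insert_of_notMem hpT, pow_succ]
    calc _ ≤ 2 * r2 m := by lia
      _ ≤ _ := two_mul_r2_le hp h1 hk hm

lemma prime_mem_SOS {p : ℕ} (hp : p.Prime) (h3 : p % 4 ≠ 3) : p ∈ SOS := by
  obtain ⟨w, hw⟩ := exists_norm_eq hp h3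
  exact mem_SOS_iff.2 ⟨w, hw⟩

lemma mul_mem_SOS {m n : ℕ} (hm : m ∈ SOS) (hn : n ∈ SOS) : m * n ∈ SOS := by
  rw [mem_SOS_iff] at *
  obtain ⟨z, hz⟩ := hm
  obtain ⟨w, hw⟩ := hn
  refine ⟨z * w, ?_⟩
  rw [mem_normEq] at *
  rw [Zsqrtd.norm_mul, hz, hw]; push_cast; rfl

lemma prod_mem_SOS {T : Finset ℕ} (hT : ∀ p ∈ T, p ∈ SOS) : ∏ p ∈ T, p ∈ SOS := by
  induction T using Finset.induction_on with
  | empty => exact ⟨1, 0, by simp⟩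
  | insert p T hpT ih =>
    rw [prod_insert hpT]
    exact mul_mem_SOS (hT p (by simp)) (ih fun q hq => hT q (by simp [hq]))

lemma zero_mem_SOS : 0 ∈ SOS := ⟨0, 0, by simp⟩

lemma one_mem_SOS : 1 ∈ SOS := ⟨1, 0, by simp⟩

/-- The number of representations with norm in a finite set. -/
lemma sum_r2_eq_card (S : Finset ℕ) :
    ∑ n ∈ S, r2 n = (S.biUnion fun n => (normEq_finite n).toFinset).card := by
  rw [card_biUnion]
  · apply sum_congr rfl
    intro n _
    rw [r2_eq_ncard, Set.ncard_eq_toFinset_card _ (normEq_finite _)]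
  · intro a _ b _ hab
    rw [Function.onFun, disjoint_left]
    intro z hz hz'
    simp only [Set.Finite.mem_toFinset, mem_normEq] at hz hz'
    rw [hz] at hz'
    exact hab (by exact_mod_cast hz')

lemma sum_r2_le (N : ℕ) : ∑ n ∈ range (N + 1), r2 n ≤ (2 * N.sqrt + 1) ^ 2 := by
  rw [sum_r2_eq_card]
  set s := N.sqrt
  have hs : N < (s + 1) ^ 2 := Nat.lt_succ_sqrt' N
  have hs' : (N : ℤ) < (s + 1) ^ 2 := by exact_mod_cast hs
  have hcard : ((Icc (-(s : ℤ)) s) ×ˢ (Icc (-(s : ℤ)) s)).card = (2 * s + 1) ^ 2 := by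
    rw [card_product, Int.card_Icc, show ((s : ℤ) + 1 - -s).toNat = 2 * s + 1 by lia, sq]
  rw [← hcard]
  apply card_le_card_of_injOn (fun z : GaussianInt => (z.re, z.im))
  · intro z hz
    simp only [coe_biUnion, Set.mem_iUnion, Set.Finite.coe_toFinset, mem_normEq, norm_eq_sq] at hz
    obtain ⟨n, hn, hz⟩ := hz
    have hn' : (n : ℤ) ≤ N := by
      have : n < N + 1 := by simpa using hn
      lia
    simp only [coe_product, coe_Icc, Set.mem_prod, Set.mem_Icc]
    refine ⟨⟨?_, ?_⟩, ?_, ?_⟩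
    · by_contra hc; nlinarith [sq_nonneg z.im]
    · by_contra hc; nlinarith [sq_nonneg z.im]
    · by_contra hc; nlinarith [sq_nonneg z.re]
    · by_contra hc; nlinarith [sq_nonneg z.re]
  · intro a _ b _ h
    simp only [Prod.mk.injEq] at h
    exact Zsqrtd.ext h.1 h.2

lemma sum_r2_le_linear {N : ℕ} (hN : 1 ≤ N) : ∑ n ∈ range (N + 1), r2 n ≤ 9 * N := by
  refine (sum_r2_le N).trans ?_
  have h1 : N.sqrt ^ 2 ≤ N := Nat.sqrt_le' N
  have h2 : 1 ≤ N.sqrt := Nat.le_sqrt.2 (by lia)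
  nlinarith

lemma card_sq_le_sum_r2 (a b : ℕ) :
    (b - a) ^ 2 ≤ ∑ n ∈ Ioc (2 * a ^ 2) (2 * b ^ 2), r2 n := by
  rw [sum_r2_eq_card]
  have hcard : ((Ioc a b) ×ˢ (Ioc a b)).card = (b - a) ^ 2 := by
    rw [card_product, Nat.card_Ioc, sq]
  rw [← hcard]
  apply card_le_card_of_injOn (fun z : ℕ × ℕ => (⟨z.1, z.2⟩ : GaussianInt))
  · rintro ⟨x, y⟩ hz
    simp only [coe_product, coe_Ioc, Set.mem_prod, Set.mem_Ioc] at hz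
    simp only [coe_biUnion, Set.mem_iUnion, Set.Finite.coe_toFinset, mem_normEq, norm_eq_sq]
    refine ⟨x ^ 2 + y ^ 2, ?_, by push_cast; rfl⟩
    simp only [coe_Ioc, Set.mem_Ioc]
    have h1 := Nat.pow_lt_pow_left hz.1.1 (two_ne_zero)
    have h2 := Nat.pow_lt_pow_left hz.2.1 (two_ne_zero)
    have h3 := Nat.pow_le_pow_left hz.1.2 2
    have h4 := Nat.pow_le_pow_left hz.2.2 2
    lia
  · rintro ⟨a, b⟩ _ ⟨c, d⟩ _ h
    simp only [Zsqrtd.mk.injEq] at h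
    simpa using h

lemma r2_le_sqrt (n : ℕ) : r2 n ≤ 2 * (2 * n.sqrt + 1) := by
  rw [r2_eq_ncard, Set.ncard_eq_toFinset_card _ (normEq_finite _)]
  set s := n.sqrt
  have hs' : (n : ℤ) < (s + 1) ^ 2 := by exact_mod_cast Nat.lt_succ_sqrt' n
  have hcard : ((univ : Finset Bool) ×ˢ (Icc (-(s : ℤ)) s)).card = 2 * (2 * s + 1) := by
    rw [card_product, Int.card_Icc, show ((s : ℤ) + 1 - -s).toNat = 2 * s + 1 by lia]
    simp
  rw [← hcard]
  apply card_le_card_of_injOn (fun z : GaussianInt => (decide (0 ≤ z.im), z.re))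
  · intro z hz
    simp only [Set.Finite.coe_toFinset, mem_normEq, norm_eq_sq] at hz
    simp only [coe_product, coe_Icc, Set.mem_prod, Set.mem_Icc, coe_univ, Set.mem_univ, true_and]
    refine ⟨?_, ?_⟩
    · by_contra hc; nlinarith [sq_nonneg z.im]
    · by_contra hc; nlinarith [sq_nonneg z.im]
  · intro a ha b hb h
    simp only [Set.Finite.coe_toFinset, mem_normEq, norm_eq_sq] at ha hb
    simp only [Prod.mk.injEq, decide_eq_decide] at h
    have h2 : a.im ^ 2 = b.im ^ 2 := by rw [h.2] at ha; lia
    refine Zsqrtd.ext h.2 ?_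
    rcases sq_eq_sq_iff_eq_or_eq_neg.1 h2 with h3 | h3
    · exact h3
    · have := h.1; lia

end TwoSquares

/-! ### Moments of divisor-type functions -/

namespace TwoSquares

open Finset

lemma summable_pow_mul_inv_pow (B s : ℕ) {p : ℕ} (hp : 2 ≤ p) :
    Summable fun k : ℕ => ((k + s : ℕ) : ℝ) ^ B * ((p : ℝ) ^ k)⁻¹ := by
  have hp' : (2 : ℝ) ≤ p := by exact_mod_cast hp
  have h := summable_pow_mul_geometric_of_norm_lt_one (R := ℝ) B (r := (p : ℝ)⁻¹)
    (by rw [norm_inv, Real.norm_natCast]; exact inv_lt_one_of_one_lt₀ (by linarith))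
  have h2 := ((summable_nat_add_iff s).2 h).mul_left ((p : ℝ) ^ s)
  refine h2.congr fun k => ?_
  rw [pow_add, inv_pow, inv_pow]
  have : (p : ℝ) ^ s ≠ 0 := by positivity
  field_simp

/-- The local factor `∑ (k+1)^B p^{-k}`. -/
def localFactor (B p : ℕ) : ℝ := ∑' k : ℕ, ((k + 1 : ℕ) : ℝ) ^ B * ((p : ℝ) ^ k)⁻¹

lemma localFactor_nonneg (B p : ℕ) : 0 ≤ localFactor B p := tsum_nonneg fun _ => by positivity

lemma localFactor_le (B : ℕ) {p : ℕ} (hp : 2 ≤ p) :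
    localFactor B p ≤ 1 + (∑' k : ℕ, ((k + 2 : ℕ) : ℝ) ^ B * (((2 : ℕ) : ℝ) ^ k)⁻¹) * (1 / p) := by
  have hp0 : (0 : ℝ) < p := by exact_mod_cast (by lia : 0 < p)
  rw [localFactor, (summable_pow_mul_inv_pow B 1 hp).tsum_eq_zero_add]
  refine add_le_add (by simp) ?_
  rw [← tsum_mul_right]
  refine Summable.tsum_le_tsum (fun k => ?_) ?_ ((summable_pow_mul_inv_pow B 2 le_rfl).mul_right _)
  · rw [pow_succ, mul_inv, ← mul_assoc, one_div]
    have : ((p : ℝ) ^ k)⁻¹ ≤ (((2 : ℕ) : ℝ) ^ k)⁻¹ := by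
      apply inv_anti₀ (by positivity)
      exact pow_le_pow_left₀ (by positivity) (by exact_mod_cast hp) k
    have h2 : (0 : ℝ) ≤ ((k + 2 : ℕ) : ℝ) ^ B := by positivity
    exact mul_le_mul_of_nonneg_right (mul_le_mul_of_nonneg_left this h2) (by positivity)
  · exact (summable_nat_add_iff 1).2 (summable_pow_mul_inv_pow B 1 hp)

lemma sum_tauOn_pow_le (B : ℕ) {Q : Finset ℕ} (hQ : ∀ p ∈ Q, p.Prime) :
    ∀ N : ℕ, ∑ n ∈ Ioc 0 N, (tauOn Q n : ℝ) ^ B ≤ N * ∏ p ∈ Q, localFactor B p := by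
  induction Q using Finset.induction_on with
  | empty => intro N; simp [tauOn]
  | insert p Q hpQ ih =>
    intro N
    have hp := hQ p (by simp)
    have hp0 : (0 : ℝ) < p := by exact_mod_cast hp.pos
    have ih := ih fun q hq => hQ q (by simp [hq])
    have hmaps : ∀ n ∈ Ioc 0 N, n.factorization p ∈ range N := fun n hn => by
      rw [mem_Ioc] at hn
      rw [mem_range]
      exact (Nat.factorization_lt p (by lia)).trans_le hn.2
    rw [← sum_fiberwise_of_maps_to hmaps]
    have hfib : ∀ k ∈ range N, ∑ n ∈ Ioc 0 N with n.factorization p = k,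
        (tauOn (insert p Q) n : ℝ) ^ B ≤
        (((k + 1 : ℕ) : ℝ) ^ B * ((p : ℝ) ^ k)⁻¹) * (N * ∏ p ∈ Q, localFactor B p) := by
      intro k _
      have hinj : ∑ n ∈ Ioc 0 N with n.factorization p = k, (tauOn (insert p Q) n : ℝ) ^ B ≤
          ∑ m ∈ Ioc 0 (N / p ^ k), ((k + 1 : ℕ) : ℝ) ^ B * (tauOn Q m : ℝ) ^ B := by
        have hsub : (Ioc 0 N).filter (fun n => n.factorization p = k) ⊆
            ((Ioc 0 (N / p ^ k)).filter (¬ p ∣ ·)).image (p ^ k * ·) := by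
          intro n hn
          rw [mem_filter, mem_Ioc] at hn
          obtain ⟨l, m, hm, rfl⟩ :=
            Nat.exists_eq_pow_mul_and_not_dvd (by lia : n ≠ 0) p hp.ne_one
          rw [factorization_pow_mul_self hp hm] at hn
          obtain ⟨⟨h0, hN⟩, rfl⟩ := hn
          rw [mem_image]
          refine ⟨m, mem_filter.2 ⟨mem_Ioc.2 ⟨Nat.pos_of_ne_zero ?_, ?_⟩, hm⟩, rfl⟩
          · rintro rfl; simp at hm
          · rw [Nat.le_div_iff_mul_le (pow_pos hp.pos _), mul_comm]; exact hN
        refine (sum_le_sum_of_subset_of_nonneg hsub fun _ _ _ => by positivity).trans ?_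
        rw [sum_image fun a _ b _ h => Nat.eq_of_mul_eq_mul_left (pow_pos hp.pos k) h]
        refine (sum_le_sum fun m hm => ?_).trans
          (sum_le_sum_of_subset_of_nonneg (filter_subset _ _) fun _ _ _ => by positivity)
        rw [mem_filter, mem_Ioc] at hm
        have h1 : tauOn (insert p Q) (p ^ k * m) = (k + 1) * tauOn Q m := by
          rw [tauOn, prod_insert hpQ, factorization_pow_mul_self hp hm.2, tauOn]
          congr 1
          refine prod_congr rfl fun q hq => ?_
          rw [factorization_pow_mul_of_ne hp (by rintro rfl; exact hpQ hq) (by lia)]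
        rw [h1, Nat.cast_mul, mul_pow]
      refine hinj.trans ?_
      rw [← mul_sum, mul_assoc]
      refine mul_le_mul_of_nonneg_left ?_ (by positivity)
      refine (ih _).trans ?_
      rw [← mul_assoc]
      refine mul_le_mul_of_nonneg_right ?_ (prod_nonneg fun q _ => localFactor_nonneg B q)
      refine Nat.cast_div_le.trans (le_of_eq ?_)
      push_cast
      rw [div_eq_inv_mul]
    refine (sum_le_sum hfib).trans ?_
    rw [← sum_mul, prod_insert hpQ]
    have hnn : 0 ≤ (N : ℝ) * ∏ p ∈ Q, localFactor B p :=
      mul_nonneg (by positivity) (prod_nonneg fun q _ => localFactor_nonneg B q)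
    calc _ ≤ localFactor B p * (N * ∏ p ∈ Q, localFactor B p) := by
          refine mul_le_mul_of_nonneg_right ?_ hnn
          exact (summable_pow_mul_inv_pow B 1 hp.two_le).sum_le_tsum _ (fun k _ => by positivity)
      _ = _ := by ring

/-- All moments of `tauOn Q` are controlled by the reciprocal sum of `Q`. -/
lemma exists_sum_tauOn_pow_le (B : ℕ) : ∃ C : ℝ, 0 ≤ C ∧ ∀ Q : Finset ℕ, (∀ p ∈ Q, p.Prime) →
    ∀ N : ℕ, ∑ n ∈ Ioc 0 N, (tauOn Q n : ℝ) ^ B ≤ N * Real.exp (C * ∑ p ∈ Q, 1 / (p : ℝ)) := by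
  refine ⟨∑' k : ℕ, ((k + 2 : ℕ) : ℝ) ^ B * (((2 : ℕ) : ℝ) ^ k)⁻¹,
    tsum_nonneg fun _ => by positivity, fun Q hQ N => (sum_tauOn_pow_le B hQ N).trans ?_⟩
  refine mul_le_mul_of_nonneg_left ?_ (by positivity)
  rw [mul_sum, Real.exp_sum]
  refine prod_le_prod (fun q _ => localFactor_nonneg B q) fun p hp => ?_
  refine (localFactor_le B (hQ p hp).two_le).trans ?_
  rw [add_comm]
  exact Real.add_one_le_exp _

end TwoSquares

/-! ### A pure sieve with multiplicative weights -/

namespace TwoSquares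

open Finset

lemma abs_card_modEq_sub_le (N v : ℕ) {r : ℕ} (hr : 0 < r) :
    |((((Ioc 0 N).filter fun m => m ≡ v [MOD r]).card : ℝ)) - N / r| ≤ 1 := by
  have h := Nat.Ioc_filter_modEq_card 0 N hr v
  have hr' : (0 : ℚ) < r := by exact_mod_cast hr
  have h1 := Int.floor_le (((N : ℚ) - v) / r)
  have h2 := Int.lt_floor_add_one (((N : ℚ) - v) / r)
  have h3 := Int.floor_le (((0 : ℕ) - (v : ℚ)) / r)
  have h4 := Int.lt_floor_add_one (((0 : ℕ) - (v : ℚ)) / r)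
  have h5 : ⌊((0 : ℕ) - (v : ℚ)) / r⌋ ≤ ⌊((N : ℚ) - v) / r⌋ := by
    apply Int.floor_le_floor
    rw [div_le_div_iff_of_pos_right hr']
    have : (0 : ℚ) ≤ N := by positivity
    push_cast; linarith
  rw [max_eq_left (by lia)] at h
  have h' : ((((Ioc 0 N).filter fun m => m ≡ v [MOD r]).card : ℚ)) =
      ⌊((N : ℚ) - v) / r⌋ - ⌊((0 : ℕ) - (v : ℚ)) / r⌋ := by exact_mod_cast h
  have h6 : |((((Ioc 0 N).filter fun m => m ≡ v [MOD r]).card : ℚ)) - N / r| ≤ 1 := by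
    rw [h', abs_le]
    have e1 : ((N : ℚ) - v) / r = N / r - v / r := by ring
    have e2 : ((0 : ℕ) - (v : ℚ)) / r = - (v / r) := by push_cast; ring
    rw [e1] at h1 h2
    rw [e2] at h3 h4
    rw [e1, e2]
    constructor <;> linarith
  have h7 := (Rat.cast_le (K := ℝ)).2 h6
  push_cast at h7
  exact h7

/-- Numbers lying in prescribed residue classes modulo the primes of `S` are well distributed. -/
lemma abs_card_residues_sub_le (N : ℕ) (R : ℕ → Finset ℕ) {S : Finset ℕ} (hS : ∀ p ∈ S, p.Prime)
    (hR : ∀ p ∈ S, R p ⊆ range p ∧ (R p).card ≤ 2) :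
    ∀ r v : ℕ, 0 < r → (∀ p ∈ S, r.Coprime p) →
      |(((Ioc 0 N).filter fun m => m ≡ v [MOD r] ∧ ∀ p ∈ S, m % p ∈ R p).card : ℝ) -
        N / r * ∏ p ∈ S, ((R p).card : ℝ) / p| ≤ 2 ^ S.card := by
  induction S using Finset.induction_on with
  | empty =>
    intro r v hr _
    simpa using abs_card_modEq_sub_le N v hr
  | insert p S hpS ih =>
    intro r v hr hco
    have hp := hS p (by simp)
    have hp0 : (0 : ℝ) < p := by exact_mod_cast hp.pos
    have hr0 : (0 : ℝ) < r := by exact_mod_cast hr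
    have hrp : r.Coprime p := hco p (by simp)
    obtain ⟨hRp, hRc⟩ := hR p (by simp)
    have ih := ih (fun q hq => hS q (by simp [hq])) (fun q hq => hR q (by simp [hq]))
    have hset : (Ioc 0 N).filter (fun m => m ≡ v [MOD r] ∧ ∀ q ∈ insert p S, m % q ∈ R q) =
        (R p).biUnion fun u => (Ioc 0 N).filter fun m =>
          m ≡ (Nat.chineseRemainder hrp v u : ℕ) [MOD r * p] ∧ ∀ q ∈ S, m % q ∈ R q := by
      ext m
      simp only [mem_filter, mem_biUnion, forall_mem_insert]
      constructor
      · rintro ⟨hm, hv, hmp, hmS⟩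
        refine ⟨m % p, hmp, hm, ?_, hmS⟩
        exact Nat.chineseRemainder_modEq_unique hrp hv (Nat.mod_modEq m p).symm
      · rintro ⟨u, hu, hm, hmod, hmS⟩
        obtain ⟨h1, h2⟩ := (Nat.chineseRemainder hrp v u).2
        have hru : u % p = u := Nat.mod_eq_of_lt (mem_range.1 (hRp hu))
        refine ⟨hm, (hmod.of_mul_right p).trans h1, ?_, hmS⟩
        have : m % p = u % p := (hmod.of_mul_left r).trans h2
        rw [this, hru]; exact hu
    have hdisj : (↑(R p) : Set ℕ).PairwiseDisjoint fun u => (Ioc 0 N).filter fun m =>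
          m ≡ (Nat.chineseRemainder hrp v u : ℕ) [MOD r * p] ∧ ∀ q ∈ S, m % q ∈ R q := by
      intro u hu u' hu' hne
      rw [Function.onFun, disjoint_left]
      intro m hm hm'
      simp only [mem_filter] at hm hm'
      apply hne
      have h2 := (Nat.chineseRemainder hrp v u).2.2
      have h2' := (Nat.chineseRemainder hrp v u').2.2
      have : u ≡ u' [MOD p] := (((hm.2.1.of_mul_left r).trans h2).symm).trans
        ((hm'.2.1.of_mul_left r).trans h2')
      rwa [Nat.ModEq, Nat.mod_eq_of_lt (mem_range.1 (hRp hu)),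
        Nat.mod_eq_of_lt (mem_range.1 (hRp hu'))] at this
    rw [hset, card_biUnion hdisj, prod_insert hpS, card_insert_of_notMem hpS]
    have hterm : ∀ u ∈ R p, |(((Ioc 0 N).filter fun m =>
          m ≡ (Nat.chineseRemainder hrp v u : ℕ) [MOD r * p] ∧ ∀ q ∈ S, m % q ∈ R q).card : ℝ) -
          N / (r * p : ℕ) * ∏ q ∈ S, ((R q).card : ℝ) / q| ≤ 2 ^ S.card := by
      intro u _
      refine ih (r * p) _ (Nat.mul_pos hr hp.pos) fun q hq => ?_
      refine Nat.Coprime.mul_left (hco q (by simp [hq])) ?_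
      exact (Nat.coprime_primes hp (hS q (by simp [hq]))).2 (by rintro rfl; exact hpS hq)
    have hmain : (N : ℝ) / r * (((R p).card : ℝ) / p * ∏ q ∈ S, ((R q).card : ℝ) / q) =
        ∑ u ∈ R p, N / (r * p : ℕ) * ∏ q ∈ S, ((R q).card : ℝ) / q := by
      rw [sum_const, nsmul_eq_mul]
      push_cast
      field_simp
    rw [hmain, Nat.cast_sum, ← sum_sub_distrib]
    refine (abs_sum_le_sum_abs _ _).trans ((sum_le_sum hterm).trans ?_)
    rw [sum_const, nsmul_eq_mul, pow_succ]
    have : ((R p).card : ℝ) ≤ 2 := by exact_mod_cast hRc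
    nlinarith [pow_pos (two_pos : (0 : ℝ) < 2) S.card]

/-- Truncation of the expansion of a product. -/
lemma abs_prod_one_add_sub_le (P : Finset ℕ) (x : ℕ → ℝ) (K : ℕ) :
    |∏ p ∈ P, (1 + x p) - ∑ S ∈ P.powerset with S.card ≤ K, ∏ p ∈ S, x p| ≤
      (1 / 2) ^ K * ∏ p ∈ P, (1 + 2 * |x p|) := by
  rw [prod_one_add, ← sum_filter_add_sum_filter_not P.powerset (fun S => S.card ≤ K),
    add_sub_cancel_left, prod_one_add, mul_sum]
  refine (abs_sum_le_sum_abs _ _).trans ?_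
  refine (sum_le_sum (g := fun S => (1 / 2) ^ K * ∏ p ∈ S, 2 * |x p|) ?_).trans
    (sum_le_sum_of_subset_of_nonneg (filter_subset _ _) fun S _ _ =>
      mul_nonneg (by positivity) (prod_nonneg fun _ _ => by positivity))
  intro S hS
  rw [mem_filter] at hS
  rw [abs_prod, prod_mul_distrib, prod_const, ← mul_assoc]
  apply le_mul_of_one_le_left (prod_nonneg fun _ _ => abs_nonneg _)
  rw [one_div, inv_pow, inv_mul_eq_div, le_div_iff₀ (by positivity), one_mul]
  exact pow_le_pow_right₀ (by norm_num) (by lia)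

lemma sum_two_pow_card_le (P : Finset ℕ) (K : ℕ) {X : ℝ} (hX : 1 ≤ X) (hP : (P.card : ℝ) ≤ X) :
    ∑ S ∈ P.powerset with S.card ≤ K, (2 : ℝ) ^ S.card ≤ X ^ K * Real.exp 2 := by
  have h1 : ∑ S ∈ P.powerset with S.card ≤ K, (2 : ℝ) ^ S.card ≤
      ∑ S ∈ P.powerset, X ^ K * ∏ p ∈ S, (2 / X) := by
    refine (sum_le_sum (g := fun S => X ^ K * ∏ p ∈ S, (2 / X)) ?_).trans
      (sum_le_sum_of_subset_of_nonneg (filter_subset _ _) fun S _ _ => by positivity)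
    intro S hS
    rw [mem_filter] at hS
    rw [prod_const, div_pow, mul_div_assoc', le_div_iff₀ (by positivity), mul_comm]
    exact mul_le_mul_of_nonneg_right (pow_le_pow_right₀ hX hS.2) (by positivity)
  refine h1.trans ?_
  rw [← mul_sum, ← prod_one_add]
  refine mul_le_mul_of_nonneg_left ?_ (by positivity)
  rw [prod_const]
  calc (1 + 2 / X) ^ P.card ≤ Real.exp (2 / X) ^ P.card := by
        refine pow_le_pow_left₀ (by positivity) ?_ _
        rw [add_comm]; exact Real.add_one_le_exp _
    _ = Real.exp (P.card * (2 / X)) := by rw [← Real.exp_nat_mul]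
    _ ≤ Real.exp 2 := by
        apply Real.exp_le_exp.2
        rw [mul_div_assoc', div_le_iff₀ (by linarith)]
        linarith

/-- The truncated sieve inequality for a product of local weights. -/
lemma sum_prod_local_le (N K : ℕ) {P : Finset ℕ} (hP : ∀ p ∈ P, p.Prime) (R : ℕ → Finset ℕ)
    (hR : ∀ p ∈ P, R p ⊆ range p ∧ (R p).card ≤ 2) (c : ℕ → ℝ) (hc : ∀ p ∈ P, |c p| ≤ 1)
    {X : ℝ} (hX : 1 ≤ X) (hPX : (P.card : ℝ) ≤ X) :
    ∑ m ∈ Ioc 0 N, ∏ p ∈ P, (1 + if m % p ∈ R p then c p else 0) ≤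
      N * ∏ p ∈ P, (1 + c p * ((R p).card / p)) +
      (1 / 2) ^ K * ∑ m ∈ Ioc 0 N, ∏ p ∈ P, (1 + if m % p ∈ R p then 2 else 0) +
      N * ((1 / 2) ^ K * ∏ p ∈ P, (1 + 2 * ((R p).card / p : ℝ))) + X ^ K * Real.exp 2 := by
  set x : ℕ → ℕ → ℝ := fun m p => if m % p ∈ R p then c p else 0 with hx
  set T := P.powerset.filter fun S => S.card ≤ K with hT
  have h1 : ∑ m ∈ Ioc 0 N, ∏ p ∈ P, (1 + x m p) ≤ ∑ m ∈ Ioc 0 N, ∑ S ∈ T, ∏ p ∈ S, x m p +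
      (1 / 2) ^ K * ∑ m ∈ Ioc 0 N, ∏ p ∈ P, (1 + if m % p ∈ R p then 2 else 0) := by
    rw [mul_sum, ← sum_add_distrib]
    refine sum_le_sum fun m _ => ?_
    have h := (abs_le.1 (abs_prod_one_add_sub_le P (x m) K)).2
    have h2 : ∏ p ∈ P, (1 + 2 * |x m p|) ≤ ∏ p ∈ P, (1 + if m % p ∈ R p then (2 : ℝ) else 0) := by
      refine prod_le_prod (fun _ _ => by positivity) fun p hp => ?_
      have := hc p hp
      simp only [hx]
      split_ifs
      · linarith
      · simp
    have h3 := mul_le_mul_of_nonneg_left h2 (by positivity : (0 : ℝ) ≤ (1 / 2) ^ K)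
    linarith
  have h2 : ∑ m ∈ Ioc 0 N, ∑ S ∈ T, ∏ p ∈ S, x m p ≤
      N * ∑ S ∈ T, ∏ p ∈ S, (c p * ((R p).card / p)) + ∑ S ∈ T, (2 : ℝ) ^ S.card := by
    rw [sum_comm, mul_sum, ← sum_add_distrib]
    refine sum_le_sum fun S hS => ?_
    rw [hT, mem_filter, mem_powerset] at hS
    have hSP := hS.1
    have hcount := abs_card_residues_sub_le N R (fun p hp => hP p (hSP hp))
      (fun p hp => hR p (hSP hp)) 1 0 one_pos (fun p _ => Nat.coprime_one_left p)
    have hsum : ∑ m ∈ Ioc 0 N, ∏ p ∈ S, x m p = (∏ p ∈ S, c p) *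
        (((Ioc 0 N).filter fun m => m ≡ 0 [MOD 1] ∧ ∀ p ∈ S, m % p ∈ R p).card : ℝ) := by
      rw [card_filter, Nat.cast_sum, mul_sum]
      refine sum_congr rfl fun m _ => ?_
      have : m ≡ 0 [MOD 1] := Nat.modEq_one
      simp only [this, true_and, hx]
      rw [prod_ite_zero]
      split_ifs <;> simp
    rw [hsum, prod_mul_distrib]
    have hcS : |∏ p ∈ S, c p| ≤ 1 := by
      rw [abs_prod]
      exact prod_le_one (fun _ _ => abs_nonneg _) fun p hp => hc p (hSP hp)
    have h3 := abs_mul (∏ p ∈ S, c p)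
      ((((Ioc 0 N).filter fun m => m ≡ 0 [MOD 1] ∧ ∀ p ∈ S, m % p ∈ R p).card : ℝ) -
        N / (1 : ℕ) * ∏ p ∈ S, ((R p).card : ℝ) / p)
    have h4 := (le_abs_self _).trans (h3.le.trans
      (mul_le_mul hcS hcount (abs_nonneg _) zero_le_one))
    rw [one_mul, mul_sub, Nat.cast_one, div_one] at h4
    linarith
  have h3 : ∑ S ∈ T, ∏ p ∈ S, (c p * ((R p).card / p)) ≤
      ∏ p ∈ P, (1 + c p * ((R p).card / p)) +
        (1 / 2) ^ K * ∏ p ∈ P, (1 + 2 * ((R p).card / p : ℝ)) := by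
    have h := (abs_le.1 (abs_prod_one_add_sub_le P (fun p => c p * ((R p).card / p)) K)).1
    have h2 : ∏ p ∈ P, (1 + 2 * |c p * ((R p).card / p : ℝ)|) ≤
        ∏ p ∈ P, (1 + 2 * ((R p).card / p : ℝ)) := by
      refine prod_le_prod (fun _ _ => by positivity) fun p hp => ?_
      have h0 : (0 : ℝ) ≤ (R p).card / p := by positivity
      rw [abs_mul, abs_of_nonneg h0]
      have := mul_le_mul_of_nonneg_right (hc p hp) h0
      linarith
    have h3 := mul_le_mul_of_nonneg_left h2 (by positivity : (0 : ℝ) ≤ (1 / 2) ^ K)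
    linarith
  have h4 := sum_two_pow_card_le P K hX hPX
  have h5 := mul_le_mul_of_nonneg_left h3 (Nat.cast_nonneg (α := ℝ) N)
  rw [mul_add] at h5
  linarith

end TwoSquares

/-! ### Sieving shifted sums of two squares -/

namespace TwoSquares

open Finset

lemma tendsto_loglog : Tendsto (fun N : ℕ => Real.log (Real.log N)) atTop atTop :=
  Real.tendsto_log_atTop.comp (Real.tendsto_log_atTop.comp tendsto_natCast_atTop_atTop)

/-- The lower sieving limit `(log N)^A`. -/
def lowLim (A : ℝ) (N : ℕ) : ℕ := ⌊Real.exp (A * Real.log (Real.log N))⌋₊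

/-- The upper sieving limit `exp ((log N)^(1-η))`. -/
def highLim (η : ℝ) (N : ℕ) : ℕ := ⌊Real.exp (Real.exp ((1 - η) * Real.log (Real.log N)))⌋₊

/-- The sieving primes congruent to `i` modulo four. -/
def midPrimes (i : ℕ) (A η : ℝ) (N : ℕ) : Finset ℕ :=
  (primesMod i (highLim η N)).filter (lowLim A N < ·)

lemma mem_midPrimes {i : ℕ} {A η : ℝ} {N p : ℕ} : p ∈ midPrimes i A η N ↔
    (p ≤ highLim η N ∧ p.Prime ∧ p % 4 = i) ∧ lowLim A N < p := by
  rw [midPrimes, mem_filter, mem_primesMod]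

lemma exp_le_two_mul_floor {x : ℝ} (hx : 0 ≤ x) : Real.exp x ≤ 2 * (⌊Real.exp x⌋₊ : ℝ) := by
  have h1 : 1 ≤ Real.exp x := Real.one_le_exp hx
  have h2 := Nat.lt_floor_add_one (Real.exp x)
  have h3 : (1 : ℝ) ≤ ⌊Real.exp x⌋₊ := by exact_mod_cast Nat.le_floor (by exact_mod_cast h1)
  linarith

lemma eventually_mul_log_le (A c ε : ℝ) (hε : 0 < ε) :
    ∀ᶠ v : ℝ in atTop, Real.log (A * v) + c ≤ ε * v := by
  have h := Real.isLittleO_log_id_atTop.bound (c := ε / 2) (by positivity)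
  filter_upwards [h, eventually_ge_atTop 1, eventually_ge_atTop (2 * (Real.log A + c) / ε)]
    with v h1 h2 h3
  rw [id, Real.norm_eq_abs, Real.norm_eq_abs, abs_of_nonneg (Real.log_nonneg h2),
    abs_of_nonneg (by linarith)] at h1
  rw [div_le_iff₀ hε] at h3
  by_cases hA : A = 0
  · subst hA; simp at *; nlinarith
  · rw [Real.log_mul hA (by linarith)]
    linarith

lemma eventually_lin_exp_le (a b η c : ℝ) (hη : 0 < η) (hc : 0 < c) :
    ∀ᶠ v : ℝ in atTop, (a * v + b) * Real.exp ((1 - η) * v) ≤ c * Real.exp v := by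
  have h1 : Tendsto (fun v : ℝ => (a * v + b) * Real.exp (-(η * v))) atTop (𝓝 0) := by
    have h2 := Real.tendsto_pow_mul_exp_neg_atTop_nhds_zero 1
    have h3 : Tendsto (fun v : ℝ => η * v) atTop atTop := tendsto_id.const_mul_atTop hη
    have h4 := ((h2.comp h3).const_mul (a / η)).add
      ((Real.tendsto_exp_neg_atTop_nhds_zero.comp h3).const_mul b)
    simp only [mul_zero, add_zero] at h4
    refine h4.congr fun v => ?_
    simp only [Function.comp]
    field_simp
  filter_upwards [h1.eventually (eventually_le_nhds hc)] with v hv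
  have : Real.exp ((1 - η) * v) = Real.exp (-(η * v)) * Real.exp v := by
    rw [← Real.exp_add]; ring_nf
  rw [this, ← mul_assoc]
  exact mul_le_mul_of_nonneg_right hv (Real.exp_pos v).le

lemma lowLim_le {A : ℝ} {N : ℕ} : (lowLim A N : ℝ) ≤ Real.exp (A * Real.log (Real.log N)) :=
  Nat.floor_le (Real.exp_pos _).le

lemma highLim_le {η : ℝ} {N : ℕ} :
    (highLim η N : ℝ) ≤ Real.exp (Real.exp ((1 - η) * Real.log (Real.log N))) :=
  Nat.floor_le (Real.exp_pos _).le

/-- The sieving primes in each class have reciprocal sum about `½ log log N`. -/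
lemma eventually_midPrimes_sum {i : ℕ} (hi : i = 1 ∨ i = 3) {A η : ℝ} (hA : 0 < A) (hη : 0 < η)
    (hη1 : η < 1) : ∀ᶠ N : ℕ in atTop,
    |∑ p ∈ midPrimes i A η N, 1 / (p : ℝ) - 1 / 2 * Real.log (Real.log N)| ≤
      η * Real.log (Real.log N) := by
  obtain ⟨C, hC0, hC⟩ := exists_abs_sum_inv_sub_le hi
  have hv : ∀ᶠ v : ℝ in atTop, (1 ≤ (1 - η) * v ∧ 1 ≤ A * v) ∧
      (Real.log (A * v) + (Real.log 2 + 4 * C) ≤ η * v ∧ A * v + Real.log 2 ≤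
        Real.exp ((1 - η) * v)) := by
    have e1 : Tendsto (fun v : ℝ => (1 - η) * v) atTop atTop :=
      tendsto_id.const_mul_atTop (by linarith)
    have e2 : Tendsto (fun v : ℝ => A * v) atTop atTop := tendsto_id.const_mul_atTop hA
    refine ((e1.eventually_ge_atTop 1).and (e2.eventually_ge_atTop 1)).and
      ((eventually_mul_log_le A _ η hη).and ?_)
    filter_upwards [e1.eventually
      (eventually_lin_exp_le (A / (1 - η)) (Real.log 2) 1 1 one_pos one_pos)] with v hv
    have h1 : A / (1 - η) * ((1 - η) * v) = A * v := by
      have : 1 - η ≠ 0 := by linarith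
      field_simp
    simpa [h1] using hv
  filter_upwards [tendsto_loglog.eventually hv] with N hN
  set v := Real.log (Real.log N) with hvd
  obtain ⟨⟨h1, h2⟩, h3, h4⟩ := hN
  have hl2 := Real.log_pos (by norm_num : (1 : ℝ) < 2)
  have hz1 := highLim_le (η := η) (N := N)
  have hy1 := lowLim_le (A := A) (N := N)
  have hz2 : Real.exp (Real.exp ((1 - η) * v)) ≤ 2 * (highLim η N : ℝ) :=
    exp_le_two_mul_floor (Real.exp_pos _).le
  have hy2 : Real.exp (A * v) ≤ 2 * (lowLim A N : ℝ) :=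
    exp_le_two_mul_floor (by linarith)
  rw [← hvd] at hz1 hy1
  have hyz : (lowLim A N : ℝ) ≤ highLim η N := by
    have : 2 * Real.exp (A * v) ≤ Real.exp (Real.exp ((1 - η) * v)) := by
      calc 2 * Real.exp (A * v) = Real.exp (A * v + Real.log 2) := by
            rw [Real.exp_add, Real.exp_log (by norm_num)]; ring
        _ ≤ _ := Real.exp_le_exp.2 h4
    linarith
  have he2 : (2.7 : ℝ) < Real.exp (A * v) := by
    have := Real.exp_le_exp.2 h2
    have := Real.exp_one_gt_d9
    linarith
  have hy3 : 2 ≤ lowLim A N := by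
    apply Nat.le_floor
    push_cast
    linarith
  have hyz' : lowLim A N ≤ highLim η N := by exact_mod_cast hyz
  have hsplit : ∑ p ∈ primesMod i (highLim η N), 1 / (p : ℝ) =
      ∑ p ∈ primesMod i (lowLim A N), 1 / (p : ℝ) + ∑ p ∈ midPrimes i A η N, 1 / (p : ℝ) := by
    rw [← sum_filter_add_sum_filter_not (primesMod i (highLim η N)) (fun p => lowLim A N < p),
      add_comm]
    congr 1
    apply sum_congr _ (fun _ _ => rfl)
    ext p
    rw [mem_filter, mem_primesMod, mem_primesMod]
    constructor
    · rintro ⟨⟨_, h⟩, h'⟩; exact ⟨by lia, h⟩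
    · rintro ⟨h', h⟩; exact ⟨⟨by lia, h⟩, by lia⟩
  have hSz := hC (highLim η N) (by lia)
  have hSy := hC (lowLim A N) hy3
  have hSy0 : 0 ≤ ∑ p ∈ primesMod i (lowLim A N), 1 / (p : ℝ) := sum_nonneg fun _ _ => by positivity
  have hy3' : (2 : ℝ) ≤ lowLim A N := by exact_mod_cast hy3
  have hlogy : Real.log (lowLim A N) ≤ A * v := by
    rw [Real.log_le_iff_le_exp (by linarith)]; exact hy1
  have hlly : Real.log (Real.log (lowLim A N)) ≤ Real.log (A * v) := by
    apply Real.log_le_log _ hlogy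
    exact Real.log_pos (by linarith)
  have hz0 : (0 : ℝ) < highLim η N := by linarith
  have hlogz1 : Real.log (highLim η N) ≤ Real.exp ((1 - η) * v) := by
    rw [Real.log_le_iff_le_exp hz0]; exact hz1
  have hllz1 : Real.log (Real.log (highLim η N)) ≤ (1 - η) * v := by
    rw [Real.log_le_iff_le_exp (Real.log_pos (by linarith))]; exact hlogz1
  have hlogz2 : Real.exp ((1 - η) * v) / 2 ≤ Real.log (highLim η N) := by
    have : Real.exp ((1 - η) * v) ≤ Real.log (2 * (highLim η N : ℝ)) := by
      rwa [Real.le_log_iff_exp_le (by positivity)]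
    rw [Real.log_mul (by norm_num) hz0.ne'] at this
    have h5 : (2 : ℝ) ≤ Real.exp ((1 - η) * v) := by
      have := Real.exp_le_exp.2 h1
      have := Real.exp_one_gt_d9
      linarith
    have h6 : Real.log 2 ≤ 1 := by
      have := Real.log_le_sub_one_of_pos (x := 2) (by norm_num)
      linarith
    linarith
  have hllz2 : (1 - η) * v - Real.log 2 ≤ Real.log (Real.log (highLim η N)) := by
    rw [Real.le_log_iff_exp_le (lt_of_lt_of_le (by positivity) hlogz2), Real.exp_sub,
      Real.exp_log (by norm_num)]
    exact hlogz2
  rw [abs_le] at hSz hSy ⊢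
  constructor <;> linarith

/-- `n` has no prime factor in `P`. -/
def Sifted (P : Finset ℕ) (n : ℕ) : Prop := ∀ p ∈ P, ¬ p ∣ n

/-- The number of primes of `P` dividing `n`. -/
def omegaOn (P : Finset ℕ) (n : ℕ) : ℕ := (P.filter (· ∣ n)).card

/-- The residue class `-a` modulo `p`. -/
def negRes (a p : ℕ) : ℕ := (p - a % p) % p

lemma dvd_add_iff_mod_eq_negRes {p : ℕ} (hp : 0 < p) (m a : ℕ) :
    p ∣ m + a ↔ m % p = negRes a p := by
  have h1 := Nat.mod_lt m hp
  have h2 := Nat.mod_lt a hp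
  rw [Nat.dvd_iff_mod_eq_zero, Nat.add_mod, negRes]
  rcases Nat.eq_zero_or_pos (a % p) with h | h
  · rw [h, Nat.add_zero, Nat.mod_mod, Nat.sub_zero, Nat.mod_self]
  · rw [Nat.mod_eq_of_lt (by lia : p - a % p < p)]
    constructor
    · intro h3
      obtain ⟨c, hc⟩ := Nat.dvd_of_mod_eq_zero h3
      have : c = 1 := by
        have hc2 : c < 2 := by by_contra hcc; nlinarith
        have hc0 : c ≠ 0 := by rintro rfl; lia
        lia
      subst this
      lia
    · intro h3
      rw [h3, Nat.sub_add_cancel h2.le, Nat.mod_self]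

/-- The residue classes modulo `p` removed or weighted by the sieve. -/
def sieveRes (P₃ : Finset ℕ) (a b p : ℕ) : Finset ℕ :=
  if p ∈ P₃ then {negRes a p, negRes b p} else {negRes b p}

open Classical in
lemma prod_local_eq {P₁ P₃ : Finset ℕ} (hP₁ : ∀ p ∈ P₁, p.Prime) (hP₃ : ∀ p ∈ P₃, p.Prime)
    (hd : Disjoint P₁ P₃) (V : ℝ) (a b m : ℕ) :
    ∏ p ∈ P₁ ∪ P₃, (1 + if m % p ∈ sieveRes P₃ a b p then (if p ∈ P₃ then -1 else V - 1) else 0) =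
      if Sifted P₃ (m + a) ∧ Sifted P₃ (m + b) then V ^ omegaOn P₁ (m + b) else 0 := by
  rw [prod_union hd]
  have h1 : ∏ p ∈ P₁, (1 + if m % p ∈ sieveRes P₃ a b p then (if p ∈ P₃ then -1 else V - 1)
      else 0) = V ^ omegaOn P₁ (m + b) := by
    rw [omegaOn, ← prod_const, prod_filter]
    refine prod_congr rfl fun p hp => ?_
    have hp3 : p ∉ P₃ := disjoint_left.1 hd hp
    simp only [sieveRes, if_neg hp3, mem_singleton, dvd_add_iff_mod_eq_negRes (hP₁ p hp).pos]
    split_ifs <;> ring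
  have h3 : ∏ p ∈ P₃, (1 + if m % p ∈ sieveRes P₃ a b p then (if p ∈ P₃ then -1 else V - 1)
      else 0) = if Sifted P₃ (m + a) ∧ Sifted P₃ (m + b) then 1 else 0 := by
    have : ∀ p ∈ P₃, (1 + if m % p ∈ sieveRes P₃ a b p then (if p ∈ P₃ then -1 else V - 1)
        else 0 : ℝ) = if ¬ p ∣ m + a ∧ ¬ p ∣ m + b then 1 else 0 := by
      intro p hp
      simp only [sieveRes, if_pos hp, mem_insert, mem_singleton,
        dvd_add_iff_mod_eq_negRes (hP₃ p hp).pos]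
      by_cases h : m % p = negRes a p <;> by_cases h' : m % p = negRes b p <;> simp [h, h']
    rw [prod_congr rfl this, prod_ite_zero]
    simp only [Sifted, prod_const_one, forall₂_and]
    congr
  rw [h1, h3]
  split_ifs <;> simp

lemma prod_hits_le {P₁ P₃ : Finset ℕ} (hP : ∀ p ∈ P₁ ∪ P₃, p.Prime) {a b m : ℕ} (hm : 0 < m) :
    ∏ p ∈ P₁ ∪ P₃, (1 + if m % p ∈ sieveRes P₃ a b p then (2 : ℝ) else 0) ≤
      (tauOn (P₁ ∪ P₃) (m + a) : ℝ) ^ 4 + (tauOn (P₁ ∪ P₃) (m + b) : ℝ) ^ 4 := by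
  set s := (tauOn (P₁ ∪ P₃) (m + a) : ℝ)
  set t := (tauOn (P₁ ∪ P₃) (m + b) : ℝ)
  have h : ∏ p ∈ P₁ ∪ P₃, (1 + if m % p ∈ sieveRes P₃ a b p then (2 : ℝ) else 0) ≤
      s ^ 2 * t ^ 2 := by
    simp only [s, t, tauOn, Nat.cast_prod, ← prod_pow, ← prod_mul_distrib]
    refine prod_le_prod (fun _ _ => by split_ifs <;> positivity) fun p hp => ?_
    have hpp := hP p hp
    have key : ∀ c, m % p = negRes c p → (2 : ℝ) ≤ ((m + c).factorization p + 1 : ℕ) := by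
      intro c hc
      have h1 : 1 ≤ (m + c).factorization p :=
        (hpp.dvd_iff_one_le_factorization (by lia)).1 ((dvd_add_iff_mod_eq_negRes hpp.pos m c).2 hc)
      exact_mod_cast (by lia : 2 ≤ (m + c).factorization p + 1)
    have h1 : ∀ c, (1 : ℝ) ≤ ((m + c).factorization p + 1 : ℕ) := fun c => by
      push_cast; linarith [Nat.cast_nonneg (α := ℝ) ((m + c).factorization p)]
    have ha := h1 a
    have hb := h1 b
    have ha2 := one_le_pow₀ ha (n := 2)
    have hb2 := one_le_pow₀ hb (n := 2)
    split_ifs with hm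
    · have : m % p = negRes a p ∨ m % p = negRes b p := by
        rw [sieveRes] at hm
        split_ifs at hm
        · simpa using hm
        · right; simpa using hm
      rcases this with h | h
      · have := key a h
        have : (4 : ℝ) ≤ ((m + a).factorization p + 1 : ℕ) ^ 2 := by nlinarith
        nlinarith
      · have := key b h
        have : (4 : ℝ) ≤ ((m + b).factorization p + 1 : ℕ) ^ 2 := by nlinarith
        nlinarith
    · nlinarith
  refine h.trans ?_
  nlinarith [sq_nonneg (s ^ 2 - t ^ 2), sq_nonneg (s ^ 2), sq_nonneg (t ^ 2)]

lemma card_sieveRes_le (P₃ : Finset ℕ) (a b p : ℕ) : (sieveRes P₃ a b p).card ≤ 2 := by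
  rw [sieveRes]; split_ifs
  · exact card_le_two
  · simp

lemma sieveRes_subset (P₃ : Finset ℕ) (a b : ℕ) {p : ℕ} (hp : 0 < p) :
    sieveRes P₃ a b p ⊆ range p := by
  intro x hx
  have h : ∀ c, negRes c p < p := fun c => Nat.mod_lt _ hp
  rw [sieveRes] at hx
  rw [mem_range]
  split_ifs at hx
  · rw [mem_insert, mem_singleton] at hx
    rcases hx with rfl | rfl <;> exact h _
  · rw [mem_singleton] at hx
    rw [hx]; exact h _

lemma negRes_ne {p a b : ℕ} (ha : a < p) (hb : b < p) (hab : a ≠ b) : negRes a p ≠ negRes b p := by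
  have hp : 0 < p := by lia
  intro h
  rw [negRes, negRes, Nat.mod_eq_of_lt ha, Nat.mod_eq_of_lt hb] at h
  rcases Nat.eq_zero_or_pos a with rfl | ha0
  · rw [Nat.sub_zero, Nat.mod_self, Nat.mod_eq_of_lt (by lia)] at h; lia
  · rcases Nat.eq_zero_or_pos b with rfl | hb0
    · rw [Nat.sub_zero, Nat.mod_self, Nat.mod_eq_of_lt (by lia)] at h; lia
    · rw [Nat.mod_eq_of_lt (by lia), Nat.mod_eq_of_lt (by lia)] at h; lia

end TwoSquares

namespace TwoSquares

open Finset

lemma sum_shift_le {f : ℕ → ℝ} (hf : ∀ n, 0 ≤ f n) (N a : ℕ) :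
    ∑ m ∈ Ioc 0 N, f (m + a) ≤ ∑ n ∈ Ioc 0 (N + a), f n := by
  rw [← sum_image (s := Ioc 0 N) (g := fun m => m + a) (f := f) (fun x _ y _ h => by simpa using h)]
  refine sum_le_sum_of_subset_of_nonneg ?_ fun n _ _ => hf n
  intro n hn
  rw [mem_image] at hn
  obtain ⟨m, hm, rfl⟩ := hn
  rw [mem_Ioc] at hm ⊢
  lia

lemma midPrimes_disjoint (A η : ℝ) (N : ℕ) :
    Disjoint (midPrimes 1 A η N) (midPrimes 3 A η N) := by
  rw [disjoint_left]
  intro p h1 h3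
  rw [mem_midPrimes] at h1 h3
  lia

lemma eventually_lowLim_le (A : ℝ) : ∀ᶠ N : ℕ in atTop, lowLim A N ≤ N := by
  have h := tendsto_loglog.eventually (eventually_lin_exp_le A 0 1 1 one_pos one_pos)
  filter_upwards [h, tendsto_loglog.eventually_ge_atTop 0, eventually_ge_atTop 3] with N h1 h2 h3
  have h3' : (3 : ℝ) ≤ N := by exact_mod_cast h3
  have hl : 0 < Real.log N := Real.log_pos (by linarith)
  simp only [sub_self, zero_mul, Real.exp_zero, mul_one, add_zero, one_mul, Real.exp_log hl] at h1
  have : (lowLim A N : ℝ) ≤ N := by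
    refine lowLim_le.trans ?_
    rw [← Real.le_log_iff_exp_le (by linarith)]
    exact h1
  exact_mod_cast this

lemma prod_two_nonneg (P₃ P : Finset ℕ) (a b : ℕ) :
    0 ≤ ∏ p ∈ P, (1 + 2 * (((sieveRes P₃ a b p).card : ℝ) / p)) :=
  prod_nonneg fun _ _ => by positivity

lemma prod_two_le (P₃ P : Finset ℕ) (a b : ℕ) :
    ∏ p ∈ P, (1 + 2 * (((sieveRes P₃ a b p).card : ℝ) / p)) ≤
      Real.exp (4 * ∑ p ∈ P, 1 / (p : ℝ)) := by
  rw [mul_sum, Real.exp_sum]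
  refine prod_le_prod (fun _ _ => by positivity) fun p hp => ?_
  refine le_trans ?_ (Real.add_one_le_exp _)
  have h2 : ((sieveRes P₃ a b p).card : ℝ) ≤ 2 := by
    exact_mod_cast card_sieveRes_le P₃ a b p
  have h4 : (0 : ℝ) ≤ 1 / p := by positivity
  have : ((sieveRes P₃ a b p).card : ℝ) / p ≤ 2 * (1 / p) := by
    rw [div_eq_mul_one_div]; exact mul_le_mul_of_nonneg_right h2 h4
  linarith

lemma prod_main_le {P₁ P₃ : Finset ℕ} (hpr1 : ∀ p ∈ P₁, p.Prime) (hpr3 : ∀ p ∈ P₃, p.Prime)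
    (hd : Disjoint P₁ P₃) {y a b : ℕ} (hy : ∀ p ∈ P₃, y < p) (ha : a ≤ y) (hb : b ≤ y)
    {V η v : ℝ} (hV0 : 0 ≤ V) (hV2 : V ≤ 2)
    (h1 : |∑ p ∈ P₁, 1 / (p : ℝ) - 1 / 2 * v| ≤ η * v)
    (h3 : |∑ p ∈ P₃, 1 / (p : ℝ) - 1 / 2 * v| ≤ η * v) :
    ∏ p ∈ P₁ ∪ P₃, (1 + (if p ∈ P₃ then -1 else V - 1) *
      (((sieveRes P₃ a b p).card : ℝ) / p)) ≤
      Real.exp ((-(if a = b then 1 / 2 else 1) + (V - 1) / 2 + 3 * η) * v) := by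
  obtain ⟨k, hk, hk1, hk2⟩ : ∃ k : ℝ, (if a = b then 1 / 2 else 1 : ℝ) = k / 2 ∧
      (∀ p ∈ P₃, ((sieveRes P₃ a b p).card : ℝ) = k) ∧ 0 ≤ k ∧ k ≤ 2 := by
    by_cases hab : a = b
    · refine ⟨1, by rw [if_pos hab], fun p hp => ?_, by norm_num, by norm_num⟩
      rw [sieveRes, if_pos hp, hab]; simp
    · refine ⟨2, by rw [if_neg hab]; norm_num, fun p hp => ?_, by norm_num, le_rfl⟩
      have := hy p hp
      rw [sieveRes, if_pos hp, card_pair (negRes_ne (by lia) (by lia) hab)]; norm_num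
  have hcard1 : ∀ p ∈ P₁, (sieveRes P₃ a b p).card = 1 := fun p hp => by
    rw [sieveRes, if_neg (disjoint_left.1 hd hp), card_singleton]
  have hprod1 : ∏ p ∈ P₁, (1 + (if p ∈ P₃ then -1 else V - 1) *
      (((sieveRes P₃ a b p).card : ℝ) / p)) = ∏ p ∈ P₁, (1 + (V - 1) * (1 / p)) :=
    prod_congr rfl fun p hp => by
      rw [if_neg (disjoint_left.1 hd hp), hcard1 p hp, Nat.cast_one]
  have hprod3 : ∏ p ∈ P₃, (1 + (if p ∈ P₃ then -1 else V - 1) *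
      (((sieveRes P₃ a b p).card : ℝ) / p)) = ∏ p ∈ P₃, (1 + -k * (1 / p)) :=
    prod_congr rfl fun p hp => by
      rw [if_pos hp, hk1 p hp]; ring
  have hgen : ∀ (P : Finset ℕ) (w : ℝ), (∀ p ∈ P, p.Prime) → -2 ≤ w →
      ∏ p ∈ P, (1 + w * (1 / (p : ℝ))) ≤ Real.exp (w * ∑ p ∈ P, 1 / (p : ℝ)) ∧
      0 ≤ ∏ p ∈ P, (1 + w * (1 / (p : ℝ))) := by
    intro P w hP hw
    have h0 : ∀ p ∈ P, 0 ≤ 1 + w * (1 / (p : ℝ)) := fun p hp => by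
      have h2 : (2 : ℝ) ≤ p := by exact_mod_cast (hP p hp).two_le
      have h4 : 1 / (p : ℝ) ≤ 1 / 2 := one_div_le_one_div_of_le (by norm_num) h2
      have h5 : 0 ≤ 1 / (p : ℝ) := by positivity
      nlinarith
    refine ⟨?_, prod_nonneg h0⟩
    rw [mul_sum, Real.exp_sum]
    exact prod_le_prod h0 fun p _ => by rw [add_comm]; exact Real.add_one_le_exp _
  rw [prod_union hd, hprod1, hprod3, hk]
  have g1 := hgen P₁ (V - 1) hpr1 (by linarith)
  have g3 := hgen P₃ (-k) hpr3 (by linarith)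
  refine (mul_le_mul g1.1 g3.1 g3.2 (Real.exp_pos _).le).trans ?_
  rw [← Real.exp_add]
  apply Real.exp_le_exp.2
  rw [abs_le] at h1 h3
  generalize ∑ p ∈ P₁, 1 / (p : ℝ) = S₁ at h1
  generalize ∑ p ∈ P₃, 1 / (p : ℝ) = S₃ at h3
  have e1 : (V - 1) * (S₁ - 1 / 2 * v) ≤ η * v := by
    rcases le_total 1 V with h | h
    · nlinarith [mul_nonneg (by linarith : 0 ≤ V - 1) (sub_nonneg.2 h1.2), mul_nonneg (by linarith : 0 ≤ 2 - V) (by linarith : 0 ≤ η * v)]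
    · nlinarith [mul_nonneg (by linarith : 0 ≤ 1 - V) (by linarith : 0 ≤ (S₁ - 1 / 2 * v) + η * v), mul_nonneg hV0 (by linarith : 0 ≤ η * v)]
  have e2 : -(k * (S₃ - 1 / 2 * v)) ≤ 2 * (η * v) := by
    nlinarith [mul_nonneg hk2.1 (by linarith : 0 ≤ (S₃ - 1 / 2 * v) + η * v), mul_nonneg (by linarith : 0 ≤ 2 - k) (by linarith : 0 ≤ η * v)]
  linarith

set_option maxHeartbeats 1000000 in
open Classical in
/-- The sieve upper bound for pairs of shifted integers free of the sieving primes
`≡ 3 (mod 4)`, weighted by the number of sieving primes `≡ 1 (mod 4)`. -/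
lemma eventually_sieve_le {A η V : ℝ} (hA : 0 < A) (hη : 0 < η) (hη1 : η < 1) (hV0 : 0 ≤ V)
    (hV2 : V ≤ 2) : ∀ᶠ N : ℕ in atTop, ∀ a b : ℕ, a ≤ lowLim A N → b ≤ lowLim A N →
    ∑ m ∈ Ioc 0 N, (if Sifted (midPrimes 3 A η N) (m + a) ∧ Sifted (midPrimes 3 A η N) (m + b)
      then V ^ omegaOn (midPrimes 1 A η N) (m + b) else 0) ≤
    N * Real.exp ((-(if a = b then 1 / 2 else 1) + (V - 1) / 2 + 4 * η) *
      Real.log (Real.log N)) := by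
  obtain ⟨C, hC0, hC⟩ := exists_sum_tauOn_pow_le 4
  have hl2 := Real.log_pos (by norm_num : (1 : ℝ) < 2)
  set κ : ℝ := (3 * C + 16) / Real.log 2 with hκ
  have hκ0 : 0 < κ := by positivity
  have hκl : κ * Real.log 2 = 3 * C + 16 := by rw [hκ]; field_simp
  have hv : ∀ᶠ v : ℝ in atTop, (κ * v + 1) * Real.exp ((1 - η) * v) ≤ 1 / 2 * Real.exp v ∧
      4 * v + 2 ≤ 1 / 2 * Real.exp v ∧ Real.log 6 ≤ v ∧ Real.log 2 ≤ η * v := by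
    refine (eventually_lin_exp_le κ 1 η (1 / 2) hη (by norm_num)).and (Eventually.and ?_
      ((eventually_ge_atTop _).and ((tendsto_id.const_mul_atTop hη).eventually_ge_atTop _)))
    filter_upwards [eventually_lin_exp_le 4 2 1 (1 / 2) one_pos (by norm_num)] with v hv
    simpa using hv
  filter_upwards [tendsto_loglog.eventually hv, eventually_lowLim_le A,
    eventually_midPrimes_sum (Or.inl rfl) hA hη hη1, eventually_midPrimes_sum (Or.inr rfl) hA hη hη1,
    eventually_ge_atTop 3] with N hN hlow h1 h3 hN3 a b ha hb
  have hN3' : (3 : ℝ) ≤ N := by exact_mod_cast hN3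
  have hl : 0 < Real.log N := Real.log_pos (by linarith)
  set v := Real.log (Real.log N) with hvd
  have hev : Real.exp v = Real.log N := Real.exp_log hl
  have hNe : (N : ℝ) = Real.exp (Real.exp v) := by rw [hev, Real.exp_log (by linarith)]
  obtain ⟨hv1, hv2, hv3, hv4⟩ := hN
  have hl6 : 0 < Real.log 6 := Real.log_pos (by norm_num)
  have hv0 : 0 < v := by linarith
  set P₁ := midPrimes 1 A η N with hP₁
  set P₃ := midPrimes 3 A η N with hP₃
  have hd : Disjoint P₁ P₃ := midPrimes_disjoint A η N
  have hpr1 : ∀ p ∈ P₁, p.Prime := fun p hp => (mem_midPrimes.1 hp).1.2.1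
  have hpr3 : ∀ p ∈ P₃, p.Prime := fun p hp => (mem_midPrimes.1 hp).1.2.1
  have hpr : ∀ p ∈ P₁ ∪ P₃, p.Prime := fun p hp => by
    rcases mem_union.1 hp with h | h
    exacts [hpr1 p h, hpr3 p h]
  set K := ⌈κ * v⌉₊ with hK
  have hK1 : κ * v ≤ K := Nat.le_ceil _
  have hK2 : (K : ℝ) ≤ κ * v + 1 := (Nat.ceil_lt_add_one (by positivity)).le
  have hhalf : (1 / 2 : ℝ) ^ K ≤ Real.exp (-((3 * C + 16) * v)) := by
    rw [← Real.rpow_natCast, Real.rpow_def_of_pos (by norm_num), one_div, Real.log_inv]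
    apply Real.exp_le_exp.2
    have := mul_le_mul_of_nonneg_right hK1 hl2.le
    rw [mul_right_comm, hκl] at this
    linarith
  have hz1 : (1 : ℝ) ≤ highLim η N := by
    have : 1 ≤ highLim η N := Nat.le_floor (by
      rw [Nat.cast_one]; exact Real.one_le_exp (Real.exp_pos _).le)
    exact_mod_cast this
  have hcard : ((P₁ ∪ P₃).card : ℝ) ≤ highLim η N := by
    have : P₁ ∪ P₃ ⊆ Ioc 0 (highLim η N) := fun p hp => by
      rw [mem_Ioc]
      refine ⟨(hpr p hp).pos, ?_⟩
      rcases mem_union.1 hp with h | h <;> exact (mem_midPrimes.1 h).1.1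
    have := card_le_card this
    rw [Nat.card_Ioc] at this
    exact_mod_cast this
  have hsum1 := abs_le.1 h1
  have hsum3 := abs_le.1 h3
  have hηv : η * v ≤ v := mul_le_of_le_one_left hv0.le hη1.le
  have hηv0 : 0 ≤ η * v := by positivity
  set S₁ := ∑ p ∈ P₁, 1 / (p : ℝ) with hS₁
  set S₃ := ∑ p ∈ P₃, 1 / (p : ℝ) with hS₃
  have hsumP : ∑ p ∈ P₁ ∪ P₃, 1 / (p : ℝ) = S₁ + S₃ := sum_union hd
  have hsumP3 : ∑ p ∈ P₁ ∪ P₃, 1 / (p : ℝ) ≤ 3 * v := by rw [hsumP]; linarith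
  set c : ℕ → ℝ := fun p => if p ∈ P₃ then -1 else V - 1 with hc
  have hcb : ∀ p ∈ P₁ ∪ P₃, |c p| ≤ 1 := by
    intro p _
    simp only [hc]
    split_ifs
    · simp
    · rw [abs_le]; constructor <;> linarith
  have hsieve := sum_prod_local_le N K hpr (sieveRes P₃ a b)
    (fun p hp => ⟨sieveRes_subset P₃ a b (hpr p hp).pos, card_sieveRes_le P₃ a b p⟩) c hcb hz1 hcard
  simp only [hc, prod_local_eq hpr1 hpr3 hd] at hsieve
  refine hsieve.trans ?_
  have hmain := prod_main_le hpr1 hpr3 hd (fun p hp => (mem_midPrimes.1 hp).2) ha hb hV0 hV2 h1 h3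
  have hτ : ∀ d : ℕ, d ≤ lowLim A N → ∑ m ∈ Ioc 0 N, (tauOn (P₁ ∪ P₃) (m + d) : ℝ) ^ 4 ≤
      2 * N * Real.exp (3 * C * v) := by
    intro d hdl
    refine (sum_shift_le (f := fun n => (tauOn (P₁ ∪ P₃) n : ℝ) ^ 4)
      (fun _ => by positivity) N d).trans ((hC _ hpr _).trans ?_)
    refine mul_le_mul ?_ (Real.exp_le_exp.2 ?_) (Real.exp_pos _).le (by positivity)
    · have : N + d ≤ 2 * N := by lia
      exact_mod_cast this
    · exact (mul_le_mul_of_nonneg_left hsumP3 hC0).trans_eq (by ring)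
  have herr1 : (1 / 2 : ℝ) ^ K * ∑ m ∈ Ioc 0 N, ∏ p ∈ P₁ ∪ P₃,
      (1 + if m % p ∈ sieveRes P₃ a b p then (2 : ℝ) else 0) ≤ N * (4 * Real.exp (-(4 * v))) := by
    have h5 : ∑ m ∈ Ioc 0 N, ∏ p ∈ P₁ ∪ P₃,
        (1 + if m % p ∈ sieveRes P₃ a b p then (2 : ℝ) else 0) ≤ 4 * N * Real.exp (3 * C * v) := by
      refine (sum_le_sum fun m hm => prod_hits_le hpr (a := a) (b := b) (mem_Ioc.1 hm).1).trans ?_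
      rw [sum_add_distrib]
      have := hτ a ha
      have := hτ b hb
      linarith
    calc _ ≤ Real.exp (-((3 * C + 16) * v)) * (4 * N * Real.exp (3 * C * v)) :=
          mul_le_mul hhalf h5 (sum_nonneg fun _ _ => prod_nonneg fun _ _ => by
            split_ifs <;> norm_num) (Real.exp_pos _).le
      _ = N * (4 * Real.exp (-(16 * v))) := by
          rw [show -(16 * v) = -((3 * C + 16) * v) + 3 * C * v by ring, Real.exp_add]; ring
      _ ≤ _ := by
          have := Real.exp_le_exp.2 (by linarith : -(16 * v) ≤ -(4 * v))
          exact mul_le_mul_of_nonneg_left (by linarith) (Nat.cast_nonneg N)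
  have herr2 : (N : ℝ) * ((1 / 2) ^ K * ∏ p ∈ P₁ ∪ P₃,
      (1 + 2 * (((sieveRes P₃ a b p).card : ℝ) / p))) ≤ N * Real.exp (-(4 * v)) := by
    refine mul_le_mul_of_nonneg_left ?_ (by positivity)
    have h5 : ∏ p ∈ P₁ ∪ P₃, (1 + 2 * (((sieveRes P₃ a b p).card : ℝ) / p)) ≤
        Real.exp (12 * v) :=
      (prod_two_le P₃ (P₁ ∪ P₃) a b).trans (Real.exp_le_exp.2 (by linarith))
    calc _ ≤ Real.exp (-((3 * C + 16) * v)) * Real.exp (12 * v) :=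
          mul_le_mul hhalf h5 (prod_two_nonneg P₃ (P₁ ∪ P₃) a b) (Real.exp_pos _).le
      _ ≤ _ := by
          rw [← Real.exp_add]
          apply Real.exp_le_exp.2
          have : 0 ≤ C * v := by positivity
          linarith
  have herr3 : (highLim η N : ℝ) ^ K * Real.exp 2 ≤ N * Real.exp (-(4 * v)) := by
    calc _ ≤ Real.exp (Real.exp ((1 - η) * v)) ^ K * Real.exp 2 :=
          mul_le_mul_of_nonneg_right (pow_le_pow_left₀ (by positivity) highLim_le _)
            (Real.exp_pos _).le
      _ = Real.exp (K * Real.exp ((1 - η) * v) + 2) := by rw [Real.exp_add, Real.exp_nat_mul]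
      _ ≤ Real.exp (Real.exp v + -(4 * v)) := by
          apply Real.exp_le_exp.2
          have := mul_le_mul_of_nonneg_right hK2 (Real.exp_pos ((1 - η) * v)).le
          linarith
      _ = _ := by rw [Real.exp_add, ← hNe]
  set e : ℝ := -(if a = b then 1 / 2 else 1) + (V - 1) / 2 with he
  have he15 : -3 / 2 ≤ e := by
    rw [he]; split_ifs <;> linarith
  have hfin : Real.exp ((e + 3 * η) * v) + 6 * Real.exp (-(4 * v)) ≤
      Real.exp ((e + 4 * η) * v) := by
    have f1 : 6 * Real.exp (-(4 * v)) ≤ Real.exp ((e + 3 * η) * v) := by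
      calc 6 * Real.exp (-(4 * v)) = Real.exp (Real.log 6 + -(4 * v)) := by
            rw [Real.exp_add, Real.exp_log (by norm_num)]
        _ ≤ _ := Real.exp_le_exp.2 (by have := mul_le_mul_of_nonneg_right he15 hv0.le; linarith)
    have f2 : 2 * Real.exp ((e + 3 * η) * v) ≤ Real.exp ((e + 4 * η) * v) := by
      calc 2 * Real.exp ((e + 3 * η) * v) = Real.exp (Real.log 2 + (e + 3 * η) * v) := by
            rw [Real.exp_add, Real.exp_log (by norm_num)]
        _ ≤ _ := Real.exp_le_exp.2 (by have := mul_le_mul_of_nonneg_right he15 hv0.le; linarith)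
    linarith
  have g1 := mul_le_mul_of_nonneg_left hmain (Nat.cast_nonneg (α := ℝ) N)
  have g2 := mul_le_mul_of_nonneg_left hfin (Nat.cast_nonneg (α := ℝ) N)
  linarith

end TwoSquares

namespace TwoSquares

open Finset

/-- The elements of `SOS` for which `r₂` is well approximated by the number of sieving primes. -/
def Regular (A η ε : ℝ) (N n : ℕ) : Prop :=
  Sifted (midPrimes 3 A η N) n ∧ (2 : ℝ) ^ omegaOn (midPrimes 1 A η N) n ≤ r2 n ∧
    (r2 n : ℝ) ≤ Real.exp (ε * Real.log (Real.log N)) * 2 ^ omegaOn (midPrimes 1 A η N) n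

/-- The primes up to `2N` that are not `3` modulo four. -/
def splitPrimes (N : ℕ) : Finset ℕ := (Ioc 0 (2 * N)).filter fun p => p.Prime ∧ p % 4 ≠ 3

lemma mem_splitPrimes {N p : ℕ} : p ∈ splitPrimes N ↔ p ≤ 2 * N ∧ p.Prime ∧ p % 4 ≠ 3 := by
  rw [splitPrimes, mem_filter, mem_Ioc]
  constructor
  · rintro ⟨⟨_, h⟩, h'⟩; exact ⟨h, h'⟩
  · rintro ⟨h, h'⟩; exact ⟨⟨h'.1.pos, h⟩, h'⟩

lemma exists_sum_splitPrimes_le : ∃ C : ℝ, 0 ≤ C ∧ ∀ N : ℕ, 3 ≤ N →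
    ∑ p ∈ splitPrimes N, 1 / (p : ℝ) ≤ 1 / 2 * Real.log (Real.log N) + C := by
  obtain ⟨C, hC0, hC⟩ := exists_abs_sum_inv_sub_le (i := 1) (Or.inl rfl)
  have hl2 := Real.log_pos (by norm_num : (1 : ℝ) < 2)
  refine ⟨C + 1 / 2 + 1 / 2 * Real.log 2, by positivity, fun N hN => ?_⟩
  have hsub : splitPrimes N ⊆ insert 2 (primesMod 1 (2 * N)) := by
    intro p hp
    rw [mem_splitPrimes] at hp
    rw [mem_insert, mem_primesMod]
    rcases hp.2.1.eq_two_or_odd with h | h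
    · exact Or.inl h
    · exact Or.inr ⟨hp.1, hp.2.1, by lia⟩
  have h2 : 2 ∉ primesMod 1 (2 * N) := by rw [mem_primesMod]; lia
  have h1 := sum_le_sum_of_subset_of_nonneg (f := fun p : ℕ => 1 / (p : ℝ)) hsub
    fun p _ _ => by positivity
  rw [sum_insert h2] at h1
  have h3 := (abs_le.1 (hC (2 * N) (by lia))).2
  have hN3 : (3 : ℝ) ≤ N := by exact_mod_cast hN
  have hlN : 1 < Real.log N := by
    rw [Real.lt_log_iff_exp_lt (by linarith)]
    have := Real.exp_one_lt_d9
    linarith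
  have h4 : Real.log (Real.log ((2 * N : ℕ) : ℝ)) ≤ Real.log 2 + Real.log (Real.log N) := by
    rw [← Real.log_mul (by norm_num) (by linarith)]
    have : Real.log 2 ≤ Real.log N := Real.log_le_log (by norm_num) (by linarith)
    push_cast
    rw [Real.log_mul (by norm_num) (by linarith)]
    exact Real.log_le_log (by linarith) (by linarith)
  norm_num at h1
  norm_num at h3 ⊢
  push_cast at h4
  linarith

lemma midPrimes_subset_splitPrimes {A η : ℝ} {N : ℕ} (hN : 3 ≤ N) (hη : 0 ≤ η) :
    midPrimes 1 A η N ⊆ splitPrimes N := by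
  intro p hp
  rw [mem_midPrimes] at hp
  rw [mem_splitPrimes]
  refine ⟨?_, hp.1.2.1, by lia⟩
  have hN3 : (3 : ℝ) ≤ N := by exact_mod_cast hN
  have hlN : 1 < Real.log N := by
    rw [Real.lt_log_iff_exp_lt (by linarith)]
    have := Real.exp_one_lt_d9
    linarith
  have hv : 0 < Real.log (Real.log N) := Real.log_pos hlN
  have h1 : (highLim η N : ℝ) ≤ N := by
    refine highLim_le.trans ?_
    calc _ ≤ Real.exp (Real.exp (Real.log (Real.log N))) := by
          apply Real.exp_le_exp.2; apply Real.exp_le_exp.2; nlinarith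
      _ = N := by rw [Real.exp_log (by linarith), Real.exp_log (by linarith)]
  have : highLim η N ≤ N := by exact_mod_cast h1
  lia

lemma tauOn_eq_two_pow {P : Finset ℕ} (hP : ∀ p ∈ P, p.Prime) {n : ℕ} (hn : n ≠ 0)
    (h : ∀ p ∈ P, ¬ p ^ 2 ∣ n) : tauOn P n = 2 ^ omegaOn P n := by
  rw [tauOn, omegaOn, ← prod_const, prod_filter]
  refine prod_congr rfl fun p hp => ?_
  have h1 := (hP p hp).dvd_iff_one_le_factorization hn
  have h2 : n.factorization p < 2 := by
    by_contra hh
    exact h p hp (((hP p hp).pow_dvd_iff_le_factorization hn).2 (by lia))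
  split_ifs with hd
  · have := h1.1 hd; lia
  · have : ¬ 1 ≤ n.factorization p := fun hh => hd (h1.2 hh)
    lia

lemma regular_of {A η ε : ℝ} {N n : ℕ} (hN : 3 ≤ N) (hη : 0 ≤ η) (hn0 : n ≠ 0) (hn2 : n ≤ 2 * N)
    (hnS : n ∈ SOS) (hsq : ∀ p : ℕ, p.Prime → lowLim A N < p → ¬ p ^ 2 ∣ n)
    (hτ : (tauOn (splitPrimes N \ midPrimes 1 A η N) n : ℝ) ≤
      Real.exp (ε * Real.log (Real.log N)) / 4) : Regular A η ε N n := by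
  refine ⟨fun p hp hd => ?_, ?_, ?_⟩
  · rw [mem_midPrimes] at hp
    exact hsq p hp.1.2.1 hp.2 (sq_dvd_of_mem_SOS hp.1.2.1 hp.1.2.2 hnS hd)
  · have := two_pow_card_le_r2 (T := (midPrimes 1 A η N).filter (· ∣ n))
      (fun p hp => by
        rw [mem_filter, mem_midPrimes] at hp; exact hp.1.1.2) n hn0 hnS
        (fun p hp => (mem_filter.1 hp).2)
    rw [omegaOn]
    exact_mod_cast this
  · have h1 := r2_le_tauOn (Q := splitPrimes N) (fun p hp => (mem_splitPrimes.1 hp).2) n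
      (Nat.pos_of_ne_zero hn0) (fun p hp hd h3 => mem_splitPrimes.2
        ⟨(Nat.le_of_dvd (Nat.pos_of_ne_zero hn0) hd).trans hn2, hp, h3⟩)
    have h2 : tauOn (splitPrimes N) n = tauOn (splitPrimes N \ midPrimes 1 A η N) n *
        2 ^ omegaOn (midPrimes 1 A η N) n := by
      rw [← tauOn_eq_two_pow (P := midPrimes 1 A η N) (fun p hp => (mem_midPrimes.1 hp).1.2.1) hn0
        (fun p hp => hsq p (mem_midPrimes.1 hp).1.2.1 (mem_midPrimes.1 hp).2)]
      exact (prod_sdiff (midPrimes_subset_splitPrimes hN hη)).symm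
    rw [h2] at h1
    have h3 : (r2 n : ℝ) ≤ 4 * ((tauOn (splitPrimes N \ midPrimes 1 A η N) n : ℝ) *
        2 ^ omegaOn (midPrimes 1 A η N) n) := by exact_mod_cast h1
    have h4 : (0 : ℝ) < 2 ^ omegaOn (midPrimes 1 A η N) n := by positivity
    nlinarith

open Classical in
lemma card_sq_dvd_le (y M : ℕ) (hy : y ≠ 0) :
    (((Ioc 0 M).filter fun n => ∃ p : ℕ, y < p ∧ p ^ 2 ∣ n).card : ℝ) ≤ M / y := by
  have hsub : ((Ioc 0 M).filter fun n => ∃ p : ℕ, y < p ∧ p ^ 2 ∣ n) ⊆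
      (Ioc y (max y M)).biUnion fun p => (Ioc 0 M).filter (p ^ 2 ∣ ·) := by
    intro n hn
    rw [mem_filter, mem_Ioc] at hn
    obtain ⟨hn, p, hp, hd⟩ := hn
    rw [mem_biUnion]
    refine ⟨p, ?_, mem_filter.2 ⟨mem_Ioc.2 hn, hd⟩⟩
    rw [mem_Ioc]
    have h1 := Nat.le_of_dvd hn.1 hd
    have h2 : p ≤ p ^ 2 := Nat.le_self_pow (by norm_num) p
    exact ⟨hp, le_max_of_le_right (by lia)⟩
  have h1 := (card_le_card hsub).trans card_biUnion_le
  have h2 : (((Ioc 0 M).filter fun n => ∃ p : ℕ, y < p ∧ p ^ 2 ∣ n).card : ℝ) ≤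
      ∑ p ∈ Ioc y (max y M), (M : ℝ) * ((p : ℝ) ^ 2)⁻¹ := by
    refine (Nat.cast_le.2 h1).trans ?_
    rw [Nat.cast_sum]
    refine sum_le_sum fun p _ => ?_
    rw [Nat.Ioc_filter_dvd_card_eq_div]
    refine Nat.cast_div_le.trans ?_
    push_cast
    rw [div_eq_mul_inv]
  refine h2.trans ?_
  rw [← mul_sum, div_eq_mul_inv]
  refine mul_le_mul_of_nonneg_left ?_ (by positivity)
  refine (sum_Ioc_inv_sq_le_sub hy (le_max_left _ _)).trans ?_
  have : (0 : ℝ) ≤ ((max y M : ℕ) : ℝ)⁻¹ := by positivity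
  linarith

open Classical in
lemma card_tauOn_gt_le {Q : Finset ℕ} {M B : ℕ} {T C S : ℝ} (hT : 0 < T)
    (h : ∑ n ∈ Ioc 0 M, (tauOn Q n : ℝ) ^ B ≤ M * Real.exp (C * S)) :
    (((Ioc 0 M).filter fun n => T < tauOn Q n).card : ℝ) ≤ M * Real.exp (C * S) / T ^ B := by
  rw [le_div_iff₀ (by positivity)]
  refine le_trans ?_ h
  rw [← nsmul_eq_mul, ← sum_const]
  refine (sum_le_sum fun n hn => ?_).trans (sum_le_sum_of_subset_of_nonneg (filter_subset _ _)
    fun _ _ _ => by positivity)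
  exact pow_le_pow_left₀ hT.le (mem_filter.1 hn).2.le _

end TwoSquares

namespace TwoSquares

open Finset

lemma eventually_const_mul_exp_le {K c d : ℝ} (hcd : c < d) :
    ∀ᶠ v : ℝ in atTop, K * Real.exp (c * v) ≤ Real.exp (d * v) := by
  have h : Tendsto (fun v : ℝ => Real.exp ((d - c) * v)) atTop atTop :=
    Real.tendsto_exp_atTop.comp (tendsto_id.const_mul_atTop (by linarith))
  filter_upwards [h.eventually_ge_atTop K] with v hv
  have : Real.exp (d * v) = Real.exp ((d - c) * v) * Real.exp (c * v) := by
    rw [← Real.exp_add]; ring_nf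
  rw [this]
  exact mul_le_mul_of_nonneg_right hv (Real.exp_pos _).le

lemma exists_sum_r2_sq_le : ∃ C : ℝ, 0 ≤ C ∧ ∀ᶠ N : ℕ in atTop,
    ∑ n ∈ Ioc 0 (2 * N), (r2 n : ℝ) ^ 2 ≤ 32 * N * Real.exp (C * Real.log (Real.log N)) := by
  obtain ⟨C, hC0, hC⟩ := exists_sum_tauOn_pow_le 2
  obtain ⟨C', hC'0, hC'⟩ := exists_sum_splitPrimes_le
  refine ⟨C, hC0, ?_⟩
  filter_upwards [eventually_ge_atTop 3, tendsto_loglog.eventually_ge_atTop (2 * C')] with N hN hv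
  have h1 := hC (splitPrimes N) (fun p hp => (mem_splitPrimes.1 hp).2.1) (2 * N)
  have h2 := hC' N hN
  calc ∑ n ∈ Ioc 0 (2 * N), (r2 n : ℝ) ^ 2
      ≤ ∑ n ∈ Ioc 0 (2 * N), 16 * (tauOn (splitPrimes N) n : ℝ) ^ 2 := by
        refine sum_le_sum fun n hn => ?_
        rw [mem_Ioc] at hn
        have h3 := r2_le_tauOn (Q := splitPrimes N) (fun p hp => (mem_splitPrimes.1 hp).2) n
          hn.1 (fun p hp hd h3 => mem_splitPrimes.2
            ⟨(Nat.le_of_dvd hn.1 hd).trans hn.2, hp, h3⟩)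
        have h3' : (r2 n : ℝ) ≤ 4 * tauOn (splitPrimes N) n := by exact_mod_cast h3
        calc (r2 n : ℝ) ^ 2 ≤ (4 * tauOn (splitPrimes N) n : ℝ) ^ 2 :=
              pow_le_pow_left₀ (by positivity) h3' 2
          _ = _ := by ring
    _ = 16 * ∑ n ∈ Ioc 0 (2 * N), (tauOn (splitPrimes N) n : ℝ) ^ 2 := by rw [mul_sum]
    _ ≤ 16 * (((2 * N : ℕ) : ℝ) * Real.exp (C * ∑ p ∈ splitPrimes N, 1 / (p : ℝ))) := by
        linarith
    _ ≤ 16 * (((2 * N : ℕ) : ℝ) * Real.exp (C * Real.log (Real.log N))) := by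
        have := Real.exp_le_exp.2 (mul_le_mul_of_nonneg_left
          (by linarith : ∑ p ∈ splitPrimes N, 1 / (p : ℝ) ≤ Real.log (Real.log N)) hC0)
        gcongr
    _ = _ := by push_cast; ring

open Classical in
/-- Irregular sums of two squares carry a negligible part of the mass of `r₂`. -/
theorem exists_sum_irregular_le {ε D : ℝ} (hε : 0 < ε) (hD : 0 < D) : ∃ A η : ℝ, D < A ∧ 0 < η ∧
    η < 1 ∧ η ≤ ε ∧ ∀ᶠ N : ℕ in atTop,
    ∑ n ∈ (Ioc 0 (2 * N)).filter (fun n => n ∈ SOS ∧ ¬ Regular A η ε N n), (r2 n : ℝ) ≤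
      N * Real.exp (-D * Real.log (Real.log N)) := by
  obtain ⟨C₂, hC₂0, hC₂⟩ := exists_sum_r2_sq_le
  obtain ⟨C', hC'0, hC'⟩ := exists_sum_splitPrimes_le
  set D' := 2 * D + C₂ + 1 with hD'
  obtain ⟨B, hB⟩ := exists_nat_ge ((D' + 2) / ε)
  rw [div_le_iff₀ hε] at hB
  obtain ⟨C, hC0, hC⟩ := exists_sum_tauOn_pow_le B
  set η : ℝ := min (min ε (1 / 2)) (1 / (2 * C + 2)) with hη
  have hη0 : 0 < η := by
    rw [hη]; exact lt_min (lt_min hε (by norm_num)) (by positivity)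
  have hηε : η ≤ ε := (min_le_left _ _).trans (min_le_left _ _)
  have hη1 : η < 1 := by
    have : η ≤ 1 / 2 := (min_le_left _ _).trans (min_le_right _ _)
    linarith
  have hηC : C * (2 * η) ≤ 1 := by
    have h1 : η ≤ 1 / (2 * C + 2) := min_le_right _ _
    rw [le_div_iff₀ (by positivity)] at h1
    linarith
  have hA : 0 < D' + 1 := by positivity
  refine ⟨D' + 1, η, by linarith, hη0, hη1, hηε, ?_⟩
  have hv : ∀ᶠ v : ℝ in atTop, 0 ≤ v ∧ C' ≤ η * v ∧
      (4 + 2 * 4 ^ B) * Real.exp (-(D' + 1) * v) ≤ Real.exp (-D' * v) ∧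
      32 * Real.exp ((C₂ - D') * v) ≤ Real.exp (-(2 * D) * v) := by
    refine (eventually_ge_atTop 0).and (Eventually.and ?_ (Eventually.and ?_ ?_))
    · exact (tendsto_id.const_mul_atTop hη0).eventually_ge_atTop _
    · exact eventually_const_mul_exp_le (by linarith)
    · exact eventually_const_mul_exp_le (by linarith)
  filter_upwards [tendsto_loglog.eventually hv, hC₂, eventually_ge_atTop 3,
    eventually_midPrimes_sum (Or.inl rfl) hA hη0 hη1] with N hv hr2 hN hmid
  set v := Real.log (Real.log N) with hvd
  obtain ⟨hv0, hv1, hv2, hv3⟩ := hv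
  set bad := (Ioc 0 (2 * N)).filter (fun n => n ∈ SOS ∧ ¬ Regular (D' + 1) η ε N n) with hbad
  set Q := splitPrimes N \ midPrimes 1 (D' + 1) η N with hQ
  have hy2 : Real.exp ((D' + 1) * v) ≤ 2 * (lowLim (D' + 1) N : ℝ) :=
    exp_le_two_mul_floor (by positivity)
  have hy0 : lowLim (D' + 1) N ≠ 0 := by
    rintro h
    rw [h, Nat.cast_zero] at hy2
    have := Real.exp_pos ((D' + 1) * v)
    linarith
  have hSQ : ∑ p ∈ Q, 1 / (p : ℝ) ≤ 2 * η * v := by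
    have h1 := sum_sdiff (f := fun p : ℕ => 1 / (p : ℝ))
      (midPrimes_subset_splitPrimes (A := D' + 1) hN hη0.le)
    have h2 := hC' N hN
    rw [← hvd] at h2
    have h3 := (abs_le.1 hmid).1
    rw [← hQ] at h1
    linarith
  have hsub : bad ⊆ ((Ioc 0 (2 * N)).filter fun n => ∃ p : ℕ, lowLim (D' + 1) N < p ∧ p ^ 2 ∣ n) ∪
      ((Ioc 0 (2 * N)).filter fun n => Real.exp (ε * v) / 4 < tauOn Q n) := by
    intro n hn
    rw [hbad, mem_filter] at hn
    obtain ⟨hn1, hnS, hnR⟩ := hn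
    rw [mem_union, mem_filter, mem_filter]
    by_contra hcon
    apply hnR
    push Not at hcon
    rw [mem_Ioc] at hn1
    exact regular_of hN hη0.le (by lia) hn1.2 hnS
      (fun p _ hp => hcon.1 (mem_Ioc.2 hn1) p hp) (hcon.2 (mem_Ioc.2 hn1))
  have hN0 : (0 : ℝ) < N := by exact_mod_cast (by lia : 0 < N)
  have hcard : (bad.card : ℝ) ≤ N * Real.exp (-D' * v) := by
    have h1 : (bad.card : ℝ) ≤ _ := Nat.cast_le.2 ((card_le_card hsub).trans (card_union_le _ _))
    rw [Nat.cast_add] at h1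
    have h2 := card_sq_dvd_le (lowLim (D' + 1) N) (2 * N) hy0
    have h3 := card_tauOn_gt_le (Q := Q) (M := 2 * N) (B := B) (T := Real.exp (ε * v) / 4)
      (by positivity) (hC Q (fun p hp => (mem_splitPrimes.1 (mem_sdiff.1 hp).1).2.1) (2 * N))
    have h4 : ((2 * N : ℕ) : ℝ) / lowLim (D' + 1) N ≤ 4 * N * Real.exp (-(D' + 1) * v) := by
      rw [div_le_iff₀ (by positivity), neg_mul, Real.exp_neg]
      have := Real.exp_pos ((D' + 1) * v)
      push_cast
      field_simp
      linarith
    have h5 : ((2 * N : ℕ) : ℝ) * Real.exp (C * ∑ p ∈ Q, 1 / (p : ℝ)) / (Real.exp (ε * v) / 4) ^ B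
        ≤ 2 * 4 ^ B * N * Real.exp (-(D' + 1) * v) := by
      rw [div_le_iff₀ (by positivity), div_pow, ← Real.exp_nat_mul]
      have h6 : Real.exp (C * ∑ p ∈ Q, 1 / (p : ℝ)) ≤
          Real.exp (-(D' + 1) * v) * Real.exp (B * (ε * v)) := by
        rw [← Real.exp_add]
        apply Real.exp_le_exp.2
        have e1 := mul_le_mul_of_nonneg_left hSQ hC0
        have e2 := mul_le_mul_of_nonneg_right hηC hv0
        have e3 := mul_le_mul_of_nonneg_right hB hv0
        linarith
      push_cast
      calc 2 * (N : ℝ) * Real.exp (C * ∑ p ∈ Q, 1 / (p : ℝ)) ≤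
          2 * N * (Real.exp (-(D' + 1) * v) * Real.exp (B * (ε * v))) := by gcongr
        _ = _ := by field_simp
    have h7 := mul_le_mul_of_nonneg_left hv2 hN0.le
    linarith
  have hCS := sq_sum_le_card_mul_sum_sq (s := bad) (f := fun n => (r2 n : ℝ))
  have hsq : ∑ n ∈ bad, (r2 n : ℝ) ^ 2 ≤ 32 * N * Real.exp (C₂ * v) :=
    (sum_le_sum_of_subset_of_nonneg (filter_subset _ _) fun _ _ _ => by positivity).trans hr2
  have hfin : (∑ n ∈ bad, (r2 n : ℝ)) ^ 2 ≤ (N * Real.exp (-D * v)) ^ 2 := by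
    calc (∑ n ∈ bad, (r2 n : ℝ)) ^ 2 ≤ (N * Real.exp (-D' * v)) * (32 * N * Real.exp (C₂ * v)) :=
          hCS.trans (mul_le_mul hcard hsq (sum_nonneg fun _ _ => by positivity) (by positivity))
      _ = N ^ 2 * (32 * Real.exp ((C₂ - D') * v)) := by
          rw [show (C₂ - D') * v = -D' * v + C₂ * v by ring, Real.exp_add]; ring
      _ ≤ N ^ 2 * Real.exp (-(2 * D) * v) := by gcongr
      _ = _ := by
          rw [mul_pow, ← Real.exp_nat_mul]; push_cast; ring_nf
  exact le_of_sq_le_sq hfin (by positivity)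

end TwoSquares

namespace TwoSquares

open Finset

lemma sum_le_sum_of_inj {s t : Finset ℕ} {e : ℕ → ℕ} (he : Set.InjOn e s)
    (hmap : ∀ x ∈ s, e x ∈ t) {f g : ℕ → ℝ} (hg : ∀ y ∈ t, 0 ≤ g y)
    (hfg : ∀ x ∈ s, f x ≤ g (e x)) : ∑ x ∈ s, f x ≤ ∑ y ∈ t, g y := by
  refine (sum_le_sum hfg).trans ?_
  rw [← sum_image he]
  exact sum_le_sum_of_subset_of_nonneg (image_subset_iff.2 hmap) fun y hy _ => hg y hy

/-- The neighbours of `n` up to `M` at distance at most `y`. -/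
def nbr (M y n : ℕ) : Finset ℕ := (Ioc 0 M).filter fun k => k ≠ n ∧ Nat.dist n k ≤ y

lemma mem_nbr {M y n k : ℕ} :
    k ∈ nbr M y n ↔ (0 < k ∧ k ≤ M) ∧ k ≠ n ∧ (n - k) + (k - n) ≤ y := by
  rw [nbr, mem_filter, mem_Ioc, Nat.dist]

lemma cast_dist (n k : ℕ) : ((Nat.dist n k : ℕ) : ℝ) = |(k : ℝ) - n| := by
  rcases le_total n k with h | h
  · rw [Nat.dist_eq_sub_of_le h, Nat.cast_sub h, abs_of_nonneg]
    have : (n : ℝ) ≤ k := by exact_mod_cast h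
    linarith
  · rw [Nat.dist_eq_sub_of_le_right h, Nat.cast_sub h, abs_of_nonpos]
    · ring
    · have : (k : ℝ) ≤ n := by exact_mod_cast h
      linarith

lemma sum_nbr_le {f : ℕ → ℕ → ℝ} (hf : ∀ a b, 0 ≤ f a b) (n M y : ℕ) :
    ∑ k ∈ nbr M y n, f n k ≤ ∑ h ∈ Ioc 0 y, f n (n + h) +
      ∑ h ∈ Ioc 0 y, (if h < n then f n (n - h) else 0) := by
  rw [← sum_filter_add_sum_filter_not (nbr M y n) (fun k => n < k)]
  refine add_le_add ?_ ?_
  · refine sum_le_sum_of_inj (e := fun k => k - n) ?_ ?_ (fun _ _ => hf _ _) ?_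
    · intro a ha b hb hab
      rw [mem_coe, mem_filter] at ha hb
      simp only at hab
      lia
    · intro a ha
      rw [mem_filter, mem_nbr] at ha
      rw [mem_Ioc]; lia
    · intro a ha
      rw [mem_filter] at ha
      rw [show n + (a - n) = a by lia]
  · refine sum_le_sum_of_inj (e := fun k => n - k) ?_ ?_ (fun _ _ => ?_) ?_
    · intro a ha b hb hab
      rw [mem_coe, mem_filter, mem_nbr] at ha hb
      simp only at hab
      lia
    · intro a ha
      rw [mem_filter, mem_nbr] at ha
      rw [mem_Ioc]; lia
    · split_ifs
      exacts [hf _ _, le_rfl]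
    · intro a ha
      rw [mem_filter, mem_nbr] at ha
      rw [if_pos (by lia), show n - (n - a) = a by lia]

lemma sum_sum_nbr_le {f : ℕ → ℕ → ℝ} (hf : ∀ a b, 0 ≤ f a b) (N M y : ℕ) :
    ∑ n ∈ Ioc 0 N, ∑ k ∈ nbr M y n, f n k ≤
      ∑ h ∈ Ioc 0 y, (∑ m ∈ Ioc 0 N, f m (m + h) + ∑ m ∈ Ioc 0 N, f (m + h) m) := by
  refine (sum_le_sum fun n _ => sum_nbr_le hf n M y).trans ?_
  rw [sum_add_distrib, sum_add_distrib, sum_comm]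
  refine add_le_add le_rfl ?_
  rw [sum_comm]
  refine sum_le_sum fun h _ => ?_
  rw [← sum_filter]
  refine sum_le_sum_of_inj (e := fun k => k - h) ?_ ?_ (fun _ _ => hf _ _) ?_
  · intro a ha b hb hab
    rw [mem_coe, mem_filter] at ha hb
    simp only at hab
    lia
  · intro a ha
    rw [mem_filter, mem_Ioc] at ha
    rw [mem_Ioc]; lia
  · intro a ha
    rw [mem_filter] at ha
    rw [show a - h + h = a by lia]

open Classical in
/-- The sieve weight of a pair. -/
def pairW (V A η : ℝ) (N n k : ℕ) : ℝ :=
  if Sifted (midPrimes 3 A η N) n ∧ Sifted (midPrimes 3 A η N) k then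
    V ^ omegaOn (midPrimes 1 A η N) k else 0

lemma pairW_nonneg {V : ℝ} (hV : 0 ≤ V) (A η : ℝ) (N n k : ℕ) : 0 ≤ pairW V A η N n k := by
  rw [pairW]; split_ifs
  exacts [pow_nonneg hV _, le_rfl]

lemma eventually_sum_pairW_le {A η V : ℝ} (hA : 0 < A) (hη : 0 < η) (hη1 : η < 1) (hV0 : 0 ≤ V)
    (hV2 : V ≤ 2) : ∀ᶠ N : ℕ in atTop, ∀ w : ℕ → ℝ, (∀ h, 0 ≤ w h) →
    ∑ n ∈ Ioc 0 N, ∑ k ∈ nbr (2 * N) (lowLim A N) n, w (Nat.dist n k) * pairW V A η N n k ≤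
      2 * (∑ h ∈ Ioc 0 (lowLim A N), w h) *
        (N * Real.exp ((-1 + (V - 1) / 2 + 4 * η) * Real.log (Real.log N))) := by
  filter_upwards [eventually_sieve_le hA hη hη1 hV0 hV2] with N hN w hw
  refine (sum_sum_nbr_le (f := fun n k => w (Nat.dist n k) * pairW V A η N n k)
    (fun a b => mul_nonneg (hw _) (pairW_nonneg hV0 _ _ _ _ _)) N (2 * N) (lowLim A N)).trans ?_
  rw [mul_assoc, sum_mul, mul_sum]
  refine sum_le_sum fun h hh => ?_
  rw [mem_Ioc] at hh
  have h1 := hN 0 h (Nat.zero_le _) hh.2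
  have h2 := hN h 0 hh.2 (Nat.zero_le _)
  rw [if_neg (by lia)] at h1 h2
  have d1 : ∀ m, Nat.dist m (m + h) = h := fun m => by rw [Nat.dist]; lia
  have d2 : ∀ m, Nat.dist (m + h) m = h := fun m => by rw [Nat.dist]; lia
  simp only [d1, d2, ← mul_sum]
  have e1 : w h * ∑ m ∈ Ioc 0 N, pairW V A η N m (m + h) ≤ _ := mul_le_mul_of_nonneg_left h1 (hw h)
  have e2 : w h * ∑ m ∈ Ioc 0 N, pairW V A η N (m + h) m ≤ _ := mul_le_mul_of_nonneg_left h2 (hw h)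
  linarith

lemma eventually_sum_diag_le {A η V : ℝ} (hA : 0 < A) (hη : 0 < η) (hη1 : η < 1) (hV0 : 0 ≤ V)
    (hV2 : V ≤ 2) : ∀ᶠ N : ℕ in atTop, ∑ n ∈ Ioc 0 N, pairW V A η N n n ≤
      N * Real.exp ((-(1 / 2) + (V - 1) / 2 + 4 * η) * Real.log (Real.log N)) := by
  filter_upwards [eventually_sieve_le hA hη hη1 hV0 hV2] with N hN
  have h1 := hN 0 0 (Nat.zero_le _) (Nat.zero_le _)
  rw [if_pos rfl] at h1
  exact h1

lemma sum_inv_dist_sq_le (N k y : ℕ) :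
    ∑ n ∈ (Ioc 0 N).filter (fun n => y < Nat.dist n k), ((Nat.dist n k : ℝ) ^ 2)⁻¹ ≤
      4 / (y + 1) := by
  have hs := sum_Ioo_inv_sq_le (α := ℝ) y (N + k + 1)
  rw [← sum_filter_add_sum_filter_not _ (fun n => n < k)]
  have h1 : ∑ n ∈ ((Ioc 0 N).filter (fun n => y < Nat.dist n k)).filter (fun n => n < k),
      ((Nat.dist n k : ℝ) ^ 2)⁻¹ ≤ ∑ i ∈ Ioo y (N + k + 1), ((i : ℝ) ^ 2)⁻¹ := by
    refine sum_le_sum_of_inj (e := fun n => Nat.dist n k) ?_ ?_ (fun _ _ => by positivity)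
      fun _ _ => le_rfl
    · intro a ha b hb hab
      rw [mem_coe, mem_filter] at ha hb
      simp only [Nat.dist] at hab
      lia
    · intro a ha
      rw [mem_filter, mem_filter, mem_Ioc, Nat.dist] at ha
      simp only [mem_Ioo, Nat.dist]
      lia
  have h2 : ∑ n ∈ ((Ioc 0 N).filter (fun n => y < Nat.dist n k)).filter (fun n => ¬ n < k),
      ((Nat.dist n k : ℝ) ^ 2)⁻¹ ≤ ∑ i ∈ Ioo y (N + k + 1), ((i : ℝ) ^ 2)⁻¹ := by
    refine sum_le_sum_of_inj (e := fun n => Nat.dist n k) ?_ ?_ (fun _ _ => by positivity)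
      fun _ _ => le_rfl
    · intro a ha b hb hab
      rw [mem_coe, mem_filter] at ha hb
      simp only [Nat.dist] at hab
      lia
    · intro a ha
      rw [mem_filter, mem_filter, mem_Ioc, Nat.dist] at ha
      simp only [mem_Ioo, Nat.dist]
      lia
  have h3 : (4 : ℝ) / (y + 1) = 2 / (y + 1) + 2 / (y + 1) := by ring
  linarith

lemma rpow_sum_le {ι : Type*} (s : Finset ι) {f : ι → ℝ} (hf : ∀ i, 0 ≤ f i) {θ : ℝ}
    (h0 : 0 < θ) (h1 : θ ≤ 1) : (∑ i ∈ s, f i) ^ θ ≤ ∑ i ∈ s, f i ^ θ := by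
  classical
  induction s using Finset.induction_on with
  | empty => simp [Real.zero_rpow h0.ne']
  | insert a s ha ih =>
    rw [sum_insert ha, sum_insert ha]
    have := NNReal.rpow_add_le_add_rpow (⟨f a, hf a⟩ : NNReal)
      ⟨∑ i ∈ s, f i, sum_nonneg fun i _ => hf i⟩ h0.le h1
    have h2 : (f a + ∑ i ∈ s, f i) ^ θ ≤ f a ^ θ + (∑ i ∈ s, f i) ^ θ := by exact_mod_cast this
    linarith

lemma two_rpow_sub_le {θ : ℝ} (h : |θ| ≤ 1) :
    ((2 : ℝ) ^ θ - 1) / 2 ≤ θ * (Real.log 2 / 2) + θ ^ 2 / 4 := by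
  have hl0 := Real.log_pos (by norm_num : (1 : ℝ) < 2)
  have hl := Real.log_two_lt_d9
  rw [Real.rpow_def_of_pos (by norm_num)]
  have h1 : |Real.log 2 * θ| ≤ 1 := by
    rw [abs_mul, abs_of_pos hl0]
    nlinarith [abs_nonneg θ]
  have h2 := (abs_le.1 (Real.abs_exp_sub_one_sub_id_le h1)).2
  have h3 : (Real.log 2) ^ 2 ≤ 1 / 2 := by nlinarith
  have h4 := mul_le_mul_of_nonneg_right h3 (sq_nonneg θ)
  nlinarith

lemma card_filter_gt_le {ι : Type*} (s : Finset ι) (p : ι → Prop) [DecidablePred p] {f : ι → ℝ}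
    (hf : ∀ i ∈ s, 0 ≤ f i) {T : ℝ} (hp : ∀ i ∈ s, p i → T ≤ f i) :
    ((s.filter p).card : ℝ) * T ≤ ∑ i ∈ s, f i := by
  rw [← nsmul_eq_mul, ← sum_const]
  refine (sum_le_sum fun i hi => ?_).trans (sum_le_sum_of_subset_of_nonneg (filter_subset p s)
    fun i hi _ => hf i hi)
  exact hp i (mem_filter.1 hi).1 (mem_filter.1 hi).2

end TwoSquares

namespace TwoSquares

open Finset

lemma two_pow_rpow (θ : ℝ) (m : ℕ) : ((2 : ℝ) ^ m) ^ θ = ((2 : ℝ) ^ θ) ^ m := by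
  rw [← Real.rpow_natCast, ← Real.rpow_natCast, ← Real.rpow_mul (by norm_num),
    ← Real.rpow_mul (by norm_num), mul_comm]

lemma Regular.rpow_le {A η ε θ : ℝ} {N n k : ℕ} (hn : Regular A η ε N n) (hk : Regular A η ε N k)
    (hθ : 0 ≤ θ) : (r2 k : ℝ) ^ θ ≤
      Real.exp (ε * θ * Real.log (Real.log N)) * pairW (2 ^ θ) A η N n k := by
  rw [pairW, if_pos ⟨hn.1, hk.1⟩]
  refine (Real.rpow_le_rpow (by positivity) hk.2.2 hθ).trans_eq ?_
  rw [Real.mul_rpow (Real.exp_pos _).le (by positivity), two_pow_rpow, ← Real.exp_mul]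
  ring_nf

lemma Regular.rpow_neg_le {A η ε θ : ℝ} {N n : ℕ} (hn : Regular A η ε N n) (hθ : 0 ≤ θ) :
    (r2 n : ℝ) ^ (-θ) ≤ pairW (2 ^ (-θ)) A η N n n := by
  rw [pairW, if_pos ⟨hn.1, hn.1⟩, ← two_pow_rpow]
  exact Real.rpow_le_rpow_of_nonpos (by positivity) hn.2.1 (by linarith)

lemma card_le_of_card_mul_exp_le {c K M a b v : ℝ}
    (h : c * Real.exp (a * v) ≤ K * (M * Real.exp (b * v))) :
    c ≤ K * (M * Real.exp ((b - a) * v)) := by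
  have h1 : Real.exp (b * v) = Real.exp ((b - a) * v) * Real.exp (a * v) := by
    rw [← Real.exp_add]; ring_nf
  rw [h1] at h
  have := Real.exp_pos (a * v)
  by_contra hc
  push Not at hc
  nlinarith

lemma gain_le {κ ε η : ℝ} (hκ : 0 < κ) (hκ1 : κ ≤ 1) (hε0 : 0 < ε) (hε : 20 * ε ≤ κ ^ 2)
    (hη : η ≤ ε) :
    ((2 : ℝ) ^ κ - 1) / 2 + 4 * η + ε * κ - κ * (Real.log 2 / 2 + κ) ≤ -(κ ^ 2 / 2) ∧
    ((2 : ℝ) ^ (-κ) - 1) / 2 + 4 * η + κ * (Real.log 2 / 2 - κ) ≤ -(κ ^ 2 / 2) := by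
  have h1 := two_rpow_sub_le (θ := κ) (by rw [abs_of_pos hκ]; exact hκ1)
  have h2 := two_rpow_sub_le (θ := -κ) (by rw [abs_neg, abs_of_pos hκ]; exact hκ1)
  constructor <;> nlinarith

lemma two_rpow_le_two {θ : ℝ} (h : θ ≤ 1) : (2 : ℝ) ^ θ ≤ 2 := by
  calc (2 : ℝ) ^ θ ≤ 2 ^ (1 : ℝ) := Real.rpow_le_rpow_of_exponent_le (by norm_num) h
    _ = 2 := Real.rpow_one 2

open Classical in
lemma eventually_card_r2_gt_le {A η ε κ : ℝ} (hA : 0 < A) (hη : 0 < η) (hη1 : η < 1)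
    (hηε : η ≤ ε) (hκ : 0 < κ) (hκ1 : κ ≤ 1) (hε : 20 * ε ≤ κ ^ 2) : ∀ᶠ N : ℕ in atTop,
    (((Ioc 0 N).filter fun n => Regular A η ε N n ∧
      Real.exp ((Real.log 2 / 2 + κ) * Real.log (Real.log N)) < r2 n).card : ℝ) ≤
      N * Real.exp (-(1 / 2 + κ ^ 2 / 2) * Real.log (Real.log N)) := by
  filter_upwards [eventually_sum_diag_le hA hη hη1 (V := 2 ^ κ) (by positivity)
    (two_rpow_le_two hκ1), tendsto_loglog.eventually_ge_atTop 0] with N hN hv0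
  set v := Real.log (Real.log N) with hv
  have h1 := card_filter_gt_le (Ioc 0 N) (fun n => Regular A η ε N n ∧
      Real.exp ((Real.log 2 / 2 + κ) * v) < r2 n)
      (f := fun n => Real.exp (ε * κ * v) * pairW (2 ^ κ) A η N n n)
      (T := Real.exp (κ * (Real.log 2 / 2 + κ) * v))
      (fun n _ => mul_nonneg (Real.exp_pos _).le (pairW_nonneg (by positivity) _ _ _ _ _))
      (fun n _ hn => by
        refine le_trans ?_ (hn.1.rpow_le hn.1 hκ.le)
        rw [show κ * (Real.log 2 / 2 + κ) * v = ((Real.log 2 / 2 + κ) * v) * κ by ring,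
          Real.exp_mul]
        exact Real.rpow_le_rpow (Real.exp_pos _).le hn.2.le hκ.le)
  rw [← mul_sum] at h1
  have h2 := card_le_of_card_mul_exp_le (K := 1) (M := N)
    (b := ε * κ + (-(1 / 2) + (2 ^ κ - 1) / 2 + 4 * η)) (h1.trans
    ((mul_le_mul_of_nonneg_left hN (Real.exp_pos _).le).trans_eq (by
      rw [add_mul (ε * κ), Real.exp_add (ε * κ * v)]; ring)))
  refine h2.trans ?_
  rw [one_mul]
  refine mul_le_mul_of_nonneg_left (Real.exp_le_exp.2 (mul_le_mul_of_nonneg_right ?_ hv0))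
    (Nat.cast_nonneg N)
  have := (gain_le hκ hκ1 (by linarith) hε hηε).1
  linarith

open Classical in
lemma eventually_card_r2_lt_le {A η ε κ : ℝ} (hA : 0 < A) (hη : 0 < η) (hη1 : η < 1)
    (hηε : η ≤ ε) (hκ : 0 < κ) (hκ1 : κ ≤ 1) (hε : 20 * ε ≤ κ ^ 2) : ∀ᶠ N : ℕ in atTop,
    (((Ioc 0 N).filter fun n => Regular A η ε N n ∧
      (r2 n : ℝ) < Real.exp ((Real.log 2 / 2 - κ) * Real.log (Real.log N))).card : ℝ) ≤
      N * Real.exp (-(1 / 2 + κ ^ 2 / 2) * Real.log (Real.log N)) := by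
  filter_upwards [eventually_sum_diag_le hA hη hη1 (V := 2 ^ (-κ)) (by positivity)
    (two_rpow_le_two (by linarith)), tendsto_loglog.eventually_ge_atTop 0] with N hN hv0
  set v := Real.log (Real.log N) with hv
  have h1 := card_filter_gt_le (Ioc 0 N) (fun n => Regular A η ε N n ∧
      (r2 n : ℝ) < Real.exp ((Real.log 2 / 2 - κ) * v))
      (f := fun n => pairW (2 ^ (-κ)) A η N n n)
      (T := Real.exp (-κ * (Real.log 2 / 2 - κ) * v))
      (fun n _ => pairW_nonneg (by positivity) _ _ _ _ _)
      (fun n _ hn => by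
        refine le_trans ?_ (hn.1.rpow_neg_le hκ.le)
        rw [show -κ * (Real.log 2 / 2 - κ) * v = ((Real.log 2 / 2 - κ) * v) * (-κ) by ring,
          Real.exp_mul]
        have : (0 : ℝ) < r2 n := lt_of_lt_of_le (by positivity) hn.1.2.1
        exact Real.rpow_le_rpow_of_nonpos this hn.2.le (by linarith))
  have h2 := card_le_of_card_mul_exp_le (K := 1) (M := N) (h1.trans (hN.trans_eq (one_mul _).symm))
  refine h2.trans ?_
  rw [one_mul]
  refine mul_le_mul_of_nonneg_left (Real.exp_le_exp.2 (mul_le_mul_of_nonneg_right ?_ hv0))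
    (Nat.cast_nonneg N)
  have := (gain_le hκ hκ1 (by linarith) hε hηε).2
  linarith

/-- The range of the close neighbours. -/
def nearLim (N : ℕ) : ℕ := ⌈Real.exp (1 / 2 * Real.log (Real.log N))⌉₊

lemma le_nearLim {N : ℕ} : Real.exp (1 / 2 * Real.log (Real.log N)) ≤ nearLim N := Nat.le_ceil _

lemma nearLim_le {N : ℕ} (h : 0 ≤ Real.log (Real.log N)) :
    (nearLim N : ℝ) ≤ 2 * Real.exp (1 / 2 * Real.log (Real.log N)) := by
  have h1 := (Nat.ceil_lt_add_one (Real.exp_pos (1 / 2 * Real.log (Real.log N))).le).le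
  have h2 : 1 ≤ Real.exp (1 / 2 * Real.log (Real.log N)) := Real.one_le_exp (by positivity)
  rw [nearLim]
  linarith

open Classical in
/-- The contribution of the close regular neighbours. -/
def nearSum (A η ε : ℝ) (N n : ℕ) : ℝ :=
  ∑ k ∈ (nbr (2 * N) (lowLim A N) n).filter
    (fun k => Regular A η ε N k ∧ Nat.dist n k ≤ nearLim N), (r2 k : ℝ)

open Classical in
lemma eventually_card_nearSum_gt_le {A η ε κ : ℝ} (hA : 0 < A) (hη : 0 < η) (hη1 : η < 1)
    (hηε : η ≤ ε) (hκ : 0 < κ) (hκ1 : κ ≤ 1) (hε : 20 * ε ≤ κ ^ 2) : ∀ᶠ N : ℕ in atTop,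
    (((Ioc 0 N).filter fun n => Regular A η ε N n ∧
      Real.exp ((Real.log 2 / 2 + κ) * Real.log (Real.log N)) < nearSum A η ε N n).card : ℝ) ≤
      4 * (N * Real.exp (-(1 / 2 + κ ^ 2 / 2) * Real.log (Real.log N))) := by
  filter_upwards [eventually_sum_pairW_le hA hη hη1 (V := 2 ^ κ) (by positivity)
    (two_rpow_le_two hκ1), tendsto_loglog.eventually_ge_atTop 0] with N hN hv0
  set v := Real.log (Real.log N) with hv
  set w : ℕ → ℝ := fun h => if h ≤ nearLim N then 1 else 0 with hw
  have hw0 : ∀ h, 0 ≤ w h := fun h => by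
    simp only [hw]; split_ifs <;> norm_num
  have hN' := hN w hw0
  have hsw : ∑ h ∈ Ioc 0 (lowLim A N), w h ≤ 2 * Real.exp (1 / 2 * v) := by
    refine le_trans ?_ (nearLim_le hv0)
    simp only [hw]
    rw [← sum_filter, sum_const, nsmul_eq_mul, mul_one]
    have : (Ioc 0 (lowLim A N)).filter (· ≤ nearLim N) ⊆ Ioc 0 (nearLim N) := fun h hh => by
      rw [mem_filter, mem_Ioc] at hh
      rw [mem_Ioc]; lia
    have := card_le_card this
    rw [Nat.card_Ioc] at this
    exact_mod_cast this
  have h1 := card_filter_gt_le (Ioc 0 N) (fun n => Regular A η ε N n ∧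
      Real.exp ((Real.log 2 / 2 + κ) * v) < nearSum A η ε N n)
      (f := fun n => Real.exp (ε * κ * v) * ∑ k ∈ nbr (2 * N) (lowLim A N) n,
        w (Nat.dist n k) * pairW (2 ^ κ) A η N n k)
      (T := Real.exp (κ * (Real.log 2 / 2 + κ) * v))
      (fun n _ => mul_nonneg (Real.exp_pos _).le (sum_nonneg fun _ _ =>
        mul_nonneg (hw0 _) (pairW_nonneg (by positivity) _ _ _ _ _)))
      (fun n _ hn => by
        have e1 : Real.exp (κ * (Real.log 2 / 2 + κ) * v) ≤ nearSum A η ε N n ^ κ := by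
          rw [show κ * (Real.log 2 / 2 + κ) * v = ((Real.log 2 / 2 + κ) * v) * κ by ring,
            Real.exp_mul]
          exact Real.rpow_le_rpow (Real.exp_pos _).le hn.2.le hκ.le
        refine e1.trans ((rpow_sum_le _ (fun _ => by positivity) hκ hκ1).trans ?_)
        rw [sum_filter, mul_sum]
        refine sum_le_sum fun k _ => ?_
        split_ifs with hk
        · have := hn.1.rpow_le hk.1 hκ.le
          simp only [hw]
          rw [if_pos hk.2, one_mul]
          exact this
        · exact mul_nonneg (Real.exp_pos _).le
            (mul_nonneg (hw0 _) (pairW_nonneg (by positivity) _ _ _ _ _)))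
  rw [← mul_sum] at h1
  have h3 : ∑ n ∈ Ioc 0 N, ∑ k ∈ nbr (2 * N) (lowLim A N) n,
      w (Nat.dist n k) * pairW (2 ^ κ) A η N n k ≤
      4 * (N * Real.exp ((-(1 / 2) + (2 ^ κ - 1) / 2 + 4 * η) * v)) := by
    refine hN'.trans ?_
    calc _ ≤ 2 * (2 * Real.exp (1 / 2 * v)) *
          (N * Real.exp ((-1 + (2 ^ κ - 1) / 2 + 4 * η) * v)) := by gcongr
      _ = 4 * (N * (Real.exp (1 / 2 * v) * Real.exp ((-1 + (2 ^ κ - 1) / 2 + 4 * η) * v))) := by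
          ring
      _ = _ := by rw [← Real.exp_add]; ring_nf
  have h2 := card_le_of_card_mul_exp_le (K := 4) (M := N)
    (b := ε * κ + (-(1 / 2) + (2 ^ κ - 1) / 2 + 4 * η)) (h1.trans
    ((mul_le_mul_of_nonneg_left h3 (Real.exp_pos _).le).trans_eq (by
      rw [add_mul (ε * κ), Real.exp_add (ε * κ * v)]; ring)))
  refine h2.trans ?_
  refine mul_le_mul_of_nonneg_left (mul_le_mul_of_nonneg_left
    (Real.exp_le_exp.2 (mul_le_mul_of_nonneg_right ?_ hv0)) (Nat.cast_nonneg N)) (by norm_num)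
  have := (gain_le hκ hκ1 (by linarith) hε hηε).1
  linarith

end TwoSquares

namespace TwoSquares

open Finset

open Classical in
/-- The contribution of the regular neighbours at intermediate distance. -/
def midSum (A η ε s β : ℝ) (N n : ℕ) : ℝ :=
  ∑ k ∈ (nbr (2 * N) (lowLim A N) n).filter
    (fun k => Regular A η ε N k ∧ nearLim N < Nat.dist n k),
      (r2 k : ℝ) * (2 * Real.exp (β * Real.log (Real.log N)) / Nat.dist n k) ^ (2 * s)

lemma rpow_div_le {X H d s : ℝ} (hX : 0 < X) (hH : 0 < H) (hd : H ≤ d) (hs : 1 ≤ s) :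
    (X / d) ^ (2 * s) ≤ (X / H) ^ (2 * s - 2) * (X ^ 2 * (d ^ 2)⁻¹) := by
  have hd0 : 0 < d := hH.trans_le hd
  have h1 : (X / d) ^ (2 * s) = (X / d) ^ (2 * s - 2) * (X / d) ^ (2 : ℝ) := by
    rw [← Real.rpow_add (by positivity)]; ring_nf
  rw [h1, Real.rpow_two, div_pow, div_eq_mul_inv (X ^ 2)]
  refine mul_le_mul_of_nonneg_right ?_ (by positivity)
  refine Real.rpow_le_rpow (by positivity) ?_ (by linarith)
  exact div_le_div_of_nonneg_left hX.le hH hd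

lemma midWeight_sum_le {X s v : ℝ} {H y : ℕ} (hX : 0 < X) (hs : 1 ≤ s)
    (hH : Real.exp (1 / 2 * v) ≤ H) :
    ∑ h ∈ Ioc 0 y, (if H < h then (X / H) ^ (2 * s - 2) * (X ^ 2 * ((h : ℝ) ^ 2)⁻¹) else 0) ≤
      X ^ (2 * s) * Real.exp ((1 / 2 - s) * v) := by
  have hHr : (0 : ℝ) < H := (Real.exp_pos _).trans_le hH
  have hH0 : H ≠ 0 := by rintro rfl; simp at hHr
  rw [← sum_filter, ← mul_sum, ← mul_sum]
  have h1 : ∑ h ∈ (Ioc 0 y).filter (H < ·), ((h : ℝ) ^ 2)⁻¹ ≤ (H : ℝ)⁻¹ := by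
    refine (sum_le_sum_of_subset_of_nonneg (t := Ioc H (max H y)) ?_
      fun _ _ _ => by positivity).trans ?_
    · intro h hh
      rw [mem_filter, mem_Ioc] at hh
      rw [mem_Ioc]
      exact ⟨hh.2, le_max_of_le_right hh.1.2⟩
    · refine (sum_Ioc_inv_sq_le_sub hH0 (le_max_left _ _)).trans ?_
      have : (0 : ℝ) ≤ ((max H y : ℕ) : ℝ)⁻¹ := by positivity
      linarith
  calc _ ≤ (X / H) ^ (2 * s - 2) * (X ^ 2 * (H : ℝ)⁻¹) := by gcongr
    _ ≤ (X / Real.exp (1 / 2 * v)) ^ (2 * s - 2) * (X ^ 2 * (Real.exp (1 / 2 * v))⁻¹) := by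
        have : (0 : ℝ) ≤ 2 * s - 2 := by linarith
        gcongr
    _ = _ := by
        rw [Real.div_rpow hX.le (Real.exp_pos _).le, ← Real.exp_mul, ← Real.exp_neg,
          div_eq_mul_inv, ← Real.exp_neg]
        have e1 : X ^ (2 * s) = X ^ (2 * s - 2) * X ^ 2 := by
          rw [← Real.rpow_two, ← Real.rpow_add hX]; ring_nf
        have e2 : Real.exp ((1 / 2 - s) * v) =
            Real.exp (-(1 / 2 * v * (2 * s - 2))) * Real.exp (-(1 / 2 * v)) := by
          rw [← Real.exp_add]; ring_nf
        rw [e1, e2]; ring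

open Classical in
lemma eventually_card_midSum_gt_le {A η ε κ s β : ℝ} (hA : 0 < A) (hη : 0 < η) (hη1 : η < 1)
    (hηε : η ≤ ε) (hε : 10 * ε ≤ κ) (hs : 1 ≤ s) : ∀ᶠ N : ℕ in atTop,
    (((Ioc 0 N).filter fun n => Regular A η ε N n ∧
      Real.exp ((2 * s * β - s + 1 / 2 + κ) * Real.log (Real.log N)) <
        midSum A η ε s β N n).card : ℝ) ≤
      2 * 2 ^ (2 * s) * (N * Real.exp (-(1 / 2 + κ / 2) * Real.log (Real.log N))) := by
  filter_upwards [eventually_sum_pairW_le hA hη hη1 (V := 2) (by norm_num) le_rfl,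
    tendsto_loglog.eventually_ge_atTop 0] with N hN hv0
  set v := Real.log (Real.log N) with hv
  set X := 2 * Real.exp (β * v) with hX
  have hX0 : 0 < X := by positivity
  have hHr : (0 : ℝ) < nearLim N := (Real.exp_pos _).trans_le le_nearLim
  set w : ℕ → ℝ := fun h => if nearLim N < h then
    (X / nearLim N) ^ (2 * s - 2) * (X ^ 2 * ((h : ℝ) ^ 2)⁻¹) else 0 with hw
  have hw0 : ∀ h, 0 ≤ w h := fun h => by
    simp only [hw]; split_ifs <;> positivity
  have hN' := hN w hw0
  have hsw : ∑ h ∈ Ioc 0 (lowLim A N), w h ≤ X ^ (2 * s) * Real.exp ((1 / 2 - s) * v) :=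
    midWeight_sum_le hX0 hs le_nearLim
  have h1 := card_filter_gt_le (Ioc 0 N) (fun n => Regular A η ε N n ∧
      Real.exp ((2 * s * β - s + 1 / 2 + κ) * v) < midSum A η ε s β N n)
      (f := fun n => Real.exp (ε * v) * ∑ k ∈ nbr (2 * N) (lowLim A N) n,
        w (Nat.dist n k) * pairW 2 A η N n k)
      (T := Real.exp ((2 * s * β - s + 1 / 2 + κ) * v))
      (fun n _ => mul_nonneg (Real.exp_pos _).le (sum_nonneg fun _ _ =>
        mul_nonneg (hw0 _) (pairW_nonneg (by norm_num) _ _ _ _ _)))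
      (fun n _ hn => by
        refine hn.2.le.trans ?_
        rw [midSum, sum_filter, mul_sum]
        refine sum_le_sum fun k _ => ?_
        split_ifs with hk
        · have e1 := hn.1.rpow_le hk.1 (θ := 1) zero_le_one
          rw [Real.rpow_one, Real.rpow_one, mul_one] at e1
          have e2 : (2 * Real.exp (β * v) / Nat.dist n k) ^ (2 * s) ≤ w (Nat.dist n k) := by
            simp only [hw]
            rw [if_pos hk.2]
            exact rpow_div_le hX0 hHr (by exact_mod_cast hk.2.le) hs
          calc _ ≤ (Real.exp (ε * v) * pairW 2 A η N n k) * w (Nat.dist n k) :=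
                mul_le_mul e1 e2 (by positivity) (mul_nonneg (Real.exp_pos _).le
                  (pairW_nonneg (by norm_num) _ _ _ _ _))
            _ = _ := by ring
        · exact mul_nonneg (Real.exp_pos _).le
            (mul_nonneg (hw0 _) (pairW_nonneg (by norm_num) _ _ _ _ _)))
  rw [← mul_sum] at h1
  have h3 : Real.exp (ε * v) * ∑ n ∈ Ioc 0 N, ∑ k ∈ nbr (2 * N) (lowLim A N) n,
      w (Nat.dist n k) * pairW 2 A η N n k ≤
      2 * 2 ^ (2 * s) * (N * Real.exp ((2 * s * β - s + ε + 4 * η) * v)) := by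
    calc _ ≤ Real.exp (ε * v) * (2 * (X ^ (2 * s) * Real.exp ((1 / 2 - s) * v)) *
          (N * Real.exp ((-1 + (2 - 1) / 2 + 4 * η) * v))) := by
          refine mul_le_mul_of_nonneg_left (hN'.trans ?_) (Real.exp_pos _).le
          gcongr
      _ = 2 * 2 ^ (2 * s) * (N * (Real.exp (ε * v) * Real.exp (β * v * (2 * s)) *
          Real.exp ((1 / 2 - s) * v) * Real.exp ((-1 + (2 - 1) / 2 + 4 * η) * v))) := by
          rw [hX, Real.mul_rpow (by norm_num) (Real.exp_pos _).le, ← Real.exp_mul]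
          ring
      _ = _ := by rw [← Real.exp_add, ← Real.exp_add, ← Real.exp_add]; ring_nf
  refine (card_le_of_card_mul_exp_le (h1.trans h3)).trans ?_
  gcongr
  linarith

open Classical in
/-- The contribution of irregular or distant neighbours, up to a constant factor. -/
def restSum (A η ε β : ℝ) (N n : ℕ) : ℝ :=
  ∑ k ∈ (Ioc 0 (2 * N)).filter (fun k => k ≠ n ∧
    ((k ∈ SOS ∧ ¬ Regular A η ε N k) ∨ lowLim A N < Nat.dist n k)),
      (r2 k : ℝ) * ((2 * Real.exp (β * Real.log (Real.log N))) ^ 2 * ((Nat.dist n k : ℝ) ^ 2)⁻¹)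

open Classical in
lemma eventually_card_restSum_gt_le {A η ε β D : ℝ} (hβ : 0 ≤ β) (hDA : D ≤ A)
    (hD : 2 * β + 2 ≤ D) (hirr : ∀ᶠ N : ℕ in atTop,
    ∑ n ∈ (Ioc 0 (2 * N)).filter (fun n => n ∈ SOS ∧ ¬ Regular A η ε N n), (r2 n : ℝ) ≤
      N * Real.exp (-D * Real.log (Real.log N))) : ∀ᶠ N : ℕ in atTop,
    (((Ioc 0 N).filter fun n => 1 < restSum A η ε β N n).card : ℝ) ≤
      1000 * (N * Real.exp (-2 * Real.log (Real.log N))) := by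
  filter_upwards [hirr, tendsto_loglog.eventually_ge_atTop 0, eventually_ge_atTop 1]
    with N hN hv0 hN1
  set v := Real.log (Real.log N) with hv
  set X := (2 * Real.exp (β * v)) ^ 2 with hX
  have hX0 : 0 ≤ X := by positivity
  have h1 := card_filter_gt_le (Ioc 0 N) (fun n => 1 < restSum A η ε β N n)
      (f := fun n => restSum A η ε β N n) (T := 1)
      (fun n _ => sum_nonneg fun _ _ => by positivity) (fun n _ hn => hn.le)
  rw [mul_one] at h1
  refine h1.trans ?_
  have hpt : ∀ n ∈ Ioc 0 N, restSum A η ε β N n ≤ ∑ k ∈ Ioc 0 (2 * N), (r2 k : ℝ) * X *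
      ((if k ∈ SOS ∧ ¬ Regular A η ε N k then (if 0 < Nat.dist n k then
        ((Nat.dist n k : ℝ) ^ 2)⁻¹ else 0) else 0) +
      (if lowLim A N < Nat.dist n k then ((Nat.dist n k : ℝ) ^ 2)⁻¹ else 0)) := by
    intro n _
    rw [restSum, sum_filter]
    refine sum_le_sum fun k _ => ?_
    have p1 : (0 : ℝ) ≤ ((Nat.dist n k : ℝ) ^ 2)⁻¹ := by positivity
    have p2 : (0 : ℝ) ≤ (r2 k : ℝ) * X := by positivity
    split_ifs with g1 g2 g3 g4 g5 g6 g7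
    all_goals first
      | positivity
      | skip
    · rw [← mul_assoc]; nlinarith
    · rw [← mul_assoc]; nlinarith
    · exfalso; apply g3; have := g1.1; rw [Nat.dist]; lia
    · exfalso; apply g3; have := g1.1; rw [Nat.dist]; lia
    · rw [← mul_assoc]; nlinarith
    · exfalso; tauto
  refine (sum_le_sum hpt).trans ?_
  rw [sum_comm]
  have hy : Real.exp (A * v) ≤ 2 * (lowLim A N : ℝ) :=
    exp_le_two_mul_floor (mul_nonneg (by linarith) hv0)
  have hk : ∀ k ∈ Ioc 0 (2 * N), ∑ n ∈ Ioc 0 N, (r2 k : ℝ) * X *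
      ((if k ∈ SOS ∧ ¬ Regular A η ε N k then (if 0 < Nat.dist n k then
        ((Nat.dist n k : ℝ) ^ 2)⁻¹ else 0) else 0) +
      (if lowLim A N < Nat.dist n k then ((Nat.dist n k : ℝ) ^ 2)⁻¹ else 0)) ≤
      (r2 k : ℝ) * X * ((if k ∈ SOS ∧ ¬ Regular A η ε N k then 4 else 0) +
        8 * Real.exp (-A * v)) := by
    intro k _
    rw [← mul_sum, sum_add_distrib]
    refine mul_le_mul_of_nonneg_left (add_le_add ?_ ?_) (by positivity)
    · split_ifs
      · have := sum_inv_dist_sq_le N k 0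
        rw [sum_filter] at this
        simpa using this
      · simp
    · have := sum_inv_dist_sq_le N k (lowLim A N)
      rw [sum_filter] at this
      refine this.trans ?_
      rw [div_le_iff₀ (by positivity), neg_mul, Real.exp_neg]
      have h0 := Real.exp_pos (A * v)
      field_simp
      linarith
  refine (sum_le_sum hk).trans ?_
  have hsplit : ∑ k ∈ Ioc 0 (2 * N), (r2 k : ℝ) * X *
      ((if k ∈ SOS ∧ ¬ Regular A η ε N k then 4 else 0) + 8 * Real.exp (-A * v)) =
      4 * X * ∑ k ∈ (Ioc 0 (2 * N)).filter (fun k => k ∈ SOS ∧ ¬ Regular A η ε N k), (r2 k : ℝ) +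
      8 * X * Real.exp (-A * v) * ∑ k ∈ Ioc 0 (2 * N), (r2 k : ℝ) := by
    rw [sum_filter, mul_sum, mul_sum, ← sum_add_distrib]
    refine sum_congr rfl fun k _ => ?_
    split_ifs <;> ring
  rw [hsplit]
  have hr : ∑ k ∈ Ioc 0 (2 * N), (r2 k : ℝ) ≤ 18 * N := by
    have h2 := sum_r2_le_linear (N := 2 * N) (by lia)
    have h3 : ∑ k ∈ Ioc 0 (2 * N), r2 k ≤ ∑ k ∈ range (2 * N + 1), r2 k :=
      sum_le_sum_of_subset fun k hk => by
        rw [mem_Ioc] at hk; rw [mem_range]; lia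
    have h4 : ∑ k ∈ Ioc 0 (2 * N), r2 k ≤ 18 * N := by lia
    exact_mod_cast h4
  have hXe : X = 4 * Real.exp (2 * β * v) := by
    rw [hX, mul_pow, ← Real.exp_nat_mul]; push_cast; ring_nf
  have hN0 : (0 : ℝ) ≤ N := Nat.cast_nonneg N
  have k1 : Real.exp (2 * β * v) * Real.exp (-D * v) ≤ Real.exp (-2 * v) := by
    rw [← Real.exp_add]; apply Real.exp_le_exp.2; nlinarith
  have k2 : Real.exp (2 * β * v) * Real.exp (-A * v) ≤ Real.exp (-2 * v) := by
    rw [← Real.exp_add]; apply Real.exp_le_exp.2; nlinarith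
  calc _ ≤ 4 * X * (N * Real.exp (-D * v)) + 8 * X * Real.exp (-A * v) * (18 * N) := by
        gcongr
    _ = 16 * N * (Real.exp (2 * β * v) * Real.exp (-D * v)) +
        576 * N * (Real.exp (2 * β * v) * Real.exp (-A * v)) := by rw [hXe]; ring
    _ ≤ 16 * N * Real.exp (-2 * v) + 576 * N * Real.exp (-2 * v) := by gcongr
    _ ≤ _ := by
        have := mul_nonneg hN0 (Real.exp_pos (-2 * v)).le
        linarith

end TwoSquares

namespace TwoSquares

open Finset

/-- Both `r₂ n` and the weighted sum of `r₂` over the neighbours of `n` have typical size. -/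
def Typical (s β κ : ℝ) (N n : ℕ) : Prop :=
  Real.exp ((Real.log 2 / 2 - κ) * Real.log (Real.log N)) ≤ r2 n ∧
  (r2 n : ℝ) ≤ Real.exp ((Real.log 2 / 2 + κ) * Real.log (Real.log N)) ∧
  ∑ k ∈ (Ioc 0 (2 * N)).filter (· ≠ n), (r2 k : ℝ) *
      min 1 ((2 * Real.exp (β * Real.log (Real.log N)) / Nat.dist n k) ^ (2 * s)) ≤
    Real.exp ((Real.log 2 / 2 + κ) * Real.log (Real.log N)) +
      Real.exp ((2 * s * β - s + 1 / 2 + κ) * Real.log (Real.log N)) + 1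

lemma min_one_rpow_le {x s : ℝ} (hx : 0 ≤ x) (hs : 1 ≤ s) : min 1 (x ^ (2 * s)) ≤ x ^ 2 := by
  rcases le_total x 1 with h | h
  · refine (min_le_right _ _).trans ?_
    rcases hx.eq_or_lt with rfl | hx0
    · rw [Real.zero_rpow (by linarith)]; norm_num
    · rw [← Real.rpow_two]
      exact Real.rpow_le_rpow_of_exponent_ge hx0 h (by linarith)
  · exact (min_le_left _ _).trans (one_le_pow₀ h)

lemma sum_min_le (A η ε : ℝ) {s : ℝ} (hs : 1 ≤ s) (β : ℝ) (N n : ℕ) :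
    ∑ k ∈ (Ioc 0 (2 * N)).filter (· ≠ n), (r2 k : ℝ) *
      min 1 ((2 * Real.exp (β * Real.log (Real.log N)) / Nat.dist n k) ^ (2 * s)) ≤
    nearSum A η ε N n + midSum A η ε s β N n + restSum A η ε β N n := by
  classical
  set X := 2 * Real.exp (β * Real.log (Real.log N)) with hX
  have hX0 : 0 ≤ X := by positivity
  rw [nearSum, midSum, restSum, nbr, filter_filter, filter_filter, sum_filter, sum_filter,
    sum_filter, sum_filter, ← sum_add_distrib, ← sum_add_distrib]
  refine sum_le_sum fun k _ => ?_
  have t1 : 0 ≤ (if (k ≠ n ∧ Nat.dist n k ≤ lowLim A N) ∧ Regular A η ε N k ∧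
      Nat.dist n k ≤ nearLim N then (r2 k : ℝ) else 0) := by split_ifs <;> positivity
  have t2 : 0 ≤ (if (k ≠ n ∧ Nat.dist n k ≤ lowLim A N) ∧ Regular A η ε N k ∧
      nearLim N < Nat.dist n k then (r2 k : ℝ) * (X / Nat.dist n k) ^ (2 * s) else 0) := by
    split_ifs <;> positivity
  have t3 : 0 ≤ (if k ≠ n ∧ (k ∈ SOS ∧ ¬ Regular A η ε N k ∨ lowLim A N < Nat.dist n k) then
      (r2 k : ℝ) * (X ^ 2 * ((Nat.dist n k : ℝ) ^ 2)⁻¹) else 0) := by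
    split_ifs <;> positivity
  by_cases hk : k ≠ n
  swap
  · rw [if_neg hk]; linarith
  rw [if_pos hk]
  by_cases hS : k ∈ SOS
  swap
  · rw [r2_eq_zero hS, Nat.cast_zero, zero_mul]
    rw [r2_eq_zero hS, Nat.cast_zero] at t1 t2 t3
    linarith
  have hr : (0 : ℝ) ≤ r2 k := Nat.cast_nonneg _
  by_cases hrest : ¬ Regular A η ε N k ∨ lowLim A N < Nat.dist n k
  · have e : (r2 k : ℝ) * min 1 ((X / Nat.dist n k) ^ (2 * s)) ≤
        (r2 k : ℝ) * (X ^ 2 * ((Nat.dist n k : ℝ) ^ 2)⁻¹) := by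
      refine mul_le_mul_of_nonneg_left ?_ hr
      refine (min_one_rpow_le (by positivity) hs).trans_eq ?_
      rw [div_pow, div_eq_mul_inv]
    rw [if_pos (c := k ≠ n ∧ _) ⟨hk, by tauto⟩]
    rw [if_pos (c := k ≠ n ∧ _) ⟨hk, by tauto⟩] at t3
    linarith
  · push Not at hrest
    by_cases hd : Nat.dist n k ≤ nearLim N
    · rw [if_pos (c := _ ∧ Regular A η ε N k ∧ Nat.dist n k ≤ nearLim N)
        ⟨⟨hk, hrest.2⟩, hrest.1, hd⟩]
      have e : (r2 k : ℝ) * min 1 ((X / Nat.dist n k) ^ (2 * s)) ≤ (r2 k : ℝ) * 1 :=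
        mul_le_mul_of_nonneg_left (min_le_left _ _) hr
      linarith
    · push Not at hd
      rw [if_pos (c := _ ∧ Regular A η ε N k ∧ nearLim N < Nat.dist n k)
        ⟨⟨hk, hrest.2⟩, hrest.1, hd⟩]
      have e : (r2 k : ℝ) * min 1 ((X / Nat.dist n k) ^ (2 * s)) ≤
          (r2 k : ℝ) * (X / Nat.dist n k) ^ (2 * s) :=
        mul_le_mul_of_nonneg_left (min_le_right _ _) hr
      linarith

open Classical in
/-- All but few sums of two squares are typical. -/
theorem eventually_card_not_typical_le {s β κ : ℝ} (hs : 1 ≤ s) (hβ : 0 ≤ β) (hκ : 0 < κ)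
    (hκ1 : κ ≤ 1) : ∀ᶠ N : ℕ in atTop,
    (((Ioc 0 N).filter fun n => n ∈ SOS ∧ ¬ Typical s β κ N n).card : ℝ) ≤
      N * Real.exp (-(1 / 2 + κ ^ 2 / 4) * Real.log (Real.log N)) := by
  have hκ2 : κ ^ 2 ≤ κ := by nlinarith
  obtain ⟨A, η, hDA, hη, hη1, hηε, hirr⟩ := exists_sum_irregular_le (ε := κ ^ 2 / 20)
    (D := 2 * β + 2) (by positivity) (by positivity)
  have hA : 0 < A := by linarith
  set ε := κ ^ 2 / 20 with hε
  have hv := tendsto_loglog.eventually (eventually_const_mul_exp_le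
    (K := 1 + 6 + 2 * 2 ^ (2 * s) + 1000) (c := -(1 / 2 + κ ^ 2 / 2)) (d := -(1 / 2 + κ ^ 2 / 4))
    (by nlinarith))
  filter_upwards [hirr, hv, tendsto_loglog.eventually_ge_atTop 0,
    eventually_card_r2_gt_le hA hη hη1 hηε hκ hκ1 (by linarith),
    eventually_card_r2_lt_le hA hη hη1 hηε hκ hκ1 (by linarith),
    eventually_card_nearSum_gt_le hA hη hη1 hηε hκ hκ1 (by linarith),
    eventually_card_midSum_gt_le (β := β) hA hη hη1 hηε (by linarith : 10 * ε ≤ κ) hs,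
    eventually_card_restSum_gt_le hβ hDA.le le_rfl hirr]
    with N hirr hK hv0 hgt hlt hnear hmid hrest
  set v := Real.log (Real.log N) with hvd
  have hirr' : (((Ioc 0 (2 * N)).filter
      (fun n => n ∈ SOS ∧ ¬ Regular A η ε N n)).card : ℝ) ≤
      N * Real.exp (-(2 * β + 2) * v) := by
    refine le_trans ?_ hirr
    rw [card_eq_sum_ones, Nat.cast_sum]
    refine sum_le_sum fun n hn => ?_
    exact_mod_cast r2_pos_iff.2 (mem_filter.1 hn).2.1
  have hsub : ((Ioc 0 N).filter fun n => n ∈ SOS ∧ ¬ Typical s β κ N n) ⊆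
      ((Ioc 0 (2 * N)).filter (fun n => n ∈ SOS ∧ ¬ Regular A η ε N n)) ∪
      (((Ioc 0 N).filter fun n => Regular A η ε N n ∧
        Real.exp ((Real.log 2 / 2 + κ) * v) < r2 n) ∪
      (((Ioc 0 N).filter fun n => Regular A η ε N n ∧
        (r2 n : ℝ) < Real.exp ((Real.log 2 / 2 - κ) * v)) ∪
      (((Ioc 0 N).filter fun n => Regular A η ε N n ∧
        Real.exp ((Real.log 2 / 2 + κ) * v) < nearSum A η ε N n) ∪
      (((Ioc 0 N).filter fun n => Regular A η ε N n ∧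
        Real.exp ((2 * s * β - s + 1 / 2 + κ) * v) < midSum A η ε s β N n) ∪
      ((Ioc 0 N).filter fun n => 1 < restSum A η ε β N n))))) := by
    intro n hn
    rw [mem_filter] at hn
    obtain ⟨hn1, hnS, hnT⟩ := hn
    by_contra hcon
    simp only [mem_union, mem_filter, hn1, hnS, true_and, not_or, not_and, not_lt, not_not] at hcon
    obtain ⟨c1, c2, c3, c4, c5, c6⟩ := hcon
    rw [mem_Ioc] at hn1
    have hR := c1 (mem_Ioc.2 ⟨hn1.1, by lia⟩)
    apply hnT
    refine ⟨c3 hR, c2 hR, (sum_min_le A η ε hs β N n).trans ?_⟩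
    have := c4 hR
    have := c5 hR
    linarith
  have hcard := (card_le_card hsub).trans ((card_union_le _ _).trans (Nat.add_le_add_left
    ((card_union_le _ _).trans (Nat.add_le_add_left ((card_union_le _ _).trans
    (Nat.add_le_add_left ((card_union_le _ _).trans (Nat.add_le_add_left
    (card_union_le _ _) _)) _)) _)) _))
  have hcard' := (Nat.cast_le (α := ℝ)).2 hcard
  push_cast at hcard'
  have hN0 : (0 : ℝ) ≤ N := Nat.cast_nonneg N
  have w1 : N * Real.exp (-(2 * β + 2) * v) ≤ N * Real.exp (-(1 / 2 + κ ^ 2 / 2) * v) :=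
    mul_le_mul_of_nonneg_left (Real.exp_le_exp.2 (mul_le_mul_of_nonneg_right
      (by linarith) hv0)) hN0
  have w2 : 2 * 2 ^ (2 * s) * (N * Real.exp (-(1 / 2 + κ / 2) * v)) ≤
      2 * 2 ^ (2 * s) * (N * Real.exp (-(1 / 2 + κ ^ 2 / 2) * v)) := by gcongr
  have w3 : 1000 * (N * Real.exp (-2 * v)) ≤
      1000 * (N * Real.exp (-(1 / 2 + κ ^ 2 / 2) * v)) := by gcongr; nlinarith
  have w4 := mul_le_mul_of_nonneg_left hK hN0
  linarith

end TwoSquares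

/-! ### A lower bound for the number of sums of two squares -/

namespace TwoSquares

open Finset

lemma exp_sum_sub_one_le_prod {P : Finset ℕ} (hP : ∀ p ∈ P, 1 < p) :
    Real.exp (∑ p ∈ P, 1 / (p : ℝ) - 1) ≤ ∏ p ∈ P, (1 + 1 / (p : ℝ)) := by
  have h1 : ∑ p ∈ P, ((p : ℝ) ^ 2)⁻¹ ≤ 1 := by
    refine (sum_le_sum_of_subset_of_nonneg (t := Ioc 1 (P.sup id + 2)) ?_
      (fun _ _ _ => by positivity)).trans ?_
    · intro p hp
      have := le_sup (f := id) hp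
      simp only [id] at this
      exact mem_Ioc.2 ⟨hP p hp, by lia⟩
    · refine (sum_Ioc_inv_sq_le_sub one_ne_zero (by lia)).trans ?_
      have : (0 : ℝ) ≤ ((P.sup id + 2 : ℕ) : ℝ)⁻¹ := by positivity
      simp only [Nat.cast_one, inv_one]
      linarith
  calc Real.exp (∑ p ∈ P, 1 / (p : ℝ) - 1)
      ≤ Real.exp (∑ p ∈ P, (1 / (p : ℝ) - ((p : ℝ) ^ 2)⁻¹)) := by
        rw [sum_sub_distrib]
        exact Real.exp_le_exp.2 (by linarith)
    _ = ∏ p ∈ P, Real.exp (1 / (p : ℝ) - ((p : ℝ) ^ 2)⁻¹) := Real.exp_sum _ _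
    _ ≤ _ := by
        refine prod_le_prod (fun _ _ => (Real.exp_pos _).le) fun p hp => ?_
        have hp1 : (1 : ℝ) < p := by exact_mod_cast hP p hp
        set x := 1 / (p : ℝ) with hx
        have hx0 : 0 < x := by positivity
        have hx1 : x ≤ 1 := by rw [hx, div_le_one (by linarith)]; exact hp1.le
        have e : ((p : ℝ) ^ 2)⁻¹ = x ^ 2 := by rw [hx, div_pow, one_pow, one_div]
        rw [e]
        have hy : |x - x ^ 2| ≤ 1 := by rw [abs_le]; constructor <;> nlinarith
        have := (abs_le.1 (Real.abs_exp_sub_one_sub_id_le hy)).2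
        nlinarith [mul_pos hx0 hx0, mul_pos (mul_pos hx0 hx0) hx0]

open Classical in
lemma sum_card_le_card_SOS {P : Finset ℕ} {z N : ℕ} (hP : ∀ p ∈ P, p ≤ z ∧ p.Prime ∧ p % 4 = 1)
    (F : Finset (Finset ℕ)) (hF : ∀ S ∈ F, S ⊆ P) (R : Finset ℕ → Finset ℕ)
    (hR : ∀ S ∈ F, ∀ p ∈ R S, z < p ∧ p.Prime ∧ p % 4 = 1 ∧ p * ∏ x ∈ S, x ≤ N) :
    ∑ S ∈ F, (R S).card ≤ ((Ioc 0 N).filter (· ∈ SOS)).card := by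
  rw [← card_sigma]
  have hpf : ∀ S ∈ F, ∀ p ∈ R S,
      (p * ∏ x ∈ S, x).primeFactors.filter (· ≤ z) = S := by
    intro S hS p hp
    obtain ⟨h1, h2, h3, h4⟩ := hR S hS p hp
    have hSp : ∀ x ∈ S, x.Prime := fun x hx => (hP x (hF S hS hx)).2.1
    rw [Nat.primeFactors_mul h2.ne_zero (prod_ne_zero_iff.2 fun x hx => (hSp x hx).ne_zero),
      Nat.primeFactors_prod hSp, h2.primeFactors]
    ext x
    simp only [mem_filter, mem_union, mem_singleton]
    constructor
    · rintro ⟨rfl | h, h'⟩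
      · lia
      · exact h
    · intro h
      exact ⟨Or.inr h, (hP x (hF S hS h)).1⟩
  refine card_le_card_of_injOn (fun y => y.2 * ∏ x ∈ y.1, x) ?_ ?_
  · rintro ⟨S, p⟩ hy
    rw [mem_coe, mem_sigma] at hy
    obtain ⟨h1, h2, h3, h4⟩ := hR S hy.1 p hy.2
    have hSp : ∀ x ∈ S, x.Prime := fun x hx => (hP x (hF S hy.1 hx)).2.1
    rw [mem_coe, mem_filter, mem_Ioc]
    refine ⟨⟨Nat.mul_pos h2.pos (prod_pos fun x hx => (hSp x hx).pos), h4⟩, ?_⟩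
    exact mul_mem_SOS (prime_mem_SOS h2 (by lia)) (prod_mem_SOS fun x hx =>
      prime_mem_SOS (hSp x hx) (by have := (hP x (hF S hy.1 hx)).2.2; lia))
  · rintro ⟨S, p⟩ hy ⟨S', p'⟩ hy' heq
    rw [mem_coe, mem_sigma] at hy hy'
    simp only at heq hy hy'
    have e1 := hpf S hy.1 p hy.2
    have e2 := hpf S' hy'.1 p' hy'.2
    rw [heq, e2] at e1
    subst e1
    have hSp : ∀ x ∈ S', x.Prime := fun x hx => (hP x (hF S' hy.1 hx)).2.1
    have := Nat.eq_of_mul_eq_mul_right (prod_pos fun x hx => (hSp x hx).pos) heq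
    rw [this]

lemma half_pow_floor_le {v : ℝ} (hv : 4 ≤ v) :
    ((1 : ℝ) / 2) ^ (⌊4 * v⌋₊ + 1) ≤ 1 / 2 * Real.exp (-(2 * v)) := by
  have h1 : 4 * v < (⌊4 * v⌋₊ + 1 : ℕ) := by exact_mod_cast Nat.lt_floor_add_one (4 * v)
  have hl := Real.log_two_gt_d9
  have hl' := Real.log_two_lt_d9
  have e1 : ((1 : ℝ) / 2) = Real.exp (-Real.log 2) := by
    rw [Real.exp_neg, Real.exp_log (by norm_num)]; norm_num
  rw [e1, ← Real.exp_nat_mul, ← Real.exp_add]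
  apply Real.exp_le_exp.2
  nlinarith

open Classical in
lemma exists_sum_inv_prod_ge {η : ℝ} (hη : 0 < η) (hη1 : η ≤ 1 / 4) : ∀ᶠ N : ℕ in atTop,
    1 / 2 * Real.exp ((1 / 2 - η) * Real.log (Real.log N) - 1) ≤
      ∑ S ∈ (midPrimes 1 1 η N).powerset with S.card ≤ ⌊4 * Real.log (Real.log N)⌋₊ + 1,
        ∏ p ∈ S, 1 / (p : ℝ) := by
  filter_upwards [eventually_midPrimes_sum (Or.inl rfl) one_pos hη (by linarith),
    tendsto_loglog.eventually_ge_atTop 4] with N h1 h2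
  set v := Real.log (Real.log N) with hv
  set P := midPrimes 1 1 η N with hP
  have hP1 : ∀ p ∈ P, 1 < p := fun p hp => (mem_midPrimes.1 hp).1.2.1.one_lt
  have h3 := abs_le.1 (abs_prod_one_add_sub_le P (fun p => 1 / (p : ℝ)) (⌊4 * v⌋₊ + 1))
  have h4 := exp_sum_sub_one_le_prod hP1
  have h5 := abs_le.1 h1
  have h6 : Real.exp ((1 / 2 - η) * v - 1) ≤ Real.exp (∑ p ∈ P, 1 / (p : ℝ) - 1) :=
    Real.exp_le_exp.2 (by linarith)
  have h7 : ∏ p ∈ P, (1 + 2 * |1 / (p : ℝ)|) ≤ Real.exp (2 * v) := by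
    calc _ ≤ ∏ p ∈ P, Real.exp (2 * (1 / (p : ℝ))) := by
          refine prod_le_prod (fun _ _ => by positivity) fun p _ => ?_
          rw [abs_of_nonneg (by positivity), add_comm]
          exact Real.add_one_le_exp _
      _ = Real.exp (2 * ∑ p ∈ P, 1 / (p : ℝ)) := by rw [← Real.exp_sum, mul_sum]
      _ ≤ _ := Real.exp_le_exp.2 (by nlinarith)
  have h8 : ((1 : ℝ) / 2) ^ (⌊4 * v⌋₊ + 1) * ∏ p ∈ P, (1 + 2 * |1 / (p : ℝ)|) ≤ 1 / 2 := by
    calc _ ≤ 1 / 2 * Real.exp (-(2 * v)) * Real.exp (2 * v) :=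
          mul_le_mul (half_pow_floor_le h2) h7 (prod_nonneg fun _ _ => by positivity)
            (by positivity)
      _ = 1 / 2 := by rw [mul_assoc, ← Real.exp_add]; simp
  have h9 : 1 ≤ Real.exp ((1 / 2 - η) * v - 1) := Real.one_le_exp (by nlinarith)
  linarith [h3.2]

open Classical in
/-- There are at least `N (log N)^{-1/2-ε}` sums of two squares up to `N`. -/
theorem eventually_card_SOS_ge {ε : ℝ} (hε : 0 < ε) : ∀ᶠ N : ℕ in atTop,
    N * Real.exp (-(1 / 2 + ε) * Real.log (Real.log N)) ≤
      (((Ioc 0 N).filter (· ∈ SOS)).card : ℝ) := by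
  obtain ⟨B, hB2, hB⟩ := exists_card_primesMod_ge
  set η := min (ε / 2) (1 / 4) with hηd
  have hη : 0 < η := by positivity
  have hη1 : η ≤ 1 / 4 := min_le_right _ _
  have hηε : η ≤ ε / 2 := min_le_left _ _
  have hB0 : (2 : ℝ) ≤ B := by exact_mod_cast hB2
  filter_upwards [exists_sum_inv_prod_ge hη hη1, tendsto_loglog.eventually_ge_atTop 4,
    tendsto_loglog.eventually (eventually_lin_exp_le 4 2 η (1 / 4) hη (by norm_num)),
    tendsto_loglog.eventually (eventually_const_mul_exp_le (K := 4 * B * Real.exp 1)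
      (c := -(1 / 2 + ε)) (d := -(1 / 2 + η)) (by linarith)),
    Tendsto.eventually_ge_atTop (Real.tendsto_log_atTop.comp tendsto_natCast_atTop_atTop :
      Tendsto (fun N : ℕ => Real.log N) atTop atTop) (4 * Real.log (2 * B))]
    with N hsum hv4 hlin hK hLB
  rw [Function.comp] at hLB
  set v := Real.log (Real.log N) with hv
  set K := ⌊4 * v⌋₊ + 1 with hKd
  set z := highLim η N with hz
  set P := midPrimes 1 1 η N with hP
  have hlog0 : 0 < Real.log (N : ℝ) := by
    have : 0 < Real.log (2 * (B : ℝ)) := Real.log_pos (by linarith)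
    linarith
  have hev : Real.exp v = Real.log N := Real.exp_log hlog0
  have hN1 : (1 : ℝ) < N := by
    by_contra h
    have := Real.log_nonpos (Nat.cast_nonneg N) (not_lt.1 h)
    linarith
  have hNe : (N : ℝ) = Real.exp (Real.exp v) := by rw [hev, Real.exp_log (by linarith)]
  have hw : 0 < Real.exp ((1 - η) * v) := Real.exp_pos _
  have hz1 : (z : ℝ) ≤ Real.exp (Real.exp ((1 - η) * v)) := highLim_le
  have hPz : ∀ p ∈ P, p ≤ z ∧ p.Prime ∧ p % 4 = 1 := fun p hp => (mem_midPrimes.1 hp).1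
  set F := P.powerset.filter (fun S => S.card ≤ K) with hF
  have hm : ∀ S ∈ F, ((∏ x ∈ S, x : ℕ) : ℝ) ≤ Real.exp (Real.exp v / 4) / Real.exp
      (Real.exp ((1 - η) * v)) := by
    intro S hS
    rw [hF, mem_filter, mem_powerset] at hS
    have h1 : ((∏ x ∈ S, x : ℕ) : ℝ) ≤ Real.exp (Real.exp ((1 - η) * v)) ^ S.card := by
      rw [Nat.cast_prod]
      rw [← prod_const]
      refine prod_le_prod (fun _ _ => Nat.cast_nonneg _) fun x hx => le_trans ?_ hz1
      exact_mod_cast (hPz x (hS.1 hx)).1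
    refine h1.trans ?_
    rw [← Real.exp_nat_mul, ← Real.exp_sub]
    apply Real.exp_le_exp.2
    have hK' : (S.card : ℝ) ≤ 4 * v + 1 := by
      have : (S.card : ℝ) ≤ (K : ℝ) := by exact_mod_cast hS.2
      have := Nat.floor_le (by linarith : 0 ≤ 4 * v)
      rw [hKd] at *
      push_cast at *
      linarith
    have := mul_le_mul_of_nonneg_right hK' hw.le
    linarith
  have hm0 : ∀ S ∈ F, 0 < ∏ x ∈ S, x := by
    intro S hS
    rw [hF, mem_filter, mem_powerset] at hS
    exact prod_pos fun x hx => (hPz x (hS.1 hx)).2.1.pos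
  have hbig : ∀ S ∈ F, 2 * B * Real.exp (Real.exp ((1 - η) * v)) * ((∏ x ∈ S, x : ℕ) : ℝ) ≤ N := by
    intro S hS
    have h1 := hm S hS
    rw [le_div_iff₀ (Real.exp_pos _)] at h1
    have h2 : 2 * (B : ℝ) ≤ Real.exp (Real.exp v / 4) := by
      rw [← Real.log_le_iff_le_exp (by linarith), hev]
      linarith
    have h3 : Real.exp (Real.exp v / 4) * Real.exp (Real.exp v / 4) ≤ N := by
      rw [hNe, ← Real.exp_add]
      exact Real.exp_le_exp.2 (by have := Real.exp_pos v; linarith)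
    have h4 := mul_le_mul h2 h1 (by positivity) (Real.exp_pos _).le
    calc _ = 2 * B * (((∏ x ∈ S, x : ℕ) : ℝ) * Real.exp (Real.exp ((1 - η) * v))) := by ring
      _ ≤ _ := h4.trans h3
  set M : Finset ℕ → ℕ := fun S => N / (B * ∏ x ∈ S, x) with hM
  have hMle : ∀ S ∈ F, B * M S * ∏ x ∈ S, x ≤ N := by
    intro S _
    calc B * M S * ∏ x ∈ S, x = (N / (B * ∏ x ∈ S, x)) * (B * ∏ x ∈ S, x) := by ring
      _ ≤ N := Nat.div_mul_le_self _ _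
  have hMge : ∀ S ∈ F, (N : ℝ) / (2 * B * ((∏ x ∈ S, x : ℕ) : ℝ)) ≤ M S ∧ (z : ℝ) ≤ M S ∧
      1 ≤ M S := by
    intro S hS
    have hm1 : (1 : ℝ) ≤ ((∏ x ∈ S, x : ℕ) : ℝ) := by exact_mod_cast hm0 S hS
    have hBm : (0 : ℝ) < B * ((∏ x ∈ S, x : ℕ) : ℝ) := by positivity
    set y := (N : ℝ) / (2 * B * ((∏ x ∈ S, x : ℕ) : ℝ)) with hy
    have h1 : Real.exp (Real.exp ((1 - η) * v)) ≤ y := by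
      rw [hy, le_div_iff₀ (by linarith)]
      calc _ = 2 * B * Real.exp (Real.exp ((1 - η) * v)) * ((∏ x ∈ S, x : ℕ) : ℝ) := by ring
        _ ≤ N := hbig S hS
    have h2 : 2 * y < M S + 1 := by
      have := Nat.lt_div_mul_add (a := N) (b := B * ∏ x ∈ S, x) (Nat.mul_pos (by lia) (hm0 S hS))
      have h3 : (N : ℝ) < (M S + 1) * (B * ((∏ x ∈ S, x : ℕ) : ℝ)) := by
        have := (Nat.cast_lt (α := ℝ)).2 this
        rw [Nat.cast_add, Nat.cast_mul, Nat.cast_mul] at this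
        linarith
      have h4 : 2 * y = N / (B * ((∏ x ∈ S, x : ℕ) : ℝ)) := by
        rw [hy]; field_simp
      rw [h4, div_lt_iff₀ hBm]
      exact h3
    have h5 : 1 ≤ Real.exp (Real.exp ((1 - η) * v)) := Real.one_le_exp hw.le
    refine ⟨by linarith, by linarith, ?_⟩
    have : (1 : ℝ) ≤ M S := by linarith
    exact_mod_cast this
  have hcount := sum_card_le_card_SOS (N := N) hPz F
    (fun S hS => mem_powerset.1 (mem_filter.1 hS).1)
    (fun S => (primesMod 1 (B * M S)).filter (M S < ·)) (by
      intro S hS p hp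
      rw [mem_filter, mem_primesMod] at hp
      have h1 : z ≤ M S := by exact_mod_cast (hMge S hS).2.1
      exact ⟨by lia, hp.1.2.1, hp.1.2.2, (Nat.mul_le_mul_right _ hp.1.1).trans (hMle S hS)⟩)
  have hcount' := (Nat.cast_le (α := ℝ)).2 hcount
  refine le_trans ?_ hcount'
  rw [Nat.cast_sum]
  have hterm : ∀ S ∈ F, N / (2 * B * Real.exp v) * ∏ p ∈ S, 1 / (p : ℝ) ≤
      (((primesMod 1 (B * M S)).filter (M S < ·)).card : ℝ) := by
    intro S hS
    obtain ⟨g1, g2, g3⟩ := hMge S hS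
    refine le_trans ?_ (hB (M S) g3)
    have hm1 : (1 : ℝ) ≤ ((∏ x ∈ S, x : ℕ) : ℝ) := by exact_mod_cast hm0 S hS
    have hg3 : (1 : ℝ) ≤ M S := by exact_mod_cast g3
    have hBM : (B : ℝ) * M S ≤ N := by
      have : B * M S ≤ N := (Nat.le_mul_of_pos_right _ (hm0 S hS)).trans (hMle S hS)
      exact_mod_cast this
    have hl1 : Real.log (B * M S) ≤ Real.exp v := by
      rw [hev]; exact Real.log_le_log (by nlinarith) hBM
    have hl0 : 0 < Real.log (B * M S) := Real.log_pos (by nlinarith)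
    have e : ∏ p ∈ S, 1 / (p : ℝ) = 1 / ((∏ x ∈ S, x : ℕ) : ℝ) := by
      rw [prod_div_distrib, prod_const_one, Nat.cast_prod]
    calc N / (2 * B * Real.exp v) * ∏ p ∈ S, 1 / (p : ℝ)
        = N / (2 * B * ((∏ x ∈ S, x : ℕ) : ℝ)) / Real.exp v := by
          rw [e]; field_simp
      _ ≤ M S / Real.exp v := by gcongr
      _ ≤ _ := by gcongr
  refine le_trans ?_ (sum_le_sum hterm)
  rw [← mul_sum]
  have hN0 : (0 : ℝ) ≤ N := Nat.cast_nonneg N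
  calc N * Real.exp (-(1 / 2 + ε) * v)
      = N / (4 * B * Real.exp 1) * (4 * B * Real.exp 1 * Real.exp (-(1 / 2 + ε) * v)) := by
        field_simp
    _ ≤ N / (4 * B * Real.exp 1) * Real.exp (-(1 / 2 + η) * v) := by gcongr
    _ = N / (2 * B * Real.exp v) * (1 / 2 * Real.exp ((1 / 2 - η) * v - 1)) := by
        have : Real.exp ((1 / 2 - η) * v - 1) =
            Real.exp (-(1 / 2 + η) * v) * Real.exp v / Real.exp 1 := by
          rw [← Real.exp_add, ← Real.exp_sub]; ring_nf
        rw [this]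
        field_simp
        norm_num
    _ ≤ _ := mul_le_mul_of_nonneg_left hsum (by positivity)

end TwoSquares

/-! ### Moments at a given spectral point -/

namespace TwoSquares

open Finset

/-- The value `ζ(5/4)`. -/
def zetaFiveFourths : ℝ := ∑' n : ℕ, (n : ℝ) ^ (-(5 / 4) : ℝ)

lemma summable_five_fourths : Summable fun n : ℕ => (n : ℝ) ^ (-(5 / 4) : ℝ) :=
  Real.summable_nat_rpow.2 (by norm_num)

lemma r2_le_six_rpow {n : ℕ} (hn : 1 ≤ n) : (r2 n : ℝ) ≤ 6 * (n : ℝ) ^ (1 / 2 : ℝ) := by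
  have h1 : (r2 n : ℝ) ≤ 2 * (2 * n.sqrt + 1) := by exact_mod_cast r2_le_sqrt n
  have h2 : (n.sqrt : ℝ) ≤ (n : ℝ) ^ (1 / 2 : ℝ) := by
    rw [← Real.sqrt_eq_rpow]; exact Real.nat_sqrt_le_real_sqrt
  have h3 : (1 : ℝ) ≤ (n : ℝ) ^ (1 / 2 : ℝ) :=
    Real.one_le_rpow (by exact_mod_cast hn) (by norm_num)
  linarith

lemma tail_term_le {s E : ℝ} {N n : ℕ} (hs : 1 ≤ s) (hN : 1 ≤ N) (hE0 : 0 ≤ E) (hE : 4 * E ≤ N)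
    (hn : N ≤ n) : (r2 n : ℝ) * (4 * E / n) ^ (2 * s) ≤
      96 * E ^ 2 * (N : ℝ) ^ (-(1 / 4) : ℝ) * (n : ℝ) ^ (-(5 / 4) : ℝ) := by
  have hN1 : (1 : ℝ) ≤ N := by exact_mod_cast hN
  have hnN : (N : ℝ) ≤ n := by exact_mod_cast hn
  have hn0 : (0 : ℝ) < n := by linarith
  have h1 : (4 * E / n) ^ (2 * s) ≤ (4 * E / n) ^ (2 : ℕ) := by
    rcases hE0.eq_or_lt with rfl | h
    · simp only [mul_zero, zero_div]
      rw [Real.zero_rpow (by linarith)]; norm_num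
    · rw [← Real.rpow_natCast]
      refine Real.rpow_le_rpow_of_exponent_ge (by positivity) ?_ (by push_cast; linarith)
      rw [div_le_one hn0]; linarith
  have h2 := r2_le_six_rpow (hN.trans hn)
  have h3 : (n : ℝ) ^ (-(1 / 4) : ℝ) ≤ (N : ℝ) ^ (-(1 / 4) : ℝ) :=
    Real.rpow_le_rpow_of_nonpos (by linarith) hnN (by norm_num)
  calc (r2 n : ℝ) * (4 * E / n) ^ (2 * s)
      ≤ 6 * (n : ℝ) ^ (1 / 2 : ℝ) * (4 * E / n) ^ (2 : ℕ) :=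
        mul_le_mul h2 h1 (by positivity) (by positivity)
    _ = 96 * E ^ 2 * (n : ℝ) ^ (-(1 / 4) : ℝ) * (n : ℝ) ^ (-(5 / 4) : ℝ) := by
        have e : (n : ℝ) ^ (-(1 / 4) : ℝ) * (n : ℝ) ^ (-(5 / 4) : ℝ) =
            (n : ℝ) ^ (1 / 2 : ℝ) / n ^ 2 := by
          rw [← Real.rpow_add hn0, ← Real.rpow_natCast (n : ℝ) 2, ← Real.rpow_sub hn0]
          norm_num
        rw [mul_assoc _ ((n : ℝ) ^ (-(1 / 4) : ℝ)), e, div_pow]; ring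
    _ ≤ _ := by gcongr

/-- The moment is at least the multiplicity of the nearest element, and is controlled by a local
sum around it. -/
lemma mq_bounds {s lam D E : ℝ} {N nt : ℕ} (hs : 1 ≤ s) (hN : 1 ≤ N) (hnt : nt ≤ N) (hD0 : 0 < D)
    (hD : D = |(nt : ℝ) - lam|) (hmin : ∀ m ∈ SOS, D ≤ |(m : ℝ) - lam|) (hDE : D ≤ E)
    (hE : 4 * E ≤ N) : (r2 nt : ℝ) ≤ mq s lam D ∧
      mq s lam D ≤ r2 nt + 2 +
        ∑ k ∈ (Ioc 0 (2 * N)).filter (· ≠ nt),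
          (r2 k : ℝ) * min 1 ((2 * E / Nat.dist nt k) ^ (2 * s)) +
        96 * E ^ 2 * (N : ℝ) ^ (-(1 / 4) : ℝ) * zetaFiveFourths := by
  set f : ℕ → ℝ := fun n => D ^ (2 * s) * ((r2 n : ℝ) * |(n : ℝ) - lam| ^ (-(2 * s))) with hf
  have hE0 : 0 < E := hD0.trans_le hDE
  have hmq : mq s lam D = ∑' n, f n := by rw [mq, ← tsum_mul_left]
  have hf0 : ∀ n, 0 ≤ f n := fun n => by positivity
  have hfS : ∀ n, n ∉ SOS → f n = 0 := fun n hn => by simp [hf, r2_eq_zero hn]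
  have hfe : ∀ n ∈ SOS, f n = r2 n * (D / |(n : ℝ) - lam|) ^ (2 * s) := by
    intro n hn
    simp only [hf]
    rw [Real.div_rpow hD0.le (abs_nonneg _), Real.rpow_neg (abs_nonneg _)]
    ring
  have hf1 : ∀ n, f n ≤ r2 n := by
    intro n
    by_cases hn : n ∈ SOS
    · rw [hfe n hn]
      refine mul_le_of_le_one_right (Nat.cast_nonneg _) (Real.rpow_le_one (by positivity) ?_
        (by linarith))
      exact div_le_one_of_le₀ (hmin n hn) (abs_nonneg _)
    · rw [hfS n hn]; positivity
  have hf2 : ∀ n, n ≠ nt → f n ≤ r2 n * (2 * E / Nat.dist nt n) ^ (2 * s) := by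
    intro n hne
    by_cases hn : n ∈ SOS
    · rw [hfe n hn]
      have h1 := hmin n hn
      have h2 : (Nat.dist nt n : ℝ) ≤ 2 * |(n : ℝ) - lam| := by
        rw [cast_dist]
        calc |(n : ℝ) - nt| = |((n : ℝ) - lam) - (nt - lam)| := by ring_nf
          _ ≤ |(n : ℝ) - lam| + |(nt : ℝ) - lam| := abs_sub _ _
          _ ≤ _ := by rw [← hD]; linarith
      have h3 : (0 : ℝ) < Nat.dist nt n := by
        exact_mod_cast Nat.dist_pos_of_ne hne.symm
      have h4 : D / |(n : ℝ) - lam| ≤ 2 * E / Nat.dist nt n := by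
        rw [div_le_div_iff₀ (by linarith) h3]
        nlinarith [abs_nonneg ((n : ℝ) - lam)]
      have := Real.rpow_le_rpow (z := 2 * s) (by positivity) h4 (by linarith)
      exact mul_le_mul_of_nonneg_left this (Nat.cast_nonneg _)
    · rw [hfS n hn]; positivity
  set A := 96 * E ^ 2 * (N : ℝ) ^ (-(1 / 4) : ℝ) with hA
  have hA0 : 0 ≤ A := by positivity
  set T := (Ioc 0 (2 * N)).filter (· ≠ nt) with hT
  set h : ℕ → ℝ := fun k => (r2 k : ℝ) * min 1 ((2 * E / Nat.dist nt k) ^ (2 * s)) with hh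
  have hh0 : ∀ k, 0 ≤ h k := fun k => by positivity
  have hfg : ∀ n, f n ≤ (if n = nt then (r2 nt : ℝ) else 0) + (if n = 0 then 2 else 0) +
      (if n ∈ T then h n else 0) + A * (n : ℝ) ^ (-(5 / 4) : ℝ) := by
    intro n
    have p1 : 0 ≤ A * (n : ℝ) ^ (-(5 / 4) : ℝ) := by positivity
    have p2 : (0 : ℝ) ≤ if n = nt then (r2 nt : ℝ) else 0 := by split_ifs <;> positivity
    have p3 : (0 : ℝ) ≤ if n = 0 then 2 else 0 := by split_ifs <;> norm_num
    have p4 : (0 : ℝ) ≤ if n ∈ T then h n else 0 := by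
      split_ifs
      · exact hh0 n
      · exact le_rfl
    have q1 := hf1 n
    by_cases c1 : n = nt
    · rw [if_pos c1]
      rw [← c1]; linarith
    by_cases c2 : n = 0
    · rw [if_pos c2]
      have : (r2 0 : ℝ) ≤ 2 := by exact_mod_cast r2_le_sqrt 0
      rw [c2] at q1 p1 p2 p4 ⊢
      linarith
    by_cases c3 : n ≤ 2 * N
    · have c4 : n ∈ T := mem_filter.2 ⟨mem_Ioc.2 ⟨by lia, c3⟩, c1⟩
      rw [if_pos c4]
      have : f n ≤ h n := by
        rw [hh]; simp only
        rw [mul_min_of_nonneg _ _ (Nat.cast_nonneg _), mul_one]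
        exact le_min q1 (hf2 n c1)
      linarith
    · have q2 : f n ≤ r2 n * (4 * E / n) ^ (2 * s) := by
        refine (hf2 n c1).trans (mul_le_mul_of_nonneg_left ?_ (Nat.cast_nonneg _))
        have hd : (n : ℝ) ≤ 2 * Nat.dist nt n := by
          have : n ≤ 2 * Nat.dist nt n := by rw [Nat.dist]; lia
          exact_mod_cast this
        have hn0 : (0 : ℝ) < n := by exact_mod_cast Nat.pos_of_ne_zero c2
        refine Real.rpow_le_rpow (by positivity) ?_ (by linarith)
        rw [div_le_div_iff₀ (by linarith) hn0]
        nlinarith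
      have q3 := q2.trans (tail_term_le (n := n) hs hN hE0.le hE (by lia))
      linarith
  have s1 : HasSum (fun n => if n = nt then (r2 nt : ℝ) else 0) (r2 nt) := hasSum_ite_eq nt _
  have s2 : HasSum (fun n : ℕ => if n = 0 then (2 : ℝ) else 0) 2 := hasSum_ite_eq 0 _
  have s3 : HasSum (fun n => if n ∈ T then h n else 0) (∑ k ∈ T, h k) := by
    have : ∑ k ∈ T, h k = ∑ k ∈ T, if k ∈ T then h k else 0 :=
      sum_congr rfl fun k hk => by rw [if_pos hk]
    rw [this]
    exact hasSum_sum_of_ne_finset_zero fun k hk => by rw [if_neg hk]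
  have s4 := summable_five_fourths.hasSum.mul_left A
  have s5 := ((s1.add s2).add s3).add s4
  have hsf : Summable f := Summable.of_nonneg_of_le hf0 hfg s5.summable
  refine ⟨?_, ?_⟩
  · rw [hmq]
    by_cases hn : nt ∈ SOS
    · have e : f nt = r2 nt := by
        rw [hfe nt hn, ← hD, div_self hD0.ne', Real.one_rpow, mul_one]
      rw [← e]
      exact hsf.le_tsum nt fun k _ => hf0 k
    · rw [r2_eq_zero hn]; simpa using tsum_nonneg hf0
  · rw [hmq]
    have := hsf.tsum_le_tsum hfg s5.summable
    rwa [s5.tsum_eq] at this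

end TwoSquares

/-! ### Interlacing sequences -/

namespace TwoSquares

open Finset

/-- The sequence `lam` interlaces with the sums of two squares `nseq`, with nearest
elements `ntil` and distances `D`. -/
structure Interlaced (nseq : ℕ → ℕ) (lam : ℕ → ℝ) (ntil : ℕ → ℕ) (D : ℕ → ℝ) : Prop where
  mono : StrictMono nseq
  range_eq : Set.range nseq = SOS
  inter : ∀ j, 1 ≤ j → (nseq (j - 1) : ℝ) < lam j ∧ lam j < (nseq j : ℝ)
  dist_eq : ∀ j, D j = |(ntil j : ℝ) - lam j|
  ntil_mem : ∀ j, ntil j ∈ SOS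
  near : ∀ j, ∀ m ∈ SOS, |(ntil j : ℝ) - lam j| ≤ |(m : ℝ) - lam j|

namespace Interlaced

variable {nseq : ℕ → ℕ} {lam : ℕ → ℝ} {ntil : ℕ → ℕ} {D : ℕ → ℝ}

lemma nseq_mem (h : Interlaced nseq lam ntil D) (j : ℕ) : nseq j ∈ SOS :=
  h.range_eq ▸ Set.mem_range_self j

lemma D_le (h : Interlaced nseq lam ntil D) {j m : ℕ} (hm : m ∈ SOS) : D j ≤ |(m : ℝ) - lam j| :=
  h.dist_eq j ▸ h.near j m hm

lemma D_nonneg (h : Interlaced nseq lam ntil D) (j : ℕ) : 0 ≤ D j :=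
  h.dist_eq j ▸ abs_nonneg _

lemma ntil_eq (h : Interlaced nseq lam ntil D) {j : ℕ} (hj : 1 ≤ j) :
    ntil j = nseq (j - 1) ∨ ntil j = nseq j := by
  obtain ⟨i, hi⟩ : ntil j ∈ Set.range nseq := h.range_eq ▸ h.ntil_mem j
  obtain ⟨h1, h2⟩ := h.inter j hj
  have n1 := h.near j _ (h.nseq_mem (j - 1))
  have n2 := h.near j _ (h.nseq_mem j)
  rw [← hi] at n1 n2 ⊢
  rcases lt_trichotomy i (j - 1) with hij | hij | hij
  · have h3 : (nseq i : ℝ) < nseq (j - 1) := by exact_mod_cast h.mono hij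
    rw [abs_of_neg (by linarith), abs_of_neg (by linarith)] at n1
    linarith
  · left; rw [hij]
  · rcases Nat.lt_or_ge j i with hij' | hij'
    · have h3 : (nseq j : ℝ) < nseq i := by exact_mod_cast h.mono hij'
      rw [abs_of_pos (by linarith), abs_of_pos (by linarith)] at n2
      linarith
    · right; rw [show i = j by lia]

lemma D_pos (h : Interlaced nseq lam ntil D) {j : ℕ} (hj : 1 ≤ j) : 0 < D j := by
  rw [h.dist_eq, abs_pos]
  obtain ⟨h1, h2⟩ := h.inter j hj
  rcases h.ntil_eq hj with e | e <;> rw [e]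
  · exact (sub_neg.2 h1).ne
  · exact (sub_pos.2 h2).ne'

lemma ntil_le (h : Interlaced nseq lam ntil D) {j k : ℕ} (hj : 1 ≤ j) (hjk : j ≤ k) :
    ntil j ≤ nseq k := by
  rcases h.ntil_eq hj with e | e <;> rw [e]
  · exact h.mono.monotone (by lia)
  · exact h.mono.monotone hjk

lemma nseq_zero (h : Interlaced nseq lam ntil D) : nseq 0 = 0 := by
  obtain ⟨i, hi⟩ : 0 ∈ Set.range nseq := h.range_eq ▸ zero_mem_SOS
  have := h.mono.monotone (Nat.zero_le i)
  lia

lemma lam_le_iff (h : Interlaced nseq lam ntil D) {j : ℕ} (hj : 1 ≤ j) (k : ℕ) :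
    lam j ≤ nseq k ↔ j ≤ k := by
  obtain ⟨h1, h2⟩ := h.inter j hj
  constructor
  · intro hle
    by_contra hcon
    have : (nseq k : ℝ) ≤ nseq (j - 1) := by exact_mod_cast h.mono.monotone (by lia : k ≤ j - 1)
    linarith
  · intro hle
    have : (nseq j : ℝ) ≤ nseq k := by exact_mod_cast h.mono.monotone hle
    linarith

lemma sum_D_eq (h : Interlaced nseq lam ntil D) {k : ℕ} (hk : 1 ≤ k) :
    ∑ j ∈ Icc 1 k, D j = avgD lam D (nseq k) * k := by
  have e : (fun j : ℕ => 1 ≤ j ∧ lam j ≤ nseq k) = fun j => j ∈ Icc 1 k := by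
    funext j
    rw [mem_Icc, eq_iff_iff]
    exact and_congr_right fun hj => h.lam_le_iff hj k
  rw [avgD, e, Finset.tsum_subtype, Nat.card_eq_fintype_card, Fintype.card_coe, Nat.card_Icc,
    Nat.add_sub_cancel, div_mul_cancel₀]
  exact_mod_cast (by lia : k ≠ 0)

open Classical in
lemma card_SOS_le (h : Interlaced nseq lam ntil D) (k : ℕ) :
    ((Ioc 0 (nseq k)).filter (· ∈ SOS)).card ≤ k := by
  have hsub : (Ioc 0 (nseq k)).filter (· ∈ SOS) ⊆ (Icc 1 k).image nseq := by
    intro n hn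
    rw [mem_filter, mem_Ioc] at hn
    obtain ⟨i, rfl⟩ : n ∈ Set.range nseq := h.range_eq ▸ hn.2
    refine mem_image_of_mem _ (mem_Icc.2 ⟨?_, h.mono.le_iff_le.1 hn.1.2⟩)
    by_contra hi
    rw [show i = 0 by lia, h.nseq_zero] at hn
    lia
  simpa using (card_le_card hsub).trans card_image_le

open Classical in
/-- Each sum of two squares is the nearest one to at most two terms of the sequence. -/
lemma card_ntil_le (h : Interlaced nseq lam ntil D) (k : ℕ) (p : ℕ → Prop) :
    ((Icc 1 k).filter fun j => 0 < ntil j ∧ p (ntil j)).card ≤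
      2 * ((Ioc 0 (nseq k)).filter fun n => n ∈ SOS ∧ p n).card := by
  set T := (Ioc 0 (nseq k)).filter fun n => n ∈ SOS ∧ p n with hT
  have hsub : ((Icc 1 k).filter fun j => 0 < ntil j ∧ p (ntil j)) ⊆
      ((Icc 1 k).filter fun j => nseq j ∈ T) ∪ ((Icc 1 k).filter fun j => nseq (j - 1) ∈ T) := by
    intro j hj
    rw [mem_filter, mem_Icc] at hj
    have hm : ntil j ∈ T := mem_filter.2 ⟨mem_Ioc.2 ⟨hj.2.1, h.ntil_le hj.1.1 hj.1.2⟩,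
      h.ntil_mem j, hj.2.2⟩
    rcases h.ntil_eq hj.1.1 with e | e <;> rw [e] at hm
    · exact mem_union_right _ (mem_filter.2 ⟨mem_Icc.2 hj.1, hm⟩)
    · exact mem_union_left _ (mem_filter.2 ⟨mem_Icc.2 hj.1, hm⟩)
  have c1 : ((Icc 1 k).filter fun j => nseq j ∈ T).card ≤ T.card :=
    card_le_card_of_injOn nseq (fun j hj => (mem_filter.1 (mem_coe.1 hj)).2)
      (h.mono.injective.injOn)
  have c2 : ((Icc 1 k).filter fun j => nseq (j - 1) ∈ T).card ≤ T.card := by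
    refine card_le_card_of_injOn (fun j => nseq (j - 1))
      (fun j hj => (mem_filter.1 (mem_coe.1 hj)).2) fun i hi j hj hij => ?_
    have := h.mono.injective hij
    have h1 := (mem_Icc.1 (mem_filter.1 (mem_coe.1 hi)).1).1
    have h2 := (mem_Icc.1 (mem_filter.1 (mem_coe.1 hj)).1).1
    lia
  have := (card_le_card hsub).trans (card_union_le _ _)
  lia

lemma card_lam_lt_le (h : Interlaced nseq lam ntil D) (k : ℕ) {y : ℝ} (hy : 1 ≤ y) :
    (((Icc 1 k).filter fun j => lam j < y).card : ℝ) ≤ 2 * y := by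
  have hsub : ((Icc 1 k).filter fun j => lam j < y) ⊆ Icc 1 (⌊y⌋₊ + 1) := by
    intro j hj
    rw [mem_filter, mem_Icc] at hj
    have h1 := (h.inter j hj.1.1).1
    have h2 : j - 1 ≤ ⌊y⌋₊ := by
      apply Nat.le_floor
      have h3 : ((j - 1 : ℕ) : ℝ) ≤ nseq (j - 1) := by exact_mod_cast h.mono.le_apply
      linarith [hj.2]
    exact mem_Icc.2 ⟨hj.1.1, by lia⟩
  have h1 := card_le_card hsub
  rw [Nat.card_Icc, Nat.add_sub_cancel] at h1
  have h2 : (((Icc 1 k).filter fun j => lam j < y).card : ℝ) ≤ (⌊y⌋₊ + 1 : ℕ) := by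
    exact_mod_cast h1
  have h3 := Nat.floor_le (by linarith : 0 ≤ y)
  push_cast at h2
  linarith

lemma tendsto_lam (h : Interlaced nseq lam ntil D) : Tendsto lam atTop atTop := by
  refine tendsto_atTop_mono' atTop (f₁ := fun j : ℕ => (j : ℝ) - 1) ?_
    (tendsto_natCast_atTop_atTop.atTop_add tendsto_const_nhds)
  filter_upwards [eventually_ge_atTop 1] with j hj
  have h1 := (h.inter j hj).1
  have h3 : ((j - 1 : ℕ) : ℝ) ≤ nseq (j - 1) := by exact_mod_cast h.mono.le_apply
  rw [Nat.cast_sub hj, Nat.cast_one] at h3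
  linarith

end Interlaced

lemma eventually_mul_exp_log_log_le_rpow {C : ℝ} (hC : 0 < C) (a : ℝ) : ∀ᶠ x : ℝ in atTop,
    C * Real.exp (a * Real.log (Real.log x)) ≤ x ^ (1 / 4 : ℝ) := by
  have h := (isLittleO_log_rpow_rpow_atTop a (by norm_num : (0 : ℝ) < 1 / 4)).def
    (inv_pos.2 hC)
  filter_upwards [h, Real.tendsto_log_atTop.eventually_gt_atTop 0, eventually_gt_atTop 0]
    with x hx hl hx0
  rw [Real.norm_of_nonneg (by positivity), Real.norm_of_nonneg (by positivity),
    Real.rpow_def_of_pos hl, mul_comm (Real.log _), inv_mul_eq_div, le_div_iff₀ hC] at hx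
  linarith

lemma eventually_const_mul_exp_le_rpow {C : ℝ} (hC : 0 < C) (a : ℝ) : ∀ᶠ N : ℕ in atTop,
    C * Real.exp (a * Real.log (Real.log N)) ≤ (N : ℝ) ^ (1 / 4 : ℝ) :=
  tendsto_natCast_atTop_atTop.eventually (eventually_mul_exp_log_log_le_rpow hC a)

end TwoSquares

/-! ### The size of the moments for almost all indices -/

namespace TwoSquares

open Finset

/-- The exponent governing the moment `m_s` when the mean spacing has exponent `α`. -/
def momentExp (α s : ℝ) : ℝ := max (Real.log 2 / 2) (2 * s * α - s + 1 / 2)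

/-- The moment of a point `lam` at distance `D` has the expected logarithmic size, up to `ε`. -/
def GoodMoment (α s ε lam D : ℝ) : Prop :=
  (Real.log 2 / 2 - ε) * Real.log (Real.log lam) ≤ Real.log (mq s lam D) ∧
  Real.log (mq s lam D) ≤ (momentExp α s + ε) * Real.log (Real.log lam)

lemma log_log_sqrt_bounds {N : ℕ} {lam : ℝ} (hN : 1 < Real.log (N : ℝ))
    (h1 : (N : ℝ) ^ (1 / 2 : ℝ) ≤ lam) (h2 : lam ≤ N) :
    Real.log (Real.log N) - Real.log 2 ≤ Real.log (Real.log lam) ∧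
      Real.log (Real.log lam) ≤ Real.log (Real.log N) := by
  have hN0 : (0 : ℝ) < N := by
    rcases (Nat.cast_nonneg (α := ℝ) N).eq_or_lt with h | h
    · rw [← h, Real.log_zero] at hN; linarith
    · exact h
  have hp := Real.rpow_pos_of_pos hN0 (1 / 2 : ℝ)
  have h3 : Real.log N / 2 ≤ Real.log lam := by
    have := Real.log_le_log hp h1
    rw [Real.log_rpow hN0] at this
    linarith
  have h4 : Real.log lam ≤ Real.log N := Real.log_le_log (by linarith) h2
  refine ⟨?_, Real.log_le_log (by linarith) h4⟩
  rw [← Real.log_div (by linarith) (by norm_num)]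
  exact Real.log_le_log (by linarith) h3

lemma log_two_half_bounds : 0.34 < Real.log 2 / 2 ∧ Real.log 2 / 2 < 0.35 := by
  have := Real.log_two_gt_d9
  have := Real.log_two_lt_d9
  constructor <;> linarith

lemma eventually_goodMoment_of_typical {α s κ ε : ℝ} (hs : 1 ≤ s) (hκ : 0 < κ)
    (hκ1 : κ ≤ 1 / 4) (hε : (4 * s + 2) * κ ≤ ε) :
    ∀ᶠ N : ℕ in atTop, ∀ (lam D : ℝ) (nt : ℕ), (N : ℝ) ^ (1 / 2 : ℝ) ≤ lam → lam ≤ N → nt ≤ N →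
      0 < D → D = |(nt : ℝ) - lam| → (∀ m ∈ SOS, D ≤ |(m : ℝ) - lam|) →
      D ≤ Real.exp ((α + 2 * κ) * Real.log (Real.log N)) → Typical s (α + 2 * κ) κ N nt →
      GoodMoment α s ε lam D := by
  have hθ : Real.log 2 / 2 ≤ momentExp α s := le_max_left _ _
  have hθ' : 2 * s * α - s + 1 / 2 ≤ momentExp α s := le_max_right _ _
  set θ := momentExp α s with hθd
  have hl := log_two_half_bounds
  have hZ : 0 ≤ zetaFiveFourths := tsum_nonneg fun n => by positivity
  have hκε : κ ≤ ε := by nlinarith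
  filter_upwards [eventually_const_mul_exp_le_rpow (C := 4) (by norm_num) (α + 2 * κ),
    eventually_const_mul_exp_le_rpow (C := 96 * (zetaFiveFourths + 1)) (by positivity)
      (2 * (α + 2 * κ)), eventually_ge_atTop 1,
    (Real.tendsto_log_atTop.comp tendsto_natCast_atTop_atTop).eventually_gt_atTop (1 : ℝ),
    tendsto_loglog.eventually_ge_atTop (Real.log 2 + (Real.log 7 + (θ + (4 * s + 1) * κ) *
      Real.log 2) / κ)]
    with N hN1 hN2 hN hlog hv lam D nt hl1 hl2 hnt hD0 hD hmin hDE hT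
  rw [Function.comp] at hlog
  set v := Real.log (Real.log N) with hvd
  set E := Real.exp ((α + 2 * κ) * v) with hE
  obtain ⟨w1, w2⟩ := log_log_sqrt_bounds hlog hl1 hl2
  set w := Real.log (Real.log lam) with hw
  have hNR : (1 : ℝ) ≤ N := by exact_mod_cast hN
  have hl7 : 0 ≤ Real.log 7 := Real.log_nonneg (by norm_num)
  have hθκ : 0 ≤ (θ + (4 * s + 1) * κ) := by nlinarith
  have hκw : Real.log 7 + (θ + (4 * s + 1) * κ) * Real.log 2 ≤ κ * w := by
    have : (Real.log 7 + (θ + (4 * s + 1) * κ) * Real.log 2) / κ ≤ w := by linarith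
    rw [div_le_iff₀ hκ] at this
    linarith
  have hw0 : 0 ≤ w := by
    have : 0 ≤ κ * w := le_trans (by
      have := mul_nonneg hθκ (by linarith : 0 ≤ Real.log 2)
      linarith) hκw
    exact nonneg_of_mul_nonneg_right this hκ
  have hv0 : 0 ≤ v := by linarith
  have h4E : 4 * E ≤ N := by
    refine hN1.trans ?_
    calc (N : ℝ) ^ (1 / 4 : ℝ) ≤ (N : ℝ) ^ (1 : ℝ) :=
          Real.rpow_le_rpow_of_exponent_le hNR (by norm_num)
      _ = N := Real.rpow_one _
  obtain ⟨b1, b2⟩ := mq_bounds hs hN hnt hD0 hD hmin hDE h4E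
  obtain ⟨t1, t2, t3⟩ := hT
  rw [← hvd] at t1 t2 t3
  rw [← hE] at t3
  have hmpos : 0 < mq s lam D := (Real.exp_pos _).trans_le (t1.trans b1)
  have htail : 96 * E ^ 2 * (N : ℝ) ^ (-(1 / 4) : ℝ) * zetaFiveFourths ≤ 1 := by
    have hE2 : E ^ 2 = Real.exp (2 * (α + 2 * κ) * v) := by
      rw [hE, ← Real.exp_nat_mul]; push_cast; ring_nf
    have hp : 0 < (N : ℝ) ^ (1 / 4 : ℝ) := Real.rpow_pos_of_pos (by linarith) _
    rw [Real.rpow_neg (by linarith), hE2]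
    calc _ = 96 * zetaFiveFourths * Real.exp (2 * (α + 2 * κ) * v) / (N : ℝ) ^ (1 / 4 : ℝ) := by
          ring
      _ ≤ 1 := by
          rw [div_le_one hp]
          refine le_trans ?_ hN2
          gcongr
          linarith
  refine ⟨?_, ?_⟩
  · rw [← hw]
    refine le_trans ?_ ((Real.le_log_iff_exp_le hmpos).2 (t1.trans b1))
    nlinarith
  · rw [← hw]
    set Y := (θ + (4 * s + 1) * κ) * v with hY
    have hY0 : 0 ≤ Y := mul_nonneg hθκ hv0
    have e1 : Real.exp ((Real.log 2 / 2 + κ) * v) ≤ Real.exp Y :=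
      Real.exp_le_exp.2 (mul_le_mul_of_nonneg_right (by nlinarith) hv0)
    have e2 : Real.exp ((2 * s * (α + 2 * κ) - s + 1 / 2 + κ) * v) ≤ Real.exp Y :=
      Real.exp_le_exp.2 (mul_le_mul_of_nonneg_right (by linarith) hv0)
    have e3 : 1 ≤ Real.exp Y := Real.one_le_exp hY0
    have hup : mq s lam D ≤ 7 * Real.exp Y := by linarith
    calc Real.log (mq s lam D) ≤ Real.log (7 * Real.exp Y) := Real.log_le_log hmpos hup
      _ = Real.log 7 + Y := by
          rw [Real.log_mul (by norm_num) (Real.exp_pos _).ne', Real.log_exp]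
      _ ≤ Real.log 7 + (θ + (4 * s + 1) * κ) * (w + Real.log 2) := by
          have := mul_le_mul_of_nonneg_left (by linarith : v ≤ w + Real.log 2) hθκ
          linarith
      _ ≤ (θ + (4 * s + 2) * κ) * w := by linarith
      _ ≤ (θ + ε) * w := mul_le_mul_of_nonneg_right (by linarith) hw0

open Classical in
/-- Almost all indices have a moment of the expected logarithmic size. -/
theorem eventually_card_not_goodMoment_le {nseq : ℕ → ℕ} {lam : ℕ → ℝ} {ntil : ℕ → ℕ}
    {D : ℕ → ℝ} (h : Interlaced nseq lam ntil D) {α : ℝ} (hα : 0 ≤ α)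
    (havg : Tendsto (fun x : ℝ => Real.log (avgD lam D x) / Real.log (Real.log x)) atTop (𝓝 α))
    {s ε δ : ℝ} (hs : 1 ≤ s) (hε : 0 < ε) (hδ : 0 < δ) : ∀ᶠ k : ℕ in atTop,
    (((Icc 1 k).filter fun j => ¬ GoodMoment α s ε (lam j) (D j)).card : ℝ) ≤ δ * k := by
  set κ := min (ε / (4 * s + 2)) (1 / 4) with hκd
  have hκ : 0 < κ := by positivity
  have hκ1 : κ ≤ 1 / 4 := min_le_right _ _
  have hκε : (4 * s + 2) * κ ≤ ε := by
    have : κ ≤ ε / (4 * s + 2) := min_le_left _ _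
    rw [le_div_iff₀ (by linarith)] at this
    linarith
  have hκ2 : κ ^ 2 ≤ κ := by nlinarith
  have hnseq : Tendsto nseq atTop atTop := h.mono.tendsto_atTop
  have hx : Tendsto (fun k => (nseq k : ℝ)) atTop atTop := tendsto_natCast_atTop_atTop.comp hnseq
  filter_upwards [hnseq.eventually (eventually_goodMoment_of_typical (α := α) hs hκ hκ1 hκε),
    hnseq.eventually (eventually_card_SOS_ge (ε := κ ^ 2 / 8) (by positivity)),
    hnseq.eventually (eventually_card_not_typical_le (s := s) (β := α + 2 * κ) (κ := κ) hs
      (by linarith) hκ (by linarith)),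
    hnseq.eventually (eventually_const_mul_exp_le_rpow (C := 6 / δ) (by positivity) 1),
    (tendsto_loglog.comp hnseq).eventually (eventually_const_mul_exp_le (K := 6 / δ)
      (c := -(1 / 2 + κ ^ 2 / 4)) (d := -(1 / 2 + κ ^ 2 / 8)) (by nlinarith)),
    (tendsto_loglog.comp hnseq).eventually (eventually_const_mul_exp_le (K := 3 / δ)
      (c := α + κ) (d := α + 2 * κ) (by linarith)),
    (tendsto_loglog.comp hnseq).eventually_gt_atTop 0,
    hx.eventually (havg.eventually (eventually_le_nhds (by linarith : α < α + κ))),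
    hnseq.eventually_ge_atTop 2, eventually_ge_atTop 1]
    with k hgood hSOS hatyp hroot hv1 hv2 hv0 hav hN2 hk1
  simp only [Function.comp] at hv1 hv2 hv0
  set N := nseq k with hN
  set v := Real.log (Real.log N) with hv
  have hNR : (2 : ℝ) ≤ N := by exact_mod_cast hN2
  have hk0 : (1 : ℝ) ≤ k := by exact_mod_cast hk1
  have hkN : N * Real.exp (-(1 / 2 + κ ^ 2 / 8) * v) ≤ k := by
    refine hSOS.trans ?_
    exact_mod_cast h.card_SOS_le k
  set y := (N : ℝ) ^ (1 / 2 : ℝ) with hy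
  have hy1 : 1 ≤ y := Real.one_le_rpow (by linarith) (by norm_num)
  have hyy : y * y = N := by
    rw [hy, ← Real.rpow_add (by linarith)]; norm_num
  obtain ⟨p, hp⟩ : ∃ p : ℕ → Prop, p = fun n => ¬ Typical s (α + 2 * κ) κ N n := ⟨_, rfl⟩
  have hsub : ((Icc 1 k).filter fun j => ¬ GoodMoment α s ε (lam j) (D j)) ⊆
      ((Icc 1 k).filter fun j => lam j < y) ∪
      (((Icc 1 k).filter fun j => Real.exp ((α + 2 * κ) * v) < D j) ∪
      ((Icc 1 k).filter fun j => 0 < ntil j ∧ p (ntil j))) := by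
    intro j hj
    rw [mem_filter] at hj
    obtain ⟨hjk, hng⟩ := hj
    have hjk' := mem_Icc.1 hjk
    by_contra hcon
    simp only [mem_union, mem_filter, hjk, true_and, not_or, not_and, not_lt, hp, not_not] at hcon
    obtain ⟨c1, c2, c3⟩ := hcon
    refine hng (hgood _ _ (ntil j) c1 ((h.lam_le_iff hjk'.1 k).2 hjk'.2)
      (h.ntil_le hjk'.1 hjk'.2) (h.D_pos hjk'.1) (h.dist_eq j) (fun m hm => h.D_le hm) c2 (c3 ?_))
    by_contra hz
    have hz' : ntil j = 0 := by lia
    have h1 := h.near j 1 one_mem_SOS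
    have hlam : 1 ≤ lam j := hy1.trans c1
    rw [hz', Nat.cast_zero, zero_sub, abs_neg, abs_of_pos (by linarith), Nat.cast_one,
      abs_sub_comm, abs_of_nonneg (by linarith)] at h1
    linarith
  have hcard := (Nat.cast_le (α := ℝ)).2 ((card_le_card hsub).trans ((card_union_le _ _).trans
    (Nat.add_le_add_left (card_union_le _ _) _)))
  push_cast at hcard
  have p1 : (((Icc 1 k).filter fun j => lam j < y).card : ℝ) ≤ δ / 3 * k := by
    refine (h.card_lam_lt_le k hy1).trans ?_
    have hr : 6 / δ * Real.exp v ≤ y := by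
      rw [one_mul] at hroot
      exact hroot.trans (Real.rpow_le_rpow_of_exponent_le (by linarith) (by norm_num))
    have h1 : N * Real.exp (-v) ≤ k := by
      refine le_trans ?_ hkN
      refine mul_le_mul_of_nonneg_left (Real.exp_le_exp.2 ?_) (by linarith)
      nlinarith
    have h2 : y * (6 / δ) ≤ N * Real.exp (-v) := by
      rw [← hyy, Real.exp_neg, ← div_eq_mul_inv, le_div_iff₀ (Real.exp_pos _)]
      have := mul_le_mul_of_nonneg_left hr (by linarith : 0 ≤ y)
      linarith
    have h3 := h2.trans h1
    rw [mul_div_assoc', div_le_iff₀ hδ] at h3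
    linarith
  have p2 : (((Icc 1 k).filter fun j => Real.exp ((α + 2 * κ) * v) < D j).card : ℝ) ≤
      δ / 3 * k := by
    have h1 := card_filter_gt_le (Icc 1 k) (fun j => Real.exp ((α + 2 * κ) * v) < D j) (f := D)
      (fun j _ => h.D_nonneg j) (T := Real.exp ((α + 2 * κ) * v)) (fun j _ hj => hj.le)
    rw [h.sum_D_eq hk1] at h1
    have h2 : avgD lam D N ≤ Real.exp ((α + κ) * v) := by
      rw [div_le_iff₀ hv0] at hav
      exact (Real.le_exp_log _).trans (Real.exp_le_exp.2 hav)
    have h3 : 3 / δ * avgD lam D N ≤ Real.exp ((α + 2 * κ) * v) :=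
      (mul_le_mul_of_nonneg_left h2 (by positivity)).trans hv2
    rw [div_mul_eq_mul_div, div_le_iff₀ hδ] at h3
    have h4 : avgD lam D N * k ≤ δ / 3 * k * Real.exp ((α + 2 * κ) * v) := by
      have := mul_le_mul_of_nonneg_right h3 (by linarith : (0 : ℝ) ≤ k)
      linarith
    exact le_of_mul_le_mul_right (h1.trans h4) (Real.exp_pos _)
  have p3 : (((Icc 1 k).filter fun j => 0 < ntil j ∧ p (ntil j)).card : ℝ) ≤ δ / 3 * k := by
    have h1 := (Nat.cast_le (α := ℝ)).2 (h.card_ntil_le k p)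
    push_cast at h1
    have h0 : (((Ioc 0 (nseq k)).filter fun n => n ∈ SOS ∧ p n).card : ℝ) ≤
        N * Real.exp (-(1 / 2 + κ ^ 2 / 4) * v) := by
      refine le_of_eq_of_le (congrArg _ ?_) hatyp
      rw [hp]
      congr
    have h2 := mul_le_mul_of_nonneg_left hv1 (by linarith : (0 : ℝ) ≤ N)
    have h3 : N * Real.exp (-(1 / 2 + κ ^ 2 / 4) * v) * (6 / δ) ≤ k := by linarith
    rw [mul_div_assoc', div_le_iff₀ hδ] at h3
    linarith
  linarith

end TwoSquares

/-! ### A full density set of indices -/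

namespace TwoSquares

open Finset

open Classical in
lemma fullDensityIdx_of_card_compl_le {J : Set ℕ}
    (h : ∀ ε : ℝ, 0 < ε → ∀ᶠ k : ℕ in atTop, (((Icc 1 k).filter (· ∉ J)).card : ℝ) ≤ ε * k) :
    FullDensityIdx J := by
  rw [FullDensityIdx, Metric.tendsto_nhds]
  intro ε hε
  filter_upwards [h (ε / 2) (by positivity), eventually_ge_atTop 1] with k hk hk1
  have hk0 : (0 : ℝ) < k := by exact_mod_cast hk1
  have e1 : Nat.card ↥(J ∩ Set.Icc 1 k) = ((Icc 1 k).filter (· ∈ J)).card := by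
    have : J ∩ Set.Icc 1 k = ((Icc 1 k).filter (· ∈ J) : Finset ℕ) := by
      ext j
      simp only [Set.mem_inter_iff, Set.mem_Icc, coe_filter, mem_Icc, Set.mem_ofPred_eq]
      tauto
    rw [this, Nat.card_coe_set_eq, Set.ncard_coe_finset]
  have e2 := card_filter_add_card_filter_not (s := Icc 1 k) (· ∈ J)
  rw [Nat.card_Icc, Nat.add_sub_cancel] at e2
  have e3 : (((Icc 1 k).filter (· ∈ J)).card : ℝ) + ((Icc 1 k).filter (· ∉ J)).card = k := by
    exact_mod_cast e2
  have e4 : (((Icc 1 k).filter (· ∈ J)).card : ℝ) / k - 1 =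
      -(((Icc 1 k).filter (· ∉ J)).card / k) := by
    field_simp
    linarith
  rw [e1, Real.dist_eq, e4, abs_neg, abs_of_nonneg (by positivity), div_lt_iff₀ hk0]
  nlinarith

open Classical in
/-- Countably many density one properties hold eventually along a common full density set. -/
theorem exists_fullDensityIdx (P : ℕ → ℕ → Prop)
    (h : ∀ i, ∀ δ : ℝ, 0 < δ → ∀ᶠ k : ℕ in atTop,
      (((Icc 1 k).filter fun j => ¬ P i j).card : ℝ) ≤ δ * k) :
    ∃ J : Set ℕ, FullDensityIdx J ∧ ∀ i, ∀ᶠ j in atTop ⊓ 𝓟 J, P i j := by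
  have h1 : ∀ i, ∃ K, i ≤ K ∧ ∀ k, K ≤ k →
      (((Icc 1 k).filter fun j => ∃ i' ≤ i, ¬ P i' j).card : ℝ) ≤ 1 / (i + 1) * k := by
    intro i
    have e : ∀ᶠ k : ℕ in atTop, ∀ i' ∈ range (i + 1),
        (((Icc 1 k).filter fun j => ¬ P i' j).card : ℝ) ≤ 1 / ((i : ℝ) + 1) ^ 2 * k :=
      (eventually_all_finset _).2 fun i' _ => h i' _ (by positivity)
    obtain ⟨K, hK⟩ := eventually_atTop.1 e
    refine ⟨max i K, le_max_left _ _, fun k hk => ?_⟩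
    have hk' := hK k ((le_max_right _ _).trans hk)
    have hsub : ((Icc 1 k).filter fun j => ∃ i' ≤ i, ¬ P i' j) ⊆
        (range (i + 1)).biUnion fun i' => (Icc 1 k).filter fun j => ¬ P i' j := by
      intro j hj
      obtain ⟨hj1, i', hi', hP⟩ := mem_filter.1 hj
      exact mem_biUnion.2 ⟨i', mem_range.2 (by lia), mem_filter.2 ⟨hj1, hP⟩⟩
    have h2 := (Nat.cast_le (α := ℝ)).2 ((card_le_card hsub).trans card_biUnion_le)
    rw [Nat.cast_sum] at h2
    refine h2.trans ((sum_le_sum hk').trans ?_)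
    rw [sum_const, card_range, nsmul_eq_mul]
    have : (0 : ℝ) < i + 1 := by positivity
    push_cast
    apply le_of_eq
    field_simp
  choose K hiK hK using h1
  refine ⟨{j | ∀ i, K i ≤ j → P i j}, ?_, fun i => ?_⟩
  · apply fullDensityIdx_of_card_compl_le
    intro ε hε
    obtain ⟨i₀, hi₀⟩ := exists_nat_one_div_lt hε
    filter_upwards [eventually_ge_atTop (K i₀)] with k hk
    set I := Nat.findGreatest (fun i => K i ≤ k) k with hI
    have hI1 : ∀ i, K i ≤ k → i ≤ I := fun i hi =>
      Nat.le_findGreatest ((hiK i).trans hi) hi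
    have hI2 : K I ≤ k :=
      Nat.findGreatest_spec (P := fun i => K i ≤ k) ((hiK i₀).trans hk) hk
    have hsub : ((Icc 1 k).filter (· ∉ {j | ∀ i, K i ≤ j → P i j})) ⊆
        (Icc 1 k).filter fun j => ∃ i' ≤ I, ¬ P i' j := by
      intro j hj
      obtain ⟨hj1, hj2⟩ := mem_filter.1 hj
      rw [Set.mem_ofPred_eq] at hj2
      push Not at hj2
      obtain ⟨i, hi, hP⟩ := hj2
      exact mem_filter.2 ⟨hj1, i, hI1 i (hi.trans (mem_Icc.1 hj1).2), hP⟩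
    have h2 := (Nat.cast_le (α := ℝ)).2 (card_le_card hsub)
    refine h2.trans ((hK I k hI2).trans (mul_le_mul_of_nonneg_right ?_ (Nat.cast_nonneg _)))
    refine le_trans ?_ hi₀.le
    have : (i₀ : ℝ) ≤ I := by exact_mod_cast hI1 i₀ hk
    gcongr
  · rw [eventually_inf_principal]
    filter_upwards [eventually_ge_atTop (K i)] with j hj hJ
    exact hJ i hj

end TwoSquares

/-! ### The averaged tail -/

namespace TwoSquares

open Finset MeasureTheory

/-- The contribution of `m` to the tail `tauq`. -/
def tailTerm (q G : ℝ) (m : ℕ) (t : ℝ) : ℝ :=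
  if G ≤ |(m : ℝ) - t| then (r2 m : ℝ) * |(m : ℝ) - t| ^ (-(2 * q)) else 0

lemma tailTerm_nonneg (q G : ℝ) (m : ℕ) (t : ℝ) : 0 ≤ tailTerm q G m t := by
  rw [tailTerm]; split_ifs <;> positivity

lemma tailTerm_le (q G : ℝ) (m : ℕ) (t : ℝ) :
    tailTerm q G m t ≤ (r2 m : ℝ) * |(m : ℝ) - t| ^ (-(2 * q)) := by
  rw [tailTerm]; split_ifs <;> first | exact le_rfl | positivity

lemma tauq_eq_tsum (q t G : ℝ) : tauq q t G = ∑' m, tailTerm q G m t := by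
  refine (_root_.tsum_subtype {m : ℕ | G ≤ |(m : ℝ) - t|}
    fun m => (r2 m : ℝ) * |(m : ℝ) - t| ^ (-(2 * q))).trans ?_
  refine tsum_congr fun m => ?_
  rw [tailTerm, Set.indicator_apply]
  rfl

lemma measurable_tailTerm (q G : ℝ) (m : ℕ) : Measurable (tailTerm q G m) := by
  unfold tailTerm
  refine Measurable.ite (measurableSet_le measurable_const (by fun_prop)) ?_ measurable_const
  fun_prop

lemma tailTerm_le_of_far {q G t : ℝ} {N m : ℕ} (hq : 1 ≤ q) (hN : 2 ≤ N) (hm : N ≤ m)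
    (ht : |t| ≤ N / 2) : tailTerm q G m t ≤
      24 * (N : ℝ) ^ (-(1 / 4) : ℝ) * (m : ℝ) ^ (-(5 / 4) : ℝ) := by
  have hN2 : (2 : ℝ) ≤ N := by exact_mod_cast hN
  have hNm : (N : ℝ) ≤ m := by exact_mod_cast hm
  have h1 := tail_term_le (s := q) (E := 1 / 2) (n := m) hq (by lia : 1 ≤ N) (by norm_num)
    (by linarith) hm
  have h2 : (m : ℝ) / 2 ≤ |(m : ℝ) - t| := by
    have := le_abs_self t
    rw [abs_of_nonneg] <;> linarith
  have h3 : |(m : ℝ) - t| ^ (-(2 * q)) ≤ (4 * (1 / 2) / m : ℝ) ^ (2 * q) := by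
    have hm0 : (0 : ℝ) < m := by linarith
    rw [show (4 * (1 / 2) / m : ℝ) = ((m : ℝ) / 2)⁻¹ by field_simp; norm_num,
      Real.inv_rpow (by positivity), ← Real.rpow_neg (by positivity)]
    exact Real.rpow_le_rpow_of_nonpos (by positivity) h2 (by linarith)
  calc tailTerm q G m t ≤ _ := tailTerm_le _ _ _ _
    _ ≤ (r2 m : ℝ) * (4 * (1 / 2) / m : ℝ) ^ (2 * q) := by gcongr
    _ ≤ _ := h1
    _ = _ := by norm_num

lemma summable_tailTerm {q : ℝ} (hq : 1 ≤ q) (G t : ℝ) : Summable fun m => tailTerm q G m t := by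
  obtain ⟨N, hN⟩ := exists_nat_ge (2 * |t|)
  set M := max N 2
  have hM : |t| ≤ (M : ℝ) / 2 := by
    have : (N : ℝ) ≤ M := by exact_mod_cast le_max_left N 2
    linarith
  refine Summable.of_norm_bounded_eventually_nat
    (g := fun m => 24 * (M : ℝ) ^ (-(1 / 4) : ℝ) * (m : ℝ) ^ (-(5 / 4) : ℝ))
    (summable_five_fourths.mul_left _) ?_
  filter_upwards [eventually_ge_atTop M] with m hm
  rw [Real.norm_of_nonneg (tailTerm_nonneg _ _ _ _)]
  exact tailTerm_le_of_far hq (le_max_right N 2) hm hM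

/-- If nonzero, the integral of `tauq` can be computed termwise. -/
lemma ofReal_integral_tauq {q x G : ℝ} (hq : 1 ≤ q) (hx : 0 ≤ x)
    (h : ∫ t in x..(2 * x), tauq q t G ≠ 0) :
    ENNReal.ofReal (∫ t in x..(2 * x), tauq q t G) =
      ∑' m, ∫⁻ t in Set.Ioc x (2 * x), ENNReal.ofReal (tailTerm q G m t) := by
  rw [intervalIntegral.integral_of_le (by linarith)] at h ⊢
  have hi : IntegrableOn (fun t => tauq q t G) (Set.Ioc x (2 * x)) := by
    by_contra hc
    exact h (integral_undef hc)
  rw [ofReal_integral_eq_lintegral_ofReal hi, ← lintegral_tsum]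
  · refine lintegral_congr fun t => ?_
    rw [tauq_eq_tsum, ENNReal.ofReal_tsum_of_nonneg (fun m => tailTerm_nonneg _ _ _ _)
      (summable_tailTerm hq G t)]
  · exact fun m => (measurable_tailTerm q G m).ennreal_ofReal.aemeasurable
  · refine Eventually.of_forall fun t => ?_
    change 0 ≤ tauq q t G
    rw [tauq_eq_tsum]
    exact tsum_nonneg fun m => tailTerm_nonneg _ _ _ _

lemma lintegral_tailTerm {q G : ℝ} (hq : 1 < q) (hG : 0 < G) (m : ℕ) :
    ∫⁻ t, ENNReal.ofReal (tailTerm q G m t) =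
      ENNReal.ofReal (r2 m * (2 / (2 * q - 1) * G ^ (1 - 2 * q))) := by
  set f : ℝ → ℝ := (Set.Ici G).indicator fun v => v ^ (-(2 * q)) with hf
  have h1 : ∀ t, tailTerm q G m t = r2 m * f |t - m| := by
    intro t
    simp only [tailTerm, hf, Set.indicator_apply, abs_sub_comm (m : ℝ), Set.mem_Ici]
    split_ifs <;> simp
  have h2 : ∫ x, f |x| = 2 / (2 * q - 1) * G ^ (1 - 2 * q) := by
    have hI : Set.Ioi 0 ∩ Set.Ici G = Set.Ici G :=
      Set.inter_eq_right.2 fun y hy => hG.trans_le hy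
    rw [integral_comp_abs, hf, setIntegral_indicator measurableSet_Ici, hI,
      integral_Ici_eq_integral_Ioi, integral_Ioi_rpow_of_lt (by linarith) hG,
      show -(2 * q) + 1 = 1 - 2 * q by ring]
    have h3 : 1 - 2 * q ≠ 0 := by linarith
    have h4 : 2 * q - 1 ≠ 0 := by linarith
    field_simp
    ring
  have h3 : 0 < ∫ x, f |x| := by
    rw [h2]
    have : 0 < 2 * q - 1 := by linarith
    positivity
  have hi : Integrable fun x => f |x| := by
    by_contra hc
    exact h3.ne' (integral_undef hc)
  have hf0 : ∀ x, 0 ≤ f |x| := by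
    intro x
    simp only [hf, Set.indicator_apply]
    split_ifs <;> positivity
  calc ∫⁻ t, ENNReal.ofReal (tailTerm q G m t)
      = ∫⁻ t, ENNReal.ofReal (r2 m * f |t - m|) := lintegral_congr fun t => by rw [h1]
    _ = ∫⁻ t, ENNReal.ofReal (r2 m * f |t|) :=
        lintegral_sub_right_eq_self (fun t => ENNReal.ofReal (r2 m * f |t|)) (m : ℝ)
    _ = ENNReal.ofReal (∫ t, r2 m * f |t|) :=
        (ofReal_integral_eq_lintegral_ofReal (hi.const_mul _)
          (Eventually.of_forall fun t => mul_nonneg (Nat.cast_nonneg _) (hf0 t))).symm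
    _ = _ := by rw [integral_const_mul, h2]

theorem integral_tauq_le {q x G : ℝ} (hq : 1 < q) (hx : 1 ≤ x) (hG : 0 < G) :
    ∫ t in x..(2 * x), tauq q t G ≤
      72 / (2 * q - 1) * x * G ^ (1 - 2 * q) + 24 * x ^ (3 / 4 : ℝ) * zetaFiveFourths := by
  have hq0 : 0 < 2 * q - 1 := by linarith
  have hZ : 0 ≤ zetaFiveFourths := tsum_nonneg fun n => by positivity
  have hR : 0 ≤ 72 / (2 * q - 1) * x * G ^ (1 - 2 * q) +
    24 * x ^ (3 / 4 : ℝ) * zetaFiveFourths := by positivity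
  by_cases h0 : ∫ t in x..(2 * x), tauq q t G = 0
  · rw [h0]; exact hR
  rw [← ENNReal.ofReal_le_ofReal_iff hR, ofReal_integral_tauq hq.le (by linarith) h0]
  set M := ⌊4 * x⌋₊ with hM
  set A := 2 / (2 * q - 1) * G ^ (1 - 2 * q) with hA
  have hA0 : 0 ≤ A := by positivity
  have hM1 : (M : ℝ) ≤ 4 * x := Nat.floor_le (by linarith)
  have hM2 : 4 * x ≤ ((M + 1 : ℕ) : ℝ) := by push_cast; exact (Nat.lt_floor_add_one _).le
  have hM4 : 4 ≤ M := Nat.le_floor (by push_cast; linarith)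
  set g : ℕ → ℝ := fun m => (if m ∈ range (M + 1) then r2 m * A else 0) +
    24 * x ^ (3 / 4 : ℝ) * (m : ℝ) ^ (-(5 / 4) : ℝ) with hg
  have hg0 : ∀ m, 0 ≤ g m := by
    intro m
    rw [hg]
    have : 0 ≤ (if m ∈ range (M + 1) then r2 m * A else 0) := by split_ifs <;> positivity
    positivity
  have hgs : HasSum g (∑ m ∈ range (M + 1), r2 m * A +
      24 * x ^ (3 / 4 : ℝ) * zetaFiveFourths) := by
    refine HasSum.add ?_ (summable_five_fourths.hasSum.mul_left _)
    have : ∑ m ∈ range (M + 1), r2 m * A =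
        ∑ m ∈ range (M + 1), if m ∈ range (M + 1) then r2 m * A else 0 :=
      sum_congr rfl fun k hk => by rw [if_pos hk]
    rw [this]
    exact hasSum_sum_of_ne_finset_zero fun k hk => by rw [if_neg hk]
  have hle : ∀ m, ∫⁻ t in Set.Ioc x (2 * x), ENNReal.ofReal (tailTerm q G m t) ≤
      ENNReal.ofReal (g m) := by
    intro m
    by_cases hm : m ∈ range (M + 1)
    · refine (setLIntegral_le_lintegral _ _).trans ?_
      rw [lintegral_tailTerm hq hG]
      refine ENNReal.ofReal_le_ofReal ?_
      rw [hg]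
      simp only [if_pos hm]
      have : 0 ≤ 24 * x ^ (3 / 4 : ℝ) * (m : ℝ) ^ (-(5 / 4) : ℝ) := by positivity
      linarith
    · have hm' : M + 1 ≤ m := by rw [mem_range] at hm; lia
      have hb : ∀ t ∈ Set.Ioc x (2 * x), ENNReal.ofReal (tailTerm q G m t) ≤
          ENNReal.ofReal (24 * x ^ (-(1 / 4) : ℝ) * (m : ℝ) ^ (-(5 / 4) : ℝ)) := by
        intro t ht
        refine ENNReal.ofReal_le_ofReal ((tailTerm_le_of_far (N := M + 1) hq.le (by lia) hm'
          ?_).trans ?_)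
        · rw [abs_of_nonneg (by linarith [ht.1])]; linarith [ht.2]
        · have : ((M + 1 : ℕ) : ℝ) ^ (-(1 / 4) : ℝ) ≤ x ^ (-(1 / 4) : ℝ) :=
            Real.rpow_le_rpow_of_nonpos (by linarith) (by linarith) (by norm_num)
          gcongr
      refine (setLIntegral_mono measurable_const hb).trans ?_
      rw [setLIntegral_const, Real.volume_Ioc, ← ENNReal.ofReal_mul (by positivity)]
      refine ENNReal.ofReal_le_ofReal (le_of_eq ?_)
      rw [hg]
      simp only [if_neg hm]
      have : x ^ (3 / 4 : ℝ) = x ^ (-(1 / 4) : ℝ) * x := by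
        rw [← Real.rpow_add_one (by linarith)]; norm_num
      rw [this]; ring
  refine (ENNReal.tsum_le_tsum hle).trans ?_
  rw [← ENNReal.ofReal_tsum_of_nonneg hg0 hgs.summable, hgs.tsum_eq]
  refine ENNReal.ofReal_le_ofReal (add_le_add_left ?_ _)
  have hs : ∑ m ∈ range (M + 1), (r2 m : ℝ) ≤ 9 * M := by
    exact_mod_cast sum_r2_le_linear (by lia : 1 ≤ M)
  calc ∑ m ∈ range (M + 1), r2 m * A = (∑ m ∈ range (M + 1), (r2 m : ℝ)) * A := by rw [sum_mul]
    _ ≤ 36 * x * A := mul_le_mul_of_nonneg_right (by linarith) hA0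
    _ = _ := by rw [hA]; ring

lemma eventually_sum_r2_window_ge : ∀ᶠ x : ℝ in atTop, ∃ S : Finset ℕ,
    (∀ m ∈ S, x < m ∧ (m : ℝ) ≤ 3 / 2 * x) ∧ x / 100 ≤ ∑ m ∈ S, (r2 m : ℝ) := by
  filter_upwards [eventually_ge_atTop 10000] with x hx
  set y := Real.sqrt x with hy
  have hy2 : y ^ 2 = x := Real.sq_sqrt (by linarith)
  have hy1 : 100 ≤ y := Real.le_sqrt_of_sq_le (by norm_num; linarith)
  set a := ⌈0.71 * y⌉₊
  set b := ⌊0.86 * y⌋₊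
  have ha1 : 0.71 * y ≤ a := Nat.le_ceil _
  have ha2 : (a : ℝ) < 0.71 * y + 1 := Nat.ceil_lt_add_one (by positivity)
  have hb1 : (b : ℝ) ≤ 0.86 * y := Nat.floor_le (by positivity)
  have hb2 : 0.86 * y < b + 1 := Nat.lt_floor_add_one _
  have hab : a ≤ b := by
    have : (a : ℝ) ≤ b := by linarith
    exact_mod_cast this
  refine ⟨Ioc (2 * a ^ 2) (2 * b ^ 2), fun m hm => ?_, ?_⟩
  · obtain ⟨h1, h2⟩ := mem_Ioc.1 hm
    have h1' : (2 * (a : ℝ) ^ 2) < m := by exact_mod_cast h1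
    have h2' : (m : ℝ) ≤ 2 * (b : ℝ) ^ 2 := by exact_mod_cast h2
    constructor
    · nlinarith
    · have : (b : ℝ) ^ 2 ≤ (0.86 * y) ^ 2 := by gcongr
      nlinarith
  · have h : (((b - a) ^ 2 : ℕ) : ℝ) ≤ ∑ m ∈ Ioc (2 * a ^ 2) (2 * b ^ 2), (r2 m : ℝ) := by
      exact_mod_cast card_sq_le_sum_r2 a b
    refine le_trans ?_ h
    push_cast [hab]
    nlinarith

theorem eventually_integral_tauq_ge : ∀ᶠ x : ℝ in atTop, ∀ q G : ℝ, 1 < q → 0 < G →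
    4 * G ≤ x → ∫ t in x..(2 * x), tauq q t G ≠ 0 →
    x / 100 * (G * (2 * G) ^ (-(2 * q))) ≤ ∫ t in x..(2 * x), tauq q t G := by
  filter_upwards [eventually_sum_r2_window_ge, eventually_ge_atTop 1]
    with x ⟨S, hS, hsum⟩ hx q G hq hG hGx h0
  set B := G * (2 * G) ^ (-(2 * q)) with hB
  have hB0 : 0 ≤ B := by positivity
  have hI : 0 ≤ ∫ t in x..(2 * x), tauq q t G := by
    refine intervalIntegral.integral_nonneg (by linarith) fun t _ => ?_
    rw [tauq_eq_tsum]
    exact tsum_nonneg fun m => tailTerm_nonneg _ _ _ _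
  rw [← ENNReal.ofReal_le_ofReal_iff hI, ofReal_integral_tauq hq.le (by linarith) h0]
  refine le_trans ?_ (ENNReal.sum_le_tsum S)
  have hle : ∀ m ∈ S, ENNReal.ofReal (r2 m * B) ≤
      ∫⁻ t in Set.Ioc x (2 * x), ENNReal.ofReal (tailTerm q G m t) := by
    intro m hm
    obtain ⟨hm1, hm2⟩ := hS m hm
    have hsub : Set.Ioc ((m : ℝ) + G) (m + 2 * G) ⊆ Set.Ioc x (2 * x) := fun t ht =>
      ⟨by linarith [ht.1], by linarith [ht.2]⟩
    refine le_trans ?_ (lintegral_mono_set hsub)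
    have hb : ∀ t ∈ Set.Ioc ((m : ℝ) + G) (m + 2 * G),
        ENNReal.ofReal (r2 m * (2 * G) ^ (-(2 * q))) ≤ ENNReal.ofReal (tailTerm q G m t) := by
      intro t ht
      refine ENNReal.ofReal_le_ofReal ?_
      have h1 : |(m : ℝ) - t| = t - m := by
        rw [abs_sub_comm, abs_of_nonneg]; linarith [ht.1]
      rw [tailTerm, h1, if_pos (by linarith [ht.1])]
      have : (2 * G) ^ (-(2 * q)) ≤ (t - m) ^ (-(2 * q)) :=
        Real.rpow_le_rpow_of_nonpos (by linarith [ht.1]) (by linarith [ht.2]) (by linarith)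
      gcongr
    refine le_trans (le_of_eq ?_) (setLIntegral_mono
      (measurable_tailTerm q G m).ennreal_ofReal hb)
    rw [setLIntegral_const, Real.volume_Ioc, ← ENNReal.ofReal_mul (by positivity), hB]
    congr 1
    ring
  refine le_trans ?_ (sum_le_sum hle)
  rw [← ENNReal.ofReal_sum_of_nonneg fun m _ => mul_nonneg (Nat.cast_nonneg _) hB0, ← sum_mul]
  exact ENNReal.ofReal_le_ofReal (mul_le_mul_of_nonneg_right hsum hB0)

end TwoSquares

/-! ### The cut-off -/

namespace TwoSquares

open Finset

lemma tendsto_log_log : Tendsto (fun x : ℝ => Real.log (Real.log x)) atTop atTop :=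
  Real.tendsto_log_atTop.comp Real.tendsto_log_atTop

/-- The logarithmic size of the cut-off `G` at which the averaged tail balances `a`. -/
theorem tendsto_log_cutoff {α q : ℝ} (hq : 1 < q) {a G : ℝ → ℝ}
    (ha0 : ∀ x, 0 ≤ a x)
    (ha : Tendsto (fun x : ℝ => Real.log (a x) / Real.log (Real.log x)) atTop (𝓝 α))
    (hG : ∀ x, 0 < x → 0 < G x)
    (hGeq : ∀ᶠ x : ℝ in atTop,
      a x ^ (2 * q) * ((1 / x) * ∫ t in x..(2 * x), tauq q t (G x)) = 1) :
    Tendsto (fun x : ℝ => Real.log (G x) / Real.log (Real.log x)) atTop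
      (𝓝 (2 * q * α / (2 * q - 1))) := by
  have hq0 : 0 < 2 * q - 1 := by linarith
  have hZ : 0 ≤ zetaFiveFourths := tsum_nonneg fun n => by positivity
  set C₁ := Real.log (144 / (2 * q - 1)) with hC₁
  set C₂ := Real.log 100 + 2 * q * Real.log 2 with hC₂
  have key : ∀ᶠ x : ℝ in atTop,
      2 * q * Real.log (a x) - C₂ ≤ (2 * q - 1) * Real.log (G x) ∧
        (2 * q - 1) * Real.log (G x) ≤ 2 * q * Real.log (a x) + C₁ := by
    filter_upwards [hGeq, ha.eventually (gt_mem_nhds (lt_add_one α)),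
      eventually_mul_exp_log_log_le_rpow (C := 48 * (zetaFiveFourths + 1)) (by positivity)
        (2 * q * (α + 1)),
      eventually_mul_exp_log_log_le_rpow (C := 4 * Real.exp (C₁ / (2 * q - 1))) (by positivity)
        (2 * q * (α + 1) / (2 * q - 1)),
      tendsto_log_log.eventually_gt_atTop 0, eventually_ge_atTop 1,
      eventually_integral_tauq_ge] with x hx hax he1 he2 hw hx1 hlow
    have hx0 : 0 < x := by linarith
    have hGx := hG x hx0
    rw [div_lt_iff₀ hw] at hax
    set w := Real.log (Real.log x) with hwd
    set I := ∫ t in x..(2 * x), tauq q t (G x) with hI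
    have ha1 : 0 < a x := by
      rcases (ha0 x).eq_or_lt with h | h
      · rw [← h, Real.zero_rpow (by linarith), zero_mul] at hx
        exact absurd hx zero_ne_one
      · exact h
    have hap : 0 < a x ^ (2 * q) := Real.rpow_pos_of_pos ha1 _
    have hIe : I = x * (a x ^ (2 * q))⁻¹ := by
      field_simp at hx ⊢
      linarith
    have hI0 : 0 < I := by rw [hIe]; positivity
    have hlogI : Real.log I = Real.log x - 2 * q * Real.log (a x) := by
      rw [hIe, Real.log_mul hx0.ne' (by positivity), Real.log_inv, Real.log_rpow ha1]; ring
    have hup := integral_tauq_le hq hx1 hGx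
    rw [← hI] at hup
    have hIge : 48 * x ^ (3 / 4 : ℝ) * zetaFiveFourths ≤ I := by
      have h1 : a x ^ (2 * q) ≤ Real.exp (2 * q * (α + 1) * w) := by
        rw [Real.rpow_def_of_pos ha1]
        apply Real.exp_le_exp.2
        nlinarith
      have h2 : 48 * zetaFiveFourths * a x ^ (2 * q) ≤ x ^ (1 / 4 : ℝ) := by
        refine le_trans ?_ he1
        gcongr
        linarith
      have h3 : x ^ (3 / 4 : ℝ) * x ^ (1 / 4 : ℝ) = x := by
        rw [← Real.rpow_add hx0]; norm_num
      rw [hIe, ← div_eq_mul_inv, le_div_iff₀ hap]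
      calc 48 * x ^ (3 / 4 : ℝ) * zetaFiveFourths * a x ^ (2 * q)
          = x ^ (3 / 4 : ℝ) * (48 * zetaFiveFourths * a x ^ (2 * q)) := by ring
        _ ≤ x ^ (3 / 4 : ℝ) * x ^ (1 / 4 : ℝ) := by gcongr
        _ = x := h3
    have hGp : 0 < G x ^ (1 - 2 * q) := Real.rpow_pos_of_pos hGx _
    have hup2 : (2 * q - 1) * Real.log (G x) ≤ 2 * q * Real.log (a x) + C₁ := by
      have h1 : I ≤ 144 / (2 * q - 1) * x * G x ^ (1 - 2 * q) := by
        have : 144 / (2 * q - 1) * x * G x ^ (1 - 2 * q) =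
          2 * (72 / (2 * q - 1) * x * G x ^ (1 - 2 * q)) := by ring
        linarith
      have h2 := Real.log_le_log hI0 h1
      rw [hlogI, Real.log_mul (by positivity) hGp.ne', Real.log_mul (by positivity) hx0.ne',
        Real.log_rpow hGx] at h2
      linarith
    refine ⟨?_, hup2⟩
    have hGx4 : 4 * G x ≤ x := by
      have h1 : Real.log (G x) ≤ C₁ / (2 * q - 1) + 2 * q * (α + 1) / (2 * q - 1) * w := by
        have : C₁ / (2 * q - 1) + 2 * q * (α + 1) / (2 * q - 1) * w =
          (2 * q * ((α + 1) * w) + C₁) / (2 * q - 1) := by field_simp; ring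
        rw [this, le_div_iff₀ hq0]
        nlinarith
      have h2 : G x ≤ Real.exp (C₁ / (2 * q - 1)) *
          Real.exp (2 * q * (α + 1) / (2 * q - 1) * w) := by
        rw [← Real.exp_add]
        exact (Real.log_le_iff_le_exp hGx).1 h1
      have h3 : x ^ (1 / 4 : ℝ) ≤ x := by
        conv_rhs => rw [← Real.rpow_one x]
        exact Real.rpow_le_rpow_of_exponent_le hx1 (by norm_num)
      linarith
    have h1 := Real.log_le_log (by positivity) (hlow q (G x) hq hGx hGx4 hI0.ne')
    rw [← hI, hlogI, Real.log_mul (by positivity) (by positivity), Real.log_div hx0.ne'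
      (by norm_num), Real.log_mul hGx.ne' (by positivity), Real.log_rpow (by positivity),
      Real.log_mul (by norm_num) hGx.ne'] at h1
    linarith
  have hinv := tendsto_log_log.inv_tendsto_atTop
  have hlim : ∀ C : ℝ, Tendsto (fun x : ℝ => 2 * q / (2 * q - 1) *
      (Real.log (a x) / Real.log (Real.log x)) + C / (2 * q - 1) * (Real.log (Real.log x))⁻¹)
      atTop (𝓝 (2 * q * α / (2 * q - 1))) := by
    intro C
    have := (ha.const_mul (2 * q / (2 * q - 1))).add (hinv.const_mul (C / (2 * q - 1)))
    rw [mul_zero, add_zero, div_mul_eq_mul_div] at this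
    exact this
  refine tendsto_of_tendsto_of_tendsto_of_le_of_le' (hlim (-C₂)) (hlim C₁) ?_ ?_
  · filter_upwards [key, tendsto_log_log.eventually_gt_atTop 0] with x ⟨h1, _⟩ hw
    rw [le_div_iff₀ hw]
    have : (2 * q / (2 * q - 1) * (Real.log (a x) / Real.log (Real.log x)) +
      -C₂ / (2 * q - 1) * (Real.log (Real.log x))⁻¹) * Real.log (Real.log x) =
      (2 * q * Real.log (a x) - C₂) / (2 * q - 1) := by field_simp; ring
    rw [this, div_le_iff₀ hq0]
    linarith
  · filter_upwards [key, tendsto_log_log.eventually_gt_atTop 0] with x ⟨_, h2⟩ hw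
    rw [div_le_iff₀ hw]
    have : (2 * q / (2 * q - 1) * (Real.log (a x) / Real.log (Real.log x)) +
      C₁ / (2 * q - 1) * (Real.log (Real.log x))⁻¹) * Real.log (Real.log x) =
      (2 * q * Real.log (a x) + C₁) / (2 * q - 1) := by field_simp
    rw [this, le_div_iff₀ hq0]
    linarith

end TwoSquares

/-! ### Fractal exponents along a full density set -/

namespace TwoSquares

open Finset

lemma FullDensityIdx.neBot {J : Set ℕ} (hJ : FullDensityIdx J) : (atTop ⊓ 𝓟 J).NeBot := by
  rw [← frequently_mem_iff_neBot, Nat.frequently_atTop_iff_infinite]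
  intro hfin
  have h0 : Tendsto (fun k : ℕ => (Nat.card ↥(J ∩ Set.Icc 1 k) : ℝ) / (k : ℝ)) atTop (𝓝 0) := by
    refine squeeze_zero (fun k => by positivity) (fun k => ?_)
      (tendsto_const_div_atTop_nhds_zero_nat (Nat.card J : ℝ))
    have : Nat.card ↥(J ∩ Set.Icc 1 k) ≤ Nat.card J :=
      Nat.card_mono hfin Set.inter_subset_left
    gcongr
  exact zero_ne_one (tendsto_nhds_unique h0 hJ)

lemma tendsto_min_of_eventually_ge {F : Filter ℕ} {f : ℕ → ℝ} {a : ℝ}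
    (h : ∀ i : ℕ, ∀ᶠ j in F, a - 1 / ((i : ℝ) + 1) ≤ f j) :
    Tendsto (fun j => min (f j) a) F (𝓝 a) := by
  refine tendsto_order.2 ⟨fun b hb => ?_, fun b hb =>
    Eventually.of_forall fun j => (min_le_right _ _).trans_lt hb⟩
  obtain ⟨i, hi⟩ := exists_nat_one_div_lt (sub_pos.2 hb)
  filter_upwards [h i] with j hj
  exact lt_min (by linarith) hb

lemma tendsto_max_of_eventually_le {F : Filter ℕ} {f : ℕ → ℝ} {a : ℝ}
    (h : ∀ i : ℕ, ∀ᶠ j in F, f j ≤ a + 1 / ((i : ℝ) + 1)) :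
    Tendsto (fun j => max (f j) a) F (𝓝 a) := by
  refine tendsto_order.2 ⟨fun b hb => Eventually.of_forall fun j =>
    hb.trans_le (le_max_right _ _), fun b hb => ?_⟩
  obtain ⟨i, hi⟩ := exists_nat_one_div_lt (sub_pos.2 hb)
  filter_upwards [h i] with j hj
  exact max_lt (by linarith) hb

lemma le_limsup_le_of_tendsto {F : Filter ℕ} [F.NeBot] {l u v : ℕ → ℝ} {a b : ℝ}
    (hl : Tendsto l F (𝓝 a)) (hv : Tendsto v F (𝓝 b)) (hlu : ∀ᶠ j in F, l j ≤ u j)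
    (huv : ∀ᶠ j in F, u j ≤ v j) : a ≤ limsup u F ∧ limsup u F ≤ b := by
  have hub : F.IsBoundedUnder (· ≤ ·) u := hv.isBoundedUnder_le.mono_le huv
  have hlb : F.IsBoundedUnder (· ≥ ·) u := hl.isBoundedUnder_ge.mono_ge hlu
  constructor
  · rw [← hl.limsup_eq]
    exact limsup_le_limsup hlu hl.isBoundedUnder_ge.isCoboundedUnder_le hub
  · rw [← hv.limsup_eq]
    exact limsup_le_limsup huv hlb.isCoboundedUnder_le hv.isBoundedUnder_le

open Classical in
lemma card_filter_not_le_add (S : Finset ℕ) {p r s : ℕ → Prop} (h : ∀ j, p j → r j → s j) :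
    (S.filter fun j => ¬ s j).card ≤
      (S.filter fun j => ¬ p j).card + (S.filter fun j => ¬ r j).card := by
  refine (card_le_card fun j hj => ?_).trans (card_union_le _ _)
  have := h j
  simp only [mem_union, mem_filter] at hj ⊢
  tauto

open Classical in
/-- Two almost sure moment bounds hold along a common full density set of indices. -/
lemma Interlaced.exists_fullDensityIdx_goodMoment {nseq : ℕ → ℕ} {lam : ℕ → ℝ} {ntil : ℕ → ℕ}
    {D : ℕ → ℝ} (h : Interlaced nseq lam ntil D) {α : ℝ} (hα : 0 ≤ α)
    (havg : Tendsto (fun x : ℝ => Real.log (avgD lam D x) / Real.log (Real.log x)) atTop (𝓝 α))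
    {s t : ℝ} (hs : 1 ≤ s) (ht : 1 ≤ t) :
    ∃ J : Set ℕ, FullDensityIdx J ∧ ∀ i : ℕ, ∀ᶠ j in atTop ⊓ 𝓟 J,
      GoodMoment α s (1 / (i + 1)) (lam j) (D j) ∧
        GoodMoment α t (1 / (i + 1)) (lam j) (D j) := by
  refine exists_fullDensityIdx (fun i j => GoodMoment α s (1 / (i + 1)) (lam j) (D j) ∧
        GoodMoment α t (1 / (i + 1)) (lam j) (D j)) fun i δ hδ => ?_
  have hi : (0 : ℝ) < 1 / (i + 1) := by positivity
  filter_upwards [eventually_card_not_goodMoment_le h hα havg hs hi (half_pos hδ),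
    eventually_card_not_goodMoment_le h hα havg ht hi (half_pos hδ)] with k h1 h2
  have h3 := (Nat.cast_le (α := ℝ)).2 (card_filter_not_le_add (Icc 1 k)
    (p := fun j => GoodMoment α s (1 / (i + 1)) (lam j) (D j))
    (r := fun j => GoodMoment α t (1 / (i + 1)) (lam j) (D j))
    (s := fun j => GoodMoment α s (1 / (i + 1)) (lam j) (D j) ∧
      GoodMoment α t (1 / (i + 1)) (lam j) (D j)) fun j hp hr => ⟨hp, hr⟩)
  push_cast at h3
  exact h3.trans (by linarith)

end TwoSquares

open TwoSquares

/-- Strong coupling: a multifractal scaling law for the fractal exponents. -/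
theorem strong_coupling_multifractal
    (α : ℝ) (hα : α ∈ Set.Ioo (1 / 4 : ℝ) (1 / 2))
    (nseq : ℕ → ℕ) (hmono : StrictMono nseq) (hrange : Set.range nseq = SOS)
    (lam : ℕ → ℝ)
    (hinter : ∀ j : ℕ, 1 ≤ j → (nseq (j - 1) : ℝ) < lam j ∧ lam j < (nseq j : ℝ))
    (ntil : ℕ → ℕ) (D : ℕ → ℝ)
    (hD : ∀ j, D j = |(ntil j : ℝ) - lam j|)
    (hnear : ∀ j, ntil j ∈ SOS ∧
      (∀ m ∈ SOS, |(ntil j : ℝ) - lam j| ≤ |(m : ℝ) - lam j|) ∧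
      (∀ m ∈ SOS, |(m : ℝ) - lam j| = |(ntil j : ℝ) - lam j| → ntil j ≤ m))
    (havg : Tendsto (fun x : ℝ => Real.log (avgD lam D x) / Real.log (Real.log x))
      atTop (𝓝 α))
    (q : ℝ) (hq : 1 < q)
    (hql : (1 - Real.log 2) / (2 - 4 * α) < q) (hqu : q ≤ 1 / (2 - 4 * α))
    (G : ℝ → ℝ) (hGpos : ∀ x : ℝ, 0 < x → 0 < G x)
    (hGgrow : Tendsto (fun x : ℝ => G x / Real.sqrt (Real.log x)) atTop atTop)
    (hGeq : ∀ᶠ x : ℝ in atTop,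
      avgD lam D x ^ (2 * q) * ((1 / x) * ∫ t in x..(2 * x), tauq q t (G x)) = 1) :
    ∃ (J : Set ℕ) (c : ℝ), FullDensityIdx J ∧ c ∈ Set.Icc (1 / 2 * Real.log 2) 1 ∧
      Tendsto (fun j : ℕ => Real.log (mq q (lam j) (D j)) /
          Real.log (2 * Real.pi * G (lam j)))
        (atTop ⊓ 𝓟 J)
        (𝓝 (1 / (2 * α) * (1 - 1 / (2 * q)) * Real.log 2)) ∧
      Filter.limsup (fun j : ℕ =>
          (Real.log (mq q (lam j) (D j)) - q * Real.log (mq 1 (lam j) (D j))) /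
            ((1 - q) * Real.log (2 * Real.pi * G (lam j)))) (atTop ⊓ 𝓟 J)
        = 1 / (2 * α) * (1 - 1 / (2 * q)) * (2 * c * q - Real.log 2) / (q - 1) := by
  have hI : Interlaced nseq lam ntil D :=
    ⟨hmono, hrange, hinter, hD, fun j => (hnear j).1, fun j => (hnear j).2.1⟩
  have hα0 : 0 < α := by linarith [hα.1]
  have hq1 : 0 < q - 1 := by linarith
  have hl2 := log_two_half_bounds
  have hα4 : 0 < 2 - 4 * α := by linarith [hα.2]
  have hexpq : momentExp α q = Real.log 2 / 2 := by
    rw [div_lt_iff₀ hα4] at hql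
    exact max_eq_left (by linarith)
  have hexp1 : momentExp α 1 ≤ 1 / 2 := max_le (by linarith) (by linarith [hα.2])
  obtain ⟨J, hJ, hgood⟩ := hI.exists_fullDensityIdx_goodMoment hα0.le havg le_rfl hq.le
  have hne := hJ.neBot
  set F := atTop ⊓ 𝓟 J
  set L : ℕ → ℝ := fun j => Real.log (Real.log (lam j)) with hL
  have hlam : Tendsto lam F atTop := hI.tendsto_lam.mono_left inf_le_left
  have hLpos : ∀ᶠ j in F, 0 < L j := (tendsto_log_log.comp hlam).eventually_gt_atTop 0
  set f : ℕ → ℝ := fun j => Real.log (mq q (lam j) (D j)) / L j with hf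
  set y : ℕ → ℝ := fun j => Real.log (mq 1 (lam j) (D j)) / L j with hy
  set g : ℕ → ℝ := fun j => Real.log (2 * Real.pi * G (lam j)) / L j with hg
  set γ := 2 * q * α / (2 * q - 1) with hγ
  have hq2 : 0 < 2 * q - 1 := by linarith
  have hγ0 : 0 < γ := by positivity
  have hgl : Tendsto g F (𝓝 γ) := by
    have h1 := tendsto_log_cutoff hq (a := avgD lam D) (G := G) (fun x => ?_) havg hGpos hGeq
    · have h2 := (h1.add ((tendsto_log_log.inv_tendsto_atTop).const_mul
        (Real.log (2 * Real.pi)))).comp hlam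
      rw [mul_zero, add_zero] at h2
      refine h2.congr' ?_
      filter_upwards [hlam.eventually_gt_atTop 0] with j hj
      have hp : (2 * Real.pi) ≠ 0 := by positivity
      simp only [Function.comp, Pi.inv_apply, hg, hL]
      rw [Real.log_mul hp (hGpos _ hj).ne', add_div, add_comm]
      rfl
    · rw [avgD]
      exact div_nonneg (tsum_nonneg fun k => hI.D_nonneg _) (Nat.cast_nonneg _)
  have hfl : ∀ i : ℕ, ∀ᶠ j in F, Real.log 2 / 2 - 1 / ((i : ℝ) + 1) ≤ f j := by
    intro i
    filter_upwards [hgood i, hLpos] with j ⟨_, hj, _⟩ hLj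
    rwa [hf, le_div_iff₀ hLj]
  have hfu : ∀ i : ℕ, ∀ᶠ j in F, f j ≤ Real.log 2 / 2 + 1 / ((i : ℝ) + 1) := by
    intro i
    filter_upwards [hgood i, hLpos] with j ⟨_, _, hj⟩ hLj
    rw [hexpq] at hj
    rwa [hf, div_le_iff₀ hLj]
  have hyl : ∀ i : ℕ, ∀ᶠ j in F, Real.log 2 / 2 - 1 / ((i : ℝ) + 1) ≤ y j := by
    intro i
    filter_upwards [hgood i, hLpos] with j ⟨⟨hj, _⟩, _⟩ hLj
    rwa [hy, le_div_iff₀ hLj]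
  have hyu : ∀ i : ℕ, ∀ᶠ j in F, y j ≤ 1 / 2 + 1 / ((i : ℝ) + 1) := by
    intro i
    filter_upwards [hgood i, hLpos] with j ⟨⟨_, hj⟩, _⟩ hLj
    rw [hy, div_le_iff₀ hLj]
    exact hj.trans (mul_le_mul_of_nonneg_right (by linarith) hLj.le)
  have hft : Tendsto f F (𝓝 (Real.log 2 / 2)) :=
    tendsto_of_tendsto_of_tendsto_of_le_of_le (tendsto_min_of_eventually_ge hfl)
      (tendsto_max_of_eventually_le hfu) (fun j => min_le_left _ _) fun j => le_max_left _ _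
  have hden : (q - 1) * γ ≠ 0 := by positivity
  have hlow := (((tendsto_min_of_eventually_ge hyl).const_mul q).sub hft).div
    (hgl.const_mul (q - 1)) hden
  have hupp := (((tendsto_max_of_eventually_le hyu).const_mul q).sub hft).div
    (hgl.const_mul (q - 1)) hden
  have hgpos : ∀ᶠ j in F, 0 < g j := hgl.eventually (lt_mem_nhds hγ0)
  set u : ℕ → ℝ := fun j => (Real.log (mq q (lam j) (D j)) - q * Real.log (mq 1 (lam j) (D j))) /
    ((1 - q) * Real.log (2 * Real.pi * G (lam j))) with hu
  have hue : ∀ᶠ j in F, u j = (q * y j - f j) / ((q - 1) * g j) := by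
    filter_upwards [hLpos, hgpos] with j hLj hgj
    have e : Real.log (2 * Real.pi * G (lam j)) ≠ 0 := by
      intro h0
      simp only [hg, h0, zero_div, lt_irrefl] at hgj
    have e1 : 1 - q ≠ 0 := by linarith
    have e2 := hLj.ne'
    simp only [hu, hy, hf, hg]
    field_simp
    ring
  obtain ⟨hS1, hS2⟩ := le_limsup_le_of_tendsto (u := u) hlow hupp
    (by
      filter_upwards [hue, hgpos] with j hj hgj
      rw [hj]
      simp only [Pi.div_apply]
      gcongr
      exact min_le_left _ _)
    (by
      filter_upwards [hue, hgpos] with j hj hgj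
      rw [hj]
      simp only [Pi.div_apply]
      gcongr
      exact le_max_left _ _)
  set S := limsup u F
  have hSγ1 : (q - 1) * (Real.log 2 / 2) ≤ S * ((q - 1) * γ) := by
    rw [div_le_iff₀ (by positivity)] at hS1
    linarith
  have hSγ2 : S * ((q - 1) * γ) ≤ q * (1 / 2) - Real.log 2 / 2 := by
    rwa [le_div_iff₀ (by positivity)] at hS2
  have hA : 1 / (2 * α) * (1 - 1 / (2 * q)) = 1 / (2 * γ) := by
    rw [hγ]
    field_simp
  refine ⟨J, (2 * (S * ((q - 1) * γ)) + Real.log 2) / (2 * q), hJ, ⟨?_, ?_⟩, ?_, ?_⟩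
  · rw [le_div_iff₀ (by positivity)]
    linarith
  · rw [div_le_one (by positivity)]
    linarith
  · have h1 := hft.div hgl hγ0.ne'
    have e : 1 / (2 * α) * (1 - 1 / (2 * q)) * Real.log 2 = Real.log 2 / 2 / γ := by
      rw [hA]; field_simp
    rw [e]
    refine h1.congr' ?_
    filter_upwards [hLpos] with j hLj
    simp only [Pi.div_apply, hf, hg]
    exact div_div_div_cancel_right₀ hLj.ne' _ _
  · rw [hA]
    have : q - 1 ≠ 0 := hq1.ne'
    field_simp
    ring
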